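/- Let p be an odd prime such that at least one of 2, 3, or 7 is a quadratic non-residue modulo p. Then the projective special linear group PSL(2, p) occurs as a Galois group over ℚ; that is, there exists a finite Galois extension M/ℚ with Gal(M/ℚ) isomorphic to PSL(2, p). -/

import Mathlib

set_option maxHeartbeats 400000
namespace Shih
open PowerSeries

/-- Power series over `ℂ` converging absolutely on the open unit disc. -/
def Conv : Subring ℂ⟦X⟧ where
  carrier := {f | ∀ q : ℂ, ‖q‖ < 1 → Summable fun n => ‖coeff n f * q ^ n‖}
  mul_mem' := by
    intro f g hf hg q hq
    have := summable_norm_sum_mul_antidiagonal_of_summable_norm (hf q hq) (hg q hq)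
    refine this.congr fun n => ?_
    rw [coeff_mul, Finset.sum_mul]
    congr 1
    refine Finset.sum_congr rfl fun k hk => ?_
    rw [← Finset.HasAntidiagonal.mem_antidiagonal.1 hk, pow_add]; ring
  one_mem' := by
    intro q hq
    refine summable_of_ne_finset_zero (s := {0}) ?_
    intro n hn
    simp [coeff_one] at *
    simp [hn]
  add_mem' := by
    intro f g hf hg q hq
    refine Summable.of_nonneg_of_le (fun n => norm_nonneg _) (fun n => ?_) ((hf q hq).add (hg q hq))
    rw [map_add, add_mul]; exact norm_add_le _ _
  zero_mem' := by
    intro q hq; simp [summable_zero]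
  neg_mem' := by
    intro f hf q hq
    simpa using hf q hq

/-- Evaluation at a point of the disc. -/
noncomputable def ev (q : ℂ) (hq : ‖q‖ < 1) : Conv →+* ℂ where
  toFun f := ∑' n, coeff n f.1 * q ^ n
  map_one' := by
    rw [tsum_eq_single 0]
    · simp
    · intro n hn; simp [coeff_one, hn]
  map_mul' := by
    intro f g
    rw [tsum_mul_tsum_eq_tsum_sum_antidiagonal_of_summable_norm (f.2 q hq) (g.2 q hq)]
    refine tsum_congr fun n => ?_
    rw [Subring.coe_mul, coeff_mul, Finset.sum_mul]
    refine Finset.sum_congr rfl fun k hk => ?_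
    rw [← Finset.HasAntidiagonal.mem_antidiagonal.1 hk, pow_add]; ring
  map_zero' := by simp
  map_add' := by
    intro f g
    rw [← Summable.tsum_add (f.2 q hq).of_norm (g.2 q hq).of_norm]
    refine tsum_congr fun n => ?_
    rw [Subring.coe_add, map_add]; ring

theorem ev_hasSum (f : Conv) (q : ℂ) (hq : ‖q‖ < 1) :
    HasSum (fun n => coeff n f.1 * q ^ n) (ev q hq f) :=
  (f.2 q hq).of_norm.hasSum

theorem mem_Conv_of_summable (f : ℂ⟦X⟧)
    (h : ∀ q : ℂ, ‖q‖ < 1 → Summable fun n => coeff n f * q ^ n) : f ∈ Conv := by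
  intro q hq
  obtain ⟨r, hr1, hr2⟩ := exists_between hq
  have hr0 : 0 < r := lt_of_le_of_lt (norm_nonneg _) hr1
  have h1 := (h (r : ℂ) (by simpa [abs_of_pos hr0] using hr2)).tendsto_atTop_zero
  obtain ⟨C, hC⟩ := h1.norm.bddAbove_range
  have hgeo : Summable fun n : ℕ => C * (‖q‖ / r) ^ n :=
    (summable_geometric_of_lt_one (by positivity) ((div_lt_one hr0).2 hr1)).mul_left _
  refine Summable.of_nonneg_of_le (fun n => norm_nonneg _) (fun n => ?_) hgeo
  have h2 : ‖coeff n f‖ * r ^ n ≤ C := by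
    have := hC ⟨n, rfl⟩
    simpa [abs_of_pos hr0] using this
  calc ‖coeff n f * q ^ n‖ = (‖coeff n f‖ * r ^ n) * (‖q‖ / r) ^ n := by
        rw [norm_mul, norm_pow, div_pow]; field_simp
    _ ≤ _ := by gcongr

theorem hasFPower (f : Conv) :
    HasFPowerSeriesOnBall (fun q => ∑' n, coeff n f.1 * q ^ n)
      (FormalMultilinearSeries.ofScalars ℂ (fun n => coeff n f.1)) 0 1 where
  r_le := by
    refine ENNReal.le_of_forall_nnreal_lt fun r hr => ?_
    refine FormalMultilinearSeries.le_radius_of_summable_norm _ ?_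
    have := f.2 (r : ℂ) (by simpa using hr)
    refine this.congr fun n => ?_
    simp
  r_pos := one_pos
  hasSum := by
    intro y hy
    have hy' : ‖y‖ < 1 := by simpa [← ofReal_norm] using hy
    have := ev_hasSum f y hy'
    rw [zero_add]
    refine this.congr_fun fun n => ?_
    simp [FormalMultilinearSeries.ofScalars]

theorem ev_inj (f g : Conv) (h : ∀ (q : ℂ) (hq : ‖q‖ < 1), ev q hq f = ev q hq g) : f = g := by
  have h1 := (hasFPower f).hasFPowerSeriesAt
  have h2 := (hasFPower g).hasFPowerSeriesAt
  have h3 : (fun q : ℂ => ∑' n, coeff n f.1 * q ^ n) =ᶠ[nhds 0]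
      (fun q => ∑' n, coeff n g.1 * q ^ n) := by
    filter_upwards [Metric.ball_mem_nhds (0 : ℂ) one_pos] with q hq
    exact h q (by simpa using hq)
  have h4 := (h1.congr h3).eq_formalMultilinearSeries h2
  have h5 := FormalMultilinearSeries.ofScalars_series_injective ℂ ℂ h4
  ext n
  exact congrFun h5 n

/-- It is enough to test on the punctured disc. -/
theorem ev_inj' (f g : Conv) (h : ∀ (q : ℂ) (hq : ‖q‖ < 1), q ≠ 0 → ev q hq f = ev q hq g) :
    f = g := by
  have hX : (X : ℂ⟦X⟧) ∈ Conv := by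
    intro q hq
    refine summable_of_ne_finset_zero (s := {1}) ?_
    intro n hn
    simp only [Finset.mem_singleton] at hn
    simp [coeff_X, hn]
  have : (⟨X, hX⟩ : Conv) * f = ⟨X, hX⟩ * g := by
    refine ev_inj _ _ fun q hq => ?_
    rw [map_mul, map_mul]
    by_cases h0 : q = 0
    · have : ev q hq ⟨X, hX⟩ = 0 := by
        subst h0
        change ∑' n, coeff n (X : ℂ⟦X⟧) * (0 : ℂ) ^ n = 0
        rw [← tsum_zero (α := ℂ) (β := ℕ)]
        refine tsum_congr fun n => ?_
        rcases n with _ | n <;> simp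
      rw [this]; simp
    · rw [h q hq h0]
  have h2 := congrArg Subtype.val this
  simp only [Subring.coe_mul] at h2
  exact Subtype.ext (mul_left_cancel₀ X_ne_zero h2)

theorem X_mem : (X : ℂ⟦X⟧) ∈ Conv := by
  intro q hq
  refine summable_of_ne_finset_zero (s := {1}) ?_
  intro n hn
  simp only [Finset.mem_singleton] at hn
  simp [coeff_X, hn]

theorem ev_X (q : ℂ) (hq : ‖q‖ < 1) : ev q hq ⟨X, X_mem⟩ = q := by
  change ∑' n, coeff n (X : ℂ⟦X⟧) * q ^ n = q
  rw [tsum_eq_single 1]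
  · simp
  · intro n hn; simp [coeff_X, hn]

theorem C_mem (c : ℂ) : (C c : ℂ⟦X⟧) ∈ Conv := by
  intro q hq
  refine summable_of_ne_finset_zero (s := {0}) ?_
  intro n hn
  simp only [Finset.mem_singleton] at hn
  simp [coeff_C, hn]

theorem ev_C (c : ℂ) (q : ℂ) (hq : ‖q‖ < 1) : ev q hq ⟨C c, C_mem c⟩ = c := by
  change ∑' n, coeff n (C c : ℂ⟦X⟧) * q ^ n = c
  rw [tsum_eq_single 0]
  · simp
  · intro n hn; simp [coeff_C, hn]

/-- the convergence and value relation -/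
def Val (f : ℂ⟦X⟧) (φ : ℂ → ℂ) : Prop :=
  ∀ q : ℂ, ‖q‖ < 1 → HasSum (fun n => coeff n f * q ^ n) (φ q)

theorem Val.mem {f : ℂ⟦X⟧} {φ : ℂ → ℂ} (h : Val f φ) : f ∈ Conv :=
  mem_Conv_of_summable f fun q hq => (h q hq).summable

theorem Val.ev {f : ℂ⟦X⟧} {φ : ℂ → ℂ} (h : Val f φ) (hf : f ∈ Conv) (q : ℂ) (hq : ‖q‖ < 1) :
    ev q hq ⟨f, hf⟩ = φ q := (ev_hasSum ⟨f, hf⟩ q hq).unique (h q hq)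

theorem Val.expand {f : ℂ⟦X⟧} {φ : ℂ → ℂ} (h : Val f φ) (k : ℕ) (hk : k ≠ 0) :
    Val (PowerSeries.expand k hk f) (fun q => φ (q ^ k)) := by
  intro q hq
  have h1 := h (q ^ k) (by rw [norm_pow]; exact pow_lt_one₀ (norm_nonneg _) hq hk)
  have hinj : Function.Injective (fun n : ℕ => k * n) := fun a b hab => by
    simpa [hk] using hab
  rw [← hinj.hasSum_iff]
  · refine (h1.congr_fun ?_)
    intro n
    simp [coeff_expand_mul, pow_mul]
  · intro n hn
    have : ¬ k ∣ n := fun ⟨m, hm⟩ => hn ⟨m, hm.symm⟩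
    simp [coeff_expand_of_not_dvd, this]

theorem Val.rescale {f : ℂ⟦X⟧} {φ : ℂ → ℂ} (h : Val f φ) (u : ℂ) (hu : ‖u‖ ≤ 1) :
    Val (PowerSeries.rescale u f) (fun q => φ (u * q)) := by
  intro q hq
  have h1 := h (u * q) (by
    rw [norm_mul]; exact lt_of_le_of_lt (mul_le_of_le_one_left (norm_nonneg _) hu) hq)
  refine h1.congr_fun ?_
  intro n
  rw [coeff_rescale, mul_pow]; ring

end Shih

set_option maxHeartbeats 400000
set_option linter.all false
namespace Shih
open PowerSeries

theorem tendsto_iter {F : Finset ℕ → ℂ → ℂ} {f : ℂ → ℂ}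
    (h : TendstoLocallyUniformlyOn F f Filter.atTop (Metric.ball 0 1))
    (hF : ∀ s, Differentiable ℂ (F s)) (n : ℕ) :
    TendstoLocallyUniformlyOn (fun s => deriv^[n] (F s)) (deriv^[n] f) Filter.atTop
      (Metric.ball 0 1) ∧ ∀ s, Differentiable ℂ (deriv^[n] (F s)) := by
  induction n with
  | zero => exact ⟨h, hF⟩
  | succ n ih =>
    obtain ⟨h1, h2⟩ := ih
    constructor
    · have := h1.deriv (Filter.Eventually.of_forall fun s => (h2 s).differentiableOn) Metric.isOpen_ball
      simp only [Function.iterate_succ', Function.comp_def] at *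
      exact this
    · intro s
      rw [Function.iterate_succ']
      exact (h2 s).deriv

theorem poly_iter_deriv (P : Polynomial ℂ) (n : ℕ) :
    deriv^[n] (fun q => P.eval q) = fun q => (Polynomial.derivative^[n] P).eval q := by
  induction n with
  | zero => rfl
  | succ n ih =>
    rw [Function.iterate_succ', Function.comp_apply, ih]
    funext q
    rw [Function.iterate_succ', Function.comp_apply, Polynomial.deriv]

/-- Euler function. -/
noncomputable def eul (q : ℂ) : ℂ := ∏' n, (1 - q ^ (n + 1))

theorem eul_taylor (n : ℕ) :
    iteratedDeriv n eul 0 = (n.factorial : ℂ) * ((coeff n (pentagonalSeries ℤ) : ℤ) : ℂ) := by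
  have h0 := ModularForm.multipliableLocallyUniformlyOn_one_sub_pow.hasProdLocallyUniformlyOn
  rw [hasProdLocallyUniformlyOn_iff_tendstoLocallyUniformlyOn] at h0
  have h1 := (tendsto_iter h0 (fun s => by fun_prop) n).1
  have h2 := h1.tendsto_at (Metric.mem_ball_self one_pos)
  rw [iteratedDeriv_eq_iterate]
  refine tendsto_nhds_unique h2 ?_
  have h3 := PowerSeries.coeff_prod_one_sub_X_pow_eventually_eq ℤ n
  refine tendsto_nhds_of_eventually_eq ?_
  filter_upwards [h3] with s hs
  let P : Polynomial ℤ := ∏ n ∈ s, (1 - Polynomial.X ^ (n + 1))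
  have h4 : (fun q : ℂ => ∏ i ∈ s, (1 - q ^ (i + 1))) = fun q => (P.map (Int.castRingHom ℂ)).eval q := by
    funext q
    simp [P, Polynomial.map_prod, Polynomial.eval_prod]
  have h5 : coeff n (∏ n ∈ s, (1 - X ^ (n + 1) : ℤ⟦X⟧)) = P.coeff n := by
    rw [← Polynomial.coeff_coe]
    congr 1
    rw [← Polynomial.coeToPowerSeries.ringHom_apply]
    simp only [P, map_prod, map_sub, map_one, map_pow]
    simp
  rw [← hs, h5]
  beta_reduce
  rw [h4, poly_iter_deriv]
  show (Polynomial.derivative^[n] _).eval 0 = _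
  rw [← Polynomial.coeff_zero_eq_eval_zero, Polynomial.coeff_iterate_derivative]
  simp [Nat.descFactorial_self]

theorem eul_val : Val (PowerSeries.map (Int.castRingHom ℂ) (pentagonalSeries ℤ)) eul := by
  intro q hq
  have := Complex.hasSum_taylorSeries_on_ball (r := 1) (c := 0) (z := q)
    ModularForm.differentiableOn_tprod_one_sub_pow (by simpa using hq)
  refine this.congr_fun fun n => ?_
  have h := eul_taylor n
  unfold eul at h
  rw [h]
  have : (n.factorial : ℂ) ≠ 0 := by exact_mod_cast n.factorial_ne_zero
  simp
  field_simp

open Complex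

/-- fourth power of eta -/
noncomputable def E4 (z : ℂ) : ℂ := ModularForm.eta z ^ 4

theorem qpar_eq (z : ℂ) : Function.Periodic.qParam 1 z = cexp (2 * Real.pi * I * z) := by
  simp [Function.Periodic.qParam]

theorem norm_q_lt {z : ℂ} (hz : 0 < z.im) : ‖cexp (2 * Real.pi * I * z)‖ < 1 := by
  simpa using UpperHalfPlane.norm_exp_two_pi_I_lt_one ⟨z, hz⟩

theorem E4_eq (z : ℂ) : E4 z = cexp (2 * Real.pi * I * z / 6) * eul (cexp (2 * Real.pi * I * z)) ^ 4 := by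
  unfold E4 ModularForm.eta eul
  simp only [ModularForm.eta_q, qpar_eq]
  rw [mul_pow]
  congr 1
  rw [Function.Periodic.qParam, ← Complex.exp_nat_mul]
  congr 1
  push_cast; ring

theorem E4_T (z : ℂ) : E4 (z + 1) = cexp (2 * Real.pi * I / 6) * E4 z := by
  rw [E4_eq, E4_eq]
  have h1 : cexp (2 * Real.pi * I * (z + 1)) = cexp (2 * Real.pi * I * z) := by
    rw [mul_add, mul_one, Complex.exp_add, Complex.exp_two_pi_mul_I, mul_one]
  rw [h1, ← mul_assoc, ← Complex.exp_add]
  congr 2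
  ring

theorem E4_S {z : ℂ} (hz : 0 < z.im) : E4 (-1 / z) = - z ^ 2 * E4 z := by
  have := ModularForm.eta_comp_eq_csqrt_I_inv (x := z) hz
  simp only [Function.comp_apply, Pi.smul_apply, Pi.mul_apply, smul_eq_mul] at this
  unfold E4
  rw [this]
  have h1 : ∀ w : ℂ, w ≠ 0 → sqrt w ^ 4 = w ^ 2 := by
    intro w hw
    rw [sqrt_eq_exp hw, ← exp_nat_mul]
    nth_rewrite 2 [← Complex.exp_log hw]
    rw [← Complex.exp_nat_mul]
    congr 1
    push_cast; ring
  have hz0 : z ≠ 0 := by rintro rfl; simp at hz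
  rw [mul_pow, inv_pow, mul_pow, h1 _ hz0, h1 _ I_ne_zero]
  simp

theorem E4_ne {z : ℂ} (hz : 0 < z.im) : E4 z ≠ 0 := pow_ne_zero _ (ModularForm.eta_ne_zero hz)

theorem E4_diff {z : ℂ} (hz : 0 < z.im) : DifferentiableAt ℂ E4 z :=
  (ModularForm.differentiableAt_eta_of_mem_upperHalfPlaneSet hz).fun_pow 4

theorem eul_diff : DifferentiableOn ℂ eul (Metric.ball 0 1) :=
  ModularForm.differentiableOn_tprod_one_sub_pow

theorem eul_ne {q : ℂ} (hq : ‖q‖ < 1) : eul q ≠ 0 := by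
  refine tprod_one_add_ne_zero_of_summable (f := fun n ↦ -q ^ (n + 1)) ?_ ?_
  · intro i h
    have h1 : q ^ (i + 1) = 1 := by linear_combination -h
    have h2 : ‖q‖ ^ (i + 1) < 1 := pow_lt_one₀ (norm_nonneg _) hq (by simp)
    rw [← norm_pow, h1] at h2
    simp at h2
  · simpa using (summable_nat_add_iff 1).mpr (summable_geometric_of_lt_one (norm_nonneg _) hq)

/-- exponent mod 2 -/
def phi2 (a b c d : ZMod 2) : ZMod 2 := (1 + c) * b + c * (a + d + 1)
/-- exponent mod 3 -/
def phi3 (a b c d : ZMod 3) : ZMod 3 := (1 - c ^ 2) * (b * d) + c * (a + d)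

theorem phi2_S : ∀ a b c d : ZMod 2, a * d - b * c = 1 → phi2 (-c) (-d) a b = 1 + phi2 a b c d := by
  unfold phi2; decide
theorem phi2_T : ∀ a b c d : ZMod 2, a * d - b * c = 1 →
    phi2 (a + c) (b + d) c d = 1 + phi2 a b c d := by
  unfold phi2; decide
theorem phi3_S : ∀ a b c d : ZMod 3, a * d - b * c = 1 → phi3 (-c) (-d) a b = phi3 a b c d := by
  unfold phi3; decide
theorem phi3_T : ∀ a b c d : ZMod 3, a * d - b * c = 1 →
    phi3 (a + c) (b + d) c d = 1 + phi3 a b c d := by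
  unfold phi3; decide

/-- sign character -/
noncomputable def x2 (u : ZMod 2) : ℂ := (-1) ^ u.val
/-- cubic character -/
noncomputable def x3 (u : ZMod 3) : ℂ := cexp (2 * (2 * Real.pi * I / 3)) ^ u.val

theorem x2_one_add (u : ZMod 2) : x2 (1 + u) = - x2 u := by
  have h : ∀ u : ZMod 2, (1 + u).val = 1 + u.val ∨ (1 + u).val + 2 = 1 + u.val := by decide
  unfold x2
  rcases h u with h | h
  · rw [h, pow_add]; ring
  · have : (-1 : ℂ) ^ ((1 + u).val + 2) = - (-1) ^ u.val := by rw [h, pow_add]; ring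
    rw [← this, pow_add]; ring

theorem cub : cexp (2 * (2 * Real.pi * I / 3)) ^ 3 = 1 := by
  rw [← Complex.exp_nat_mul, Complex.exp_eq_one_iff]
  exact ⟨2, by push_cast; ring⟩

theorem x3_one_add (u : ZMod 3) : x3 (1 + u) = cexp (2 * (2 * Real.pi * I / 3)) * x3 u := by
  have h : ∀ u : ZMod 3, (1 + u).val = 1 + u.val ∨ (1 + u).val + 3 = 1 + u.val := by decide
  unfold x3
  rcases h u with h | h
  · rw [h, pow_add]; ring
  · rw [← pow_succ', add_comm _ 1, ← h, pow_add, cub, mul_one]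

theorem x2_sq (u : ZMod 2) : x2 u ^ 2 = 1 := by
  unfold x2; rw [← pow_mul, mul_comm, pow_mul]; simp

theorem x3_cub (u : ZMod 3) : x3 u ^ 3 = 1 := by
  unfold x3; rw [← pow_mul, mul_comm u.val, pow_mul, cub]; simp

/-- multiplier of `E4` -/
noncomputable def chi (a b c d : ℤ) : ℂ := x2 (phi2 a b c d) * x3 (phi3 a b c d)

theorem chi_ne (a b c d : ℤ) : chi a b c d ≠ 0 := by
  intro h
  have h1 : chi a b c d ^ 6 = 1 := by
    have h2 := x2_sq (phi2 a b c d)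
    have h3 := x3_cub (phi3 a b c d)
    calc chi a b c d ^ 6 = (x2 (phi2 a b c d) ^ 2) ^ 3 * (x3 (phi3 a b c d) ^ 3) ^ 2 := by
          unfold chi; ring
      _ = 1 := by rw [h2, h3]; simp
  rw [h] at h1; simp at h1

theorem chi_S (a b c d : ℤ) (h : a * d - b * c = 1) : chi (-c) (-d) a b = - chi a b c d := by
  have h2 : (a : ZMod 2) * d - b * c = 1 := by exact_mod_cast congrArg (Int.cast (R := ZMod 2)) h
  have h3 : (a : ZMod 3) * d - b * c = 1 := by exact_mod_cast congrArg (Int.cast (R := ZMod 3)) h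
  unfold chi
  push_cast
  rw [phi2_S _ _ _ _ h2, phi3_S _ _ _ _ h3, x2_one_add]; ring

theorem chi_T (a b c d : ℤ) (h : a * d - b * c = 1) :
    chi (a + c) (b + d) c d = cexp (2 * Real.pi * I / 6) * chi a b c d := by
  have h2 : (a : ZMod 2) * d - b * c = 1 := by exact_mod_cast congrArg (Int.cast (R := ZMod 2)) h
  have h3 : (a : ZMod 3) * d - b * c = 1 := by exact_mod_cast congrArg (Int.cast (R := ZMod 3)) h
  unfold chi
  push_cast
  rw [phi2_T _ _ _ _ h2, phi3_T _ _ _ _ h3, x2_one_add, x3_one_add]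
  have : cexp (2 * Real.pi * I / 6) = - cexp (2 * (2 * Real.pi * I / 3)) := by
    have : cexp (2 * (2 * Real.pi * I / 3)) = cexp (2 * Real.pi * I / 6) * cexp (Real.pi * I) := by
      rw [← Complex.exp_add]; congr 1; ring
    rw [this, Complex.exp_pi_mul_I]; ring
  rw [this]; ring

theorem im_moeb {a b c d : ℝ} {z : ℂ} (hz : 0 < z.im) (h : 0 < a * d - b * c) :
    0 < ((a * z + b) / (c * z + d)).im ∧ (c * z + d : ℂ) ≠ 0 := by
  have h0 : (c * z + d : ℂ) ≠ 0 := by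
    intro h0
    have h1 := congrArg Complex.im h0
    have h2 := congrArg Complex.re h0
    simp [hz.ne'] at h1
    simp [h1] at h2
    simp [h1, h2] at h
  refine ⟨?_, h0⟩
  have : ((a * z + b) / (c * z + d)).im = (a * d - b * c) * z.im / normSq (c * z + d) := by
    rw [Complex.div_im]
    simp
    ring
  rw [this]
  have := Complex.normSq_pos.2 h0
  positivity

/-- The transformation property. -/
def Good (γ : Matrix.SpecialLinearGroup (Fin 2) ℤ) : Prop :=
  ∀ z : ℂ, 0 < z.im → E4 ((γ 0 0 * z + γ 0 1) / (γ 1 0 * z + γ 1 1)) =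
    chi (γ 0 0) (γ 0 1) (γ 1 0) (γ 1 1) * (γ 1 0 * z + γ 1 1) ^ 2 * E4 z

theorem det_eq (γ : Matrix.SpecialLinearGroup (Fin 2) ℤ) : γ 0 0 * γ 1 1 - γ 0 1 * γ 1 0 = 1 := by
  have := γ.2
  rwa [Matrix.det_fin_two] at this

theorem im_moeb_SL (γ : Matrix.SpecialLinearGroup (Fin 2) ℤ) {z : ℂ} (hz : 0 < z.im) :
    0 < (((γ 0 0 : ℂ) * z + γ 0 1) / (γ 1 0 * z + γ 1 1)).im ∧ ((γ 1 0 : ℂ) * z + γ 1 1) ≠ 0 := by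
  have := im_moeb (a := γ 0 0) (b := γ 0 1) (c := γ 1 0) (d := γ 1 1) hz (by
    have := det_eq γ
    have : ((γ 0 0 : ℝ) * γ 1 1 - γ 0 1 * γ 1 0) = 1 := by exact_mod_cast this
    rw [this]; exact one_pos)
  simpa using this

theorem good_S (γ : Matrix.SpecialLinearGroup (Fin 2) ℤ) (h : Good γ) : Good (ModularGroup.S * γ) := by
  intro z hz
  obtain ⟨h1, h2⟩ := im_moeb_SL γ hz
  have e00 : (ModularGroup.S * γ) 0 0 = - γ 1 0 := by
    simp [Matrix.SpecialLinearGroup.coe_mul, ModularGroup.coe_S, Matrix.mul_apply, Fin.sum_univ_two]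
  have e01 : (ModularGroup.S * γ) 0 1 = - γ 1 1 := by
    simp [Matrix.SpecialLinearGroup.coe_mul, ModularGroup.coe_S, Matrix.mul_apply, Fin.sum_univ_two]
  have e10 : (ModularGroup.S * γ) 1 0 = γ 0 0 := by
    simp [Matrix.SpecialLinearGroup.coe_mul, ModularGroup.coe_S, Matrix.mul_apply, Fin.sum_univ_two]
  have e11 : (ModularGroup.S * γ) 1 1 = γ 0 1 := by
    simp [Matrix.SpecialLinearGroup.coe_mul, ModularGroup.coe_S, Matrix.mul_apply, Fin.sum_univ_two]
  rw [e00, e01, e10, e11, chi_S _ _ _ _ (det_eq γ)]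
  have h3 := E4_S h1
  have h4 : ((γ 0 0 : ℂ) * z + γ 0 1) ≠ 0 := by
    intro h4; rw [h4] at h1; simp at h1
  rw [h z hz] at h3
  have h5 : (((-γ 1 0 : ℤ) : ℂ) * z + ((-γ 1 1 : ℤ) : ℂ)) / ((γ 0 0 : ℂ) * z + γ 0 1) =
      -1 / (((γ 0 0 : ℂ) * z + γ 0 1) / (γ 1 0 * z + γ 1 1)) := by
    push_cast; field_simp; ring
  rw [h5, h3]
  have h6 : ((γ 1 0 : ℂ) * z + γ 1 1) ^ 2 ≠ 0 := pow_ne_zero 2 h2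
  rw [div_pow]
  generalize ((γ 1 0 : ℂ) * z + γ 1 1) ^ 2 = w at *
  field_simp

theorem good_T (γ : Matrix.SpecialLinearGroup (Fin 2) ℤ) : Good γ ↔ Good (ModularGroup.T * γ) := by
  unfold Good
  refine forall_congr' fun z => forall_congr' fun hz => ?_
  obtain ⟨h1, h2⟩ := im_moeb_SL γ hz
  have e00 : (ModularGroup.T * γ) 0 0 = γ 0 0 + γ 1 0 := by
    simp [Matrix.SpecialLinearGroup.coe_mul, ModularGroup.coe_T, Matrix.mul_apply, Fin.sum_univ_two]
  have e01 : (ModularGroup.T * γ) 0 1 = γ 0 1 + γ 1 1 := by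
    simp [Matrix.SpecialLinearGroup.coe_mul, ModularGroup.coe_T, Matrix.mul_apply, Fin.sum_univ_two]
  have e10 : (ModularGroup.T * γ) 1 0 = γ 1 0 := by
    simp [Matrix.SpecialLinearGroup.coe_mul, ModularGroup.coe_T, Matrix.mul_apply, Fin.sum_univ_two]
  have e11 : (ModularGroup.T * γ) 1 1 = γ 1 1 := by
    simp [Matrix.SpecialLinearGroup.coe_mul, ModularGroup.coe_T, Matrix.mul_apply, Fin.sum_univ_two]
  rw [e00, e01, e10, e11, chi_T _ _ _ _ (det_eq γ)]
  have h5 : (((γ 0 0 + γ 1 0 : ℤ) : ℂ) * z + ((γ 0 1 + γ 1 1 : ℤ) : ℂ)) / ((γ 1 0 : ℂ) * z + γ 1 1) =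
      (((γ 0 0 : ℂ) * z + γ 0 1) / (γ 1 0 * z + γ 1 1)) + 1 := by
    push_cast; field_simp; ring
  rw [h5, E4_T]
  have h6 := Complex.exp_ne_zero (2 * Real.pi * I / 6)
  generalize cexp (2 * Real.pi * I / 6) = w at *
  constructor
  · intro h; rw [h]; ring
  · intro h
    apply mul_left_cancel₀ h6
    rw [h]; ring

theorem good_all (γ : Matrix.SpecialLinearGroup (Fin 2) ℤ) : Good γ := by
  have hγ : γ ∈ Subgroup.closure {ModularGroup.S, ModularGroup.T} := by
    rw [_root_.SpecialLinearGroup.SL2Z_generators]; trivial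
  induction hγ using Subgroup.closure_induction_left with
  | one =>
    intro z hz
    simp [chi, phi2, phi3, x2, x3]
  | mul_left x hx y hy ih =>
    rcases hx with rfl | rfl
    · exact good_S _ ih
    · exact (good_T _).1 ih
  | inv_mul_cancel x hx y hy ih =>
    rcases hx with rfl | rfl
    · have : (ModularGroup.S)⁻¹ * y = ModularGroup.S * (ModularGroup.S * (ModularGroup.S * y)) := by
        rw [inv_mul_eq_iff_eq_mul]
        simp only [← mul_assoc]
        have : ModularGroup.S * ModularGroup.S * ModularGroup.S * ModularGroup.S = 1 := by decide
        rw [this, one_mul]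
      rw [this]
      exact good_S _ (good_S _ (good_S _ ih))
    · rw [good_T]; simpa using ih

theorem E4_transf {a b c d : ℤ} (h : a * d - b * c = 1) {z : ℂ} (hz : 0 < z.im) :
    E4 ((a * z + b) / (c * z + d)) = chi a b c d * (c * z + d) ^ 2 * E4 z := by
  have := good_all ⟨!![a, b; c, d], by rw [Matrix.det_fin_two_of]; exact h⟩ z hz
  simpa using this

end Shih

set_option maxHeartbeats 400000
set_option linter.all false
namespace Shih
open PowerSeries Complex

/-- admissible levels -/
def NM (N m : ℕ) : Prop := (N = 2 ∧ m = 6) ∨ (N = 3 ∧ m = 3) ∨ (N = 7 ∧ m = 1)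

theorem NM.pos {N m : ℕ} (h : NM N m) : 0 < N := by rcases h with ⟨rfl, rfl⟩ | ⟨rfl, rfl⟩ | ⟨rfl, rfl⟩ <;> norm_num
theorem NM.one_lt {N m : ℕ} (h : NM N m) : 1 < N := by rcases h with ⟨rfl, rfl⟩ | ⟨rfl, rfl⟩ | ⟨rfl, rfl⟩ <;> norm_num
theorem NM.prime {N m : ℕ} (h : NM N m) : N.Prime := by rcases h with ⟨rfl, rfl⟩ | ⟨rfl, rfl⟩ | ⟨rfl, rfl⟩ <;> norm_num
theorem NM.mpos {N m : ℕ} (h : NM N m) : 0 < m := by rcases h with ⟨rfl, rfl⟩ | ⟨rfl, rfl⟩ | ⟨rfl, rfl⟩ <;> norm_num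
theorem NM.mul {N m : ℕ} (h : NM N m) : (N : ℂ) * m = 6 + m := by
  rcases h with ⟨rfl, rfl⟩ | ⟨rfl, rfl⟩ | ⟨rfl, rfl⟩ <;> norm_num

theorem chi_pow {N m : ℕ} (h : NM N m) (a b c d : ℤ) :
    chi a b (N * c) d ^ m = chi a (N * b) c d ^ m := by
  have h6 : ∀ a b c d : ℤ, chi a b c d ^ 6 = 1 := by
    intro a b c d
    have h2 := x2_sq (phi2 a b c d)
    have h3 := x3_cub (phi3 a b c d)
    calc chi a b c d ^ 6 = (x2 (phi2 a b c d) ^ 2) ^ 3 * (x3 (phi3 a b c d) ^ 3) ^ 2 := by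
          unfold chi; ring
      _ = 1 := by rw [h2, h3]; simp
  rcases h with ⟨rfl, rfl⟩ | ⟨rfl, rfl⟩ | ⟨rfl, rfl⟩
  · rw [h6, h6]
  · unfold chi
    rw [mul_pow, mul_pow, x3_cub, x3_cub]
    push_cast
    have : (3 : ZMod 2) = 1 := by decide
    rw [this, one_mul, one_mul]
  · unfold chi
    push_cast
    have : (7 : ZMod 2) = 1 := by decide
    have h' : (7 : ZMod 3) = 1 := by decide
    rw [this, h']
    simp only [one_mul]

/-- the Hauptmodul -/
noncomputable def hm (N m : ℕ) (z : ℂ) : ℂ := (E4 (N * z) / E4 z) ^ m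

theorem im_mul {n : ℕ} (hn : 0 < n) {z : ℂ} (hz : 0 < z.im) : 0 < ((n : ℂ) * z).im := by
  simp; positivity

theorem hm_ne {N m : ℕ} (h : NM N m) {z : ℂ} (hz : 0 < z.im) : hm N m z ≠ 0 :=
  pow_ne_zero _ (div_ne_zero (E4_ne (im_mul h.pos hz)) (E4_ne hz))

theorem hm_diff {N m : ℕ} (h : NM N m) {z : ℂ} (hz : 0 < z.im) : DifferentiableAt ℂ (hm N m) z := by
  have h1 : DifferentiableAt ℂ (fun z => E4 (N * z)) z := by
    have := E4_diff (im_mul h.pos hz)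
    exact this.comp z (by fun_prop)
  exact (h1.fun_div (E4_diff hz) (E4_ne hz)).fun_pow m

theorem hm_inv {N m : ℕ} (h : NM N m) {a b c d : ℤ} (hd : a * d - b * (N * c) = 1) {z : ℂ}
    (hz : 0 < z.im) : hm N m ((a * z + b) / (N * c * z + d)) = hm N m z := by
  unfold hm
  have h1 := E4_transf (a := a) (b := b) (c := N * c) (d := d) hd hz
  have h2 := E4_transf (a := a) (b := N * b) (c := c) (d := d) (by rw [← hd]; ring) (im_mul h.pos hz)
  have e1 : (N : ℂ) * ((a * z + b) / (N * c * z + d)) =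
      (a * (N * z) + (N * b : ℤ)) / (c * (N * z) + d) := by
    push_cast; rw [mul_div_assoc']; congr 1 <;> ring
  push_cast at h1
  rw [e1, h1, h2]
  have h3 : (N * c * z + d : ℂ) ≠ 0 := by
    have := (im_moeb (a := a) (b := b) (c := N * c) (d := d) hz (by
      have : (a : ℝ) * d - b * (N * c) = 1 := by exact_mod_cast hd
      rw [this]; exact one_pos)).2
    simpa using this
  have h4 : (c * (N * z) + d : ℂ) = N * c * z + d := by ring
  rw [h4, mul_right_comm, mul_right_comm (chi a b (N * c) d), mul_div_mul_right _ _ (pow_ne_zero 2 h3),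
    mul_div_mul_comm, mul_pow, div_pow, chi_pow h, div_self, one_mul]
  exact pow_ne_zero _ (chi_ne _ _ _ _)

theorem hm_w {N m : ℕ} (h : NM N m) {z : ℂ} (hz : 0 < z.im) :
    hm N m (-1 / (N * z)) = 1 / (((N : ℂ) ^ m) ^ 2 * hm N m z) := by
  unfold hm
  have hz0 : z ≠ 0 := by rintro rfl; simp at hz
  have hN : (N : ℂ) ≠ 0 := by exact_mod_cast h.pos.ne'
  have e1 : (N : ℂ) * (-1 / (N * z)) = -1 / z := by field_simp
  rw [e1, E4_S hz, E4_S (im_mul h.pos hz), ← pow_mul, mul_comm m 2, pow_mul, ← mul_pow, one_div, ← inv_pow]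
  congr 1
  have := E4_ne hz
  have := E4_ne (im_mul h.pos hz)
  field_simp

/-- q-expansion of the Hauptmodul -/
noncomputable def hq (N m : ℕ) (q : ℂ) : ℂ := q * (eul (q ^ N) / eul q) ^ (4 * m)

theorem hm_eq_hq {N m : ℕ} (h : NM N m) {z : ℂ} (hz : 0 < z.im) :
    hm N m z = hq N m (cexp (2 * Real.pi * I * z)) := by
  unfold hm hq
  rw [E4_eq, E4_eq, mul_div_mul_comm, mul_pow, ← Complex.exp_sub, ← Complex.exp_nat_mul,
    ← Complex.exp_nat_mul, ← div_pow, ← pow_mul]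
  congr 2
  · have := h.mul
    linear_combination (2 * Real.pi * I * z / 6) * this
  · congr 2
    ring_nf

theorem hq_diff {N m : ℕ} (h : NM N m) : DifferentiableOn ℂ (hq N m) (Metric.ball 0 1) := by
  unfold hq
  have h1 : DifferentiableOn ℂ (fun q => eul (q ^ N)) (Metric.ball 0 1) := by
    refine eul_diff.comp (by fun_prop) ?_
    intro q hq
    simp only [Metric.mem_ball, dist_zero_right] at *
    rw [norm_pow]; exact pow_lt_one₀ (norm_nonneg _) hq h.pos.ne'
  refine differentiableOn_id.mul ((h1.fun_div eul_diff ?_).fun_pow _)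
  intro q hq
  exact eul_ne (by simpa using hq)

/-- integral power series of the Hauptmodul -/
theorem hq_series {N m : ℕ} (h : NM N m) : ∃ F : ℤ⟦X⟧, coeff 0 F = 0 ∧ coeff 1 F = 1 ∧
    Val (F.map (Int.castRingHom ℂ)) (hq N m) := by
  obtain ⟨a, ha⟩ : ∃ a : ℂ⟦X⟧, Val a (hq N m) := by
    refine ⟨PowerSeries.mk fun n => (n.factorial : ℂ)⁻¹ * iteratedDeriv n (hq N m) 0, ?_⟩
    intro q hq
    have := Complex.hasSum_taylorSeries_on_ball (r := 1) (c := 0) (z := q)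
      (hq_diff h) (by simpa using hq)
    refine this.congr_fun fun n => ?_
    simp; ring
  set H : ℤ⟦X⟧ := pentagonalSeries ℤ with hH
  set HC := H.map (Int.castRingHom ℂ) with hHC
  have hv : Val HC eul := eul_val
  have hvN := hv.expand N h.pos.ne'
  have key : a * HC ^ (4 * m) = X * (PowerSeries.expand N h.pos.ne' HC) ^ (4 * m) := by
    have : (⟨a, ha.mem⟩ : Conv) * ⟨HC, hv.mem⟩ ^ (4 * m) =
      ⟨X, X_mem⟩ * ⟨_, hvN.mem⟩ ^ (4 * m) := by
      refine ev_inj _ _ fun q hq1 => ?_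
      simp only [map_mul, map_pow, ha.ev, hv.ev, hvN.ev, ev_X]
      have := eul_ne hq1
      unfold hq
      rw [div_pow]; field_simp
    exact congrArg Subtype.val this
  have hH0 : constantCoeff H = 1 := by
    have h1 := eul_taylor 0
    simp at h1
    have h2 : eul 0 = 1 := by unfold eul; simp
    rw [h2] at h1
    exact_mod_cast h1.symm
  have hu : constantCoeff (H ^ (4 * m)) = ((1 : ℤˣ) : ℤ) := by simp [hH0]
  set G := invOfUnit (H ^ (4 * m)) 1 with hG
  have hG1 : H ^ (4 * m) * G = 1 := mul_invOfUnit _ _ hu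
  refine ⟨X * ((PowerSeries.expand N h.pos.ne' H) ^ (4 * m) * G), by simp, ?_, ?_⟩
  · rw [show (1 : ℕ) = 0 + 1 from rfl, coeff_succ_X_mul, coeff_zero_eq_constantCoeff]
    rw [map_mul, map_pow, PowerSeries.constantCoeff_expand, hH0]
    simp [hG]
  · have : PowerSeries.map (Int.castRingHom ℂ) (X * ((PowerSeries.expand N h.pos.ne' H) ^ (4 * m) * G)) = a := by
      have h1 := congrArg (PowerSeries.map (Int.castRingHom ℂ)) hG1
      simp only [map_mul, map_pow, map_one, ← hHC] at h1
      simp only [map_mul, map_pow, PowerSeries.map_expand, PowerSeries.map_X, ← hHC]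
      rw [← mul_assoc, ← key, mul_assoc, h1, mul_one]
    rw [this]; exact ha

end Shih

set_option maxHeartbeats 400000
set_option linter.all false
namespace Shih
open Complex

/-- invariance under Gamma0 -/
def Inv (N : ℕ) (g : ℂ → ℂ) : Prop := ∀ a b c d : ℤ, a * d - b * (N * c) = 1 → ∀ z : ℂ, 0 < z.im →
  g ((a * z + b) / (N * c * z + d)) = g z

/-- bounded near `i∞` -/
def BddInf (g : ℂ → ℂ) : Prop := ∃ C A : ℝ, ∀ z : ℂ, 0 < z.im → A ≤ z.im → ‖g z‖ ≤ C

theorem BddInf.add {f g : ℂ → ℂ} (hf : BddInf f) (hg : BddInf g) : BddInf (fun z => f z + g z) := by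
  obtain ⟨C, A, h⟩ := hf
  obtain ⟨C', A', h'⟩ := hg
  refine ⟨C + C', max A A', fun z hz hA => ?_⟩
  exact (norm_add_le _ _).trans (add_le_add (h z hz ((le_max_left _ _).trans hA)) (h' z hz ((le_max_right _ _).trans hA)))

theorem BddInf.mul {f g : ℂ → ℂ} (hf : BddInf f) (hg : BddInf g) : BddInf (fun z => f z * g z) := by
  obtain ⟨C, A, h⟩ := hf
  obtain ⟨C', A', h'⟩ := hg
  refine ⟨C * C', max A A', fun z hz hA => ?_⟩
  rw [norm_mul]
  have h1 := h z hz ((le_max_left _ _).trans hA)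
  exact mul_le_mul h1 (h' z hz ((le_max_right _ _).trans hA)) (norm_nonneg _) ((norm_nonneg _).trans h1)

theorem BddInf.const (c : ℂ) : BddInf (fun _ => c) := ⟨‖c‖, 0, fun _ _ _ => le_rfl⟩

theorem BddInf.pow {f : ℂ → ℂ} (hf : BddInf f) (n : ℕ) : BddInf (fun z => f z ^ n) := by
  induction n with
  | zero => simpa using BddInf.const 1
  | succ n ih => simpa only [pow_succ] using ih.mul hf

theorem BddInf.congr {f g : ℂ → ℂ} (hf : BddInf f) (h : ∀ z : ℂ, 0 < z.im → f z = g z) : BddInf g := by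
  obtain ⟨C, A, h1⟩ := hf
  exact ⟨C, A, fun z hz hA => h z hz ▸ h1 z hz hA⟩

/-- holomorphic on the upper half plane -/
def Hol (g : ℂ → ℂ) : Prop := ∀ z : ℂ, 0 < z.im → DifferentiableAt ℂ g z

theorem inv_const {N m : ℕ} (hN : NM N m) (g : ℂ → ℂ) (hd : Hol g) (hi : Inv N g) (hb : BddInf g)
    (hw : BddInf (fun z => g (-1 / (N * z)))) : ∃ c, ∀ z : ℂ, 0 < z.im → g z = c := by
  have hpr := hN.prime
  haveI : NeZero N := ⟨hN.pos.ne'⟩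
  haveI : Fact N.Prime := ⟨hpr⟩
  have hsl : ∀ (γ : Matrix.SpecialLinearGroup (Fin 2) ℤ) (τ : UpperHalfPlane), ((γ • τ : UpperHalfPlane) : ℂ) =
      ((γ 0 0 : ℂ) * τ + γ 0 1) / (γ 1 0 * τ + γ 1 1) := by
    intro γ τ
    rw [UpperHalfPlane.coe_specialLinearGroup_apply]; simp
  let f : ModularForm ((CongruenceSubgroup.Gamma0 N).map (Matrix.SpecialLinearGroup.mapGL ℝ)) 0 :=
    { toFun := fun τ => g τ
      slash_action_eq' := by
        rintro _ ⟨γ, hγ, rfl⟩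
        change SlashAction.map (0 : ℤ) γ (fun τ : UpperHalfPlane => g τ) = _
        rw [ModularForm.SL_slash_def]
        funext τ
        simp only [neg_zero, zpow_zero, mul_one]
        have hc : ((γ 1 0 : ℤ) : ZMod N) = 0 := CongruenceSubgroup.Gamma0_mem.1 hγ
        obtain ⟨c, hc⟩ := (ZMod.intCast_zmod_eq_zero_iff_dvd _ _).1 hc
        have := hi (γ 0 0) (γ 0 1) c (γ 1 1) (by rw [← hc]; exact det_eq γ) τ τ.2
        rw [hsl, hc]
        push_cast
        exact this
      holo' := by
        rw [UpperHalfPlane.mdifferentiable_iff]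
        intro z hz
        refine DifferentiableAt.differentiableWithinAt ?_
        refine (hd z hz).congr_of_eventuallyEq ?_
        filter_upwards [UpperHalfPlane.isOpen_upperHalfPlaneSet.mem_nhds hz] with w hw
        simp [UpperHalfPlane.ofComplex_apply_of_im_pos hw]
      bdd_at_cusps' := by
        intro c hc
        rw [OnePoint.isBoundedAt_iff_forall_SL2Z
          ((Subgroup.IsArithmetic.isCusp_iff_isCusp_SL2Z _).1 hc)]
        intro γ _
        rw [ModularForm.SL_slash_def, UpperHalfPlane.isBoundedAtImInfty_iff]
        simp only [neg_zero, zpow_zero, mul_one, hsl]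
        by_cases hc0 : ((γ 1 0 : ℤ) : ZMod N) = 0
        · obtain ⟨c, hc⟩ := (ZMod.intCast_zmod_eq_zero_iff_dvd _ _).1 hc0
          obtain ⟨C, A, h⟩ := hb
          refine ⟨C, A, fun τ hτ => ?_⟩
          have := hi (γ 0 0) (γ 0 1) c (γ 1 1) (by rw [← hc]; exact det_eq γ) τ τ.2
          rw [hc]; push_cast; rw [this]
          exact h _ τ.2 hτ
        · let k : ℕ := ((γ 1 1 : ℤ) * ((γ 1 0 : ℤ) : ZMod N)⁻¹ : ZMod N).val
          have hk : (((γ 1 0) * k - γ 1 1 : ℤ) : ZMod N) = 0 := by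
            push_cast
            simp only [k, ZMod.natCast_val, ZMod.cast_id', id]
            field_simp
            simp
          obtain ⟨e, he⟩ := (ZMod.intCast_zmod_eq_zero_iff_dvd _ _).1 hk
          obtain ⟨C, A, h⟩ := hw
          have hNR : (0 : ℝ) < N := by exact_mod_cast hN.pos
          refine ⟨C, N * A, fun τ hτ => ?_⟩
          have hNC : (N : ℂ) ≠ 0 := by exact_mod_cast hN.pos.ne'
          have him : (((τ : ℂ) + k) / N).im = (τ : ℂ).im / N := by
            rw [Complex.div_natCast_im]; simp
          have hpos : 0 < (((τ : ℂ) + k) / N).im := by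
            rw [him]; exact div_pos τ.2 hNR
          have h1 := h (((τ : ℂ) + k) / N) hpos (by
            rw [him, le_div_iff₀ hNR]; rw [mul_comm]; exact hτ)
          have e1 : -1 / ((N : ℂ) * ((τ + k) / N)) = -1 / (τ + k) := by field_simp
          have him2 : 0 < ((τ : ℂ) + k).im := by simpa using τ.2
          have hne : (τ : ℂ) + k ≠ 0 := by intro h0; rw [h0] at him2; simp at him2
          have him3 : 0 < (-1 / ((τ : ℂ) + k)).im := by
            rw [neg_div, one_div, neg_im, inv_im, neg_div, neg_neg]
            exact div_pos him2 (normSq_pos.2 hne)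
          beta_reduce at h1
          rw [e1] at h1
          have h2 := hi (γ 0 0 * k - γ 0 1) (γ 0 0) e (γ 1 0) (by
            rw [← he]; have := det_eq γ; linear_combination this) (-1 / ((τ : ℂ) + k)) him3
          rw [← h2] at h1
          convert h1 using 3
          have he' : ((γ 1 0 : ℂ)) * k - γ 1 1 = N * e := by exact_mod_cast he
          have hcz := (im_moeb_SL γ τ.2).2
          rw [← he']
          have e3 : ((γ 1 0 : ℂ) * k - γ 1 1) * (-1 / (τ + k)) + γ 1 0 =
            (γ 1 0 * τ + γ 1 1) / (τ + k) := by field_simp; ring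
          have e4 : (((γ 0 0 * k - γ 0 1 : ℤ)) : ℂ) * (-1 / (τ + k)) + γ 0 0 =
            (γ 0 0 * τ + γ 0 1) / (τ + k) := by push_cast; field_simp; ring
          rw [e3, e4, div_div_div_cancel_right₀ hne] }
  obtain ⟨c, hc⟩ := ModularForm.eq_const_of_weight_zero f
  refine ⟨c, fun z hz => ?_⟩
  exact congrFun hc ⟨z, hz⟩
end Shih

set_option maxHeartbeats 400000
set_option linter.all false
namespace Shih
open Complex

theorem bdd_of_q {φ : ℂ → ℂ} (h : ContinuousAt φ 0) : BddInf (fun z => φ (cexp (2 * Real.pi * I * z))) := by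
  obtain ⟨δ, hδ, hb⟩ := Metric.continuousAt_iff.1 h 1 one_pos
  refine ⟨‖φ 0‖ + 1, (-Real.log δ + 1) / (2 * Real.pi), fun z hz hA => ?_⟩
  have h1 : ‖cexp (2 * Real.pi * I * z)‖ < δ := by
    rw [norm_exp]
    have : (2 * Real.pi * I * z).re = -(2 * Real.pi * z.im) := by simp [mul_re, mul_im]
    rw [this, ← Real.lt_log_iff_exp_lt hδ]
    rw [div_le_iff₀ (by positivity)] at hA
    linarith
  have h2 := hb (x := cexp (2 * Real.pi * I * z)) (by simpa using h1)
  rw [dist_eq_norm] at h2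
  have := norm_sub_norm_le (φ (cexp (2 * Real.pi * I * z))) (φ 0)
  linarith

theorem im_w {N : ℕ} (hN : 0 < N) {z : ℂ} (hz : 0 < z.im) : 0 < (-1 / ((N : ℂ) * z)).im := by
  have h1 := im_mul hN hz
  rw [neg_div, one_div, neg_im, inv_im, neg_div, neg_neg]
  refine div_pos h1 (normSq_pos.2 ?_)
  intro h0; rw [h0] at h1; simp at h1

theorem hq_cont {N m : ℕ} (h : NM N m) : ContinuousAt (hq N m) 0 :=
  ((hq_diff h).differentiableAt (Metric.ball_mem_nhds 0 one_pos)).continuousAt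

theorem hq_zero (N m : ℕ) : hq N m 0 = 0 := by simp [hq]

theorem hm_bdd {N m : ℕ} (h : NM N m) : BddInf (hm N m) :=
  (bdd_of_q (hq_cont h)).congr (fun z hz => (hm_eq_hq h hz).symm)

theorem hm_T {N m : ℕ} (h : NM N m) {z : ℂ} (hz : 0 < z.im) : hm N m (z + 1) = hm N m z := by
  have := hm_inv h (a := 1) (b := 1) (c := 0) (d := 1) (by simp) hz
  simpa using this

theorem q_div_hm_bdd {N m : ℕ} (h : NM N m) : BddInf (fun z => cexp (2 * Real.pi * I * z) / hm N m z) := by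
  have hc : ContinuousAt (fun q => ((eul (q ^ N) / eul q) ^ (4 * m))⁻¹) 0 := by
    have h1 : ContinuousAt eul 0 := (eul_diff.differentiableAt (Metric.ball_mem_nhds 0 one_pos)).continuousAt
    have h2 : ContinuousAt (fun q : ℂ => eul (q ^ N)) 0 := by
      refine ContinuousAt.comp (g := eul) (f := fun q : ℂ => q ^ N) ?_ (by fun_prop)
      simpa [h.pos.ne'] using h1
    have h0 : eul 0 ≠ 0 := eul_ne (by simp)
    refine ContinuousAt.inv₀ ((h2.div h1 h0).pow _) ?_
    exact pow_ne_zero _ (div_ne_zero (by simpa [h.pos.ne'] using h0) h0)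
  refine (bdd_of_q hc).congr (fun z hz => ?_)
  rw [hm_eq_hq h hz, hq]
  have := exp_ne_zero (2 * Real.pi * I * z)
  field_simp

theorem decay {N m : ℕ} (h : NM N m) (f : ℂ → ℂ) (hd : Hol f) (hp : ∀ z : ℂ, 0 < z.im → f (z + 1) = f z)
    (hb : BddInf f) : ∃ c, BddInf (fun z => (f z - c) / hm N m z) := by
  classical
  let f' : ℂ → ℂ := fun z => if 0 < z.im then f z else 0
  have hf' : ∀ z : ℂ, 0 < z.im → f' z = f z := fun z hz => if_pos hz
  have hper : Function.Periodic f' (1 : ℝ) := by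
    intro z
    simp only [f', add_im, ofReal_one, one_im, add_zero]
    split_ifs with hz
    · exact hp z hz
    · rfl
  have hev : ∀ A : ℝ, ∀ᶠ z in Filter.comap im Filter.atTop, A ≤ z.im := by
    intro A
    exact Filter.tendsto_comap.eventually (Filter.eventually_ge_atTop A)
  have hev0 : ∀ᶠ z in Filter.comap im Filter.atTop, 0 < z.im :=
    Filter.tendsto_comap.eventually (Filter.eventually_gt_atTop 0)
  have key := Function.Periodic.exp_decay_sub_of_bounded_at_inf one_pos hper (by
    filter_upwards [hev0] with z hz
    refine (hd z hz).congr_of_eventuallyEq ?_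
    filter_upwards [(isOpen_lt continuous_const continuous_im).mem_nhds hz] with w hw
    exact hf' w hw) (by
    obtain ⟨C, A, h1⟩ := hb
    refine Asymptotics.IsBigO.of_bound C ?_
    filter_upwards [hev A, hev0] with z hA hz
    rw [hf' z hz]
    simpa using h1 z hz hA)
  refine ⟨Function.Periodic.cuspFunction 1 f' 0, ?_⟩
  have h2 : BddInf (fun z => (f z - Function.Periodic.cuspFunction 1 f' 0) / cexp (2 * Real.pi * I * z)) := by
    obtain ⟨C, hC⟩ := key.bound
    obtain ⟨A, hA⟩ := Filter.eventually_atTop.1 (Filter.eventually_comap.1 hC)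
    refine ⟨C, A, fun z hz hzA => ?_⟩
    have := hA z.im hzA z rfl
    rw [norm_div, div_le_iff₀ (norm_pos_iff.2 (exp_ne_zero _)), norm_exp]
    rw [hf' z hz] at this
    have e : (2 * Real.pi * I * z).re = -2 * Real.pi * z.im / 1 := by simp [mul_re, mul_im]
    rw [e]
    simpa using this
  refine (h2.mul (q_div_hm_bdd h)).congr (fun z hz => ?_)
  have := exp_ne_zero (2 * Real.pi * I * z)
  have := hm_ne h hz
  field_simp

theorem haupt {N m : ℕ} (h : NM N m) (M : ℕ) : ∀ (g : ℂ → ℂ), Hol g → Inv N g → BddInf g →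
    BddInf (fun z => g (-1 / (N * z)) * hm N m z ^ M) →
    ∃ P : Polynomial ℂ, ∀ z : ℂ, 0 < z.im → g z = P.eval (hm N m z) := by
  induction M with
  | zero =>
    intro g hd hi hb hw
    obtain ⟨c, hc⟩ := inv_const h g hd hi hb (by simpa using hw)
    exact ⟨Polynomial.C c, fun z hz => by simp [hc z hz]⟩
  | succ M ih =>
    intro g hd hi hb hw
    have hN := h.pos
    have hNC : (N : ℂ) ≠ 0 := by exact_mod_cast hN.ne'
    obtain ⟨c, hc⟩ := decay h (fun z => g (-1 / (N * z)) * hm N m z ^ (M + 1)) (by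
      intro z hz
      refine DifferentiableAt.fun_mul ?_ ((hm_diff h hz).fun_pow _)
      refine DifferentiableAt.comp z (g := g) (f := fun z : ℂ => -1 / (N * z)) (hd _ (im_w hN hz)) ?_
      have : z ≠ 0 := by rintro rfl; simp at hz
      fun_prop (disch := simp [*])) (by
      intro z hz
      simp only [hm_T h hz]
      congr 1
      have := hi 1 0 (-1) 1 (by simp) (-1 / (N * z)) (im_w hN hz)
      rw [← this]
      congr 1
      have h1 : z ≠ 0 := by rintro rfl; simp at hz
      have h2 : z + 1 ≠ 0 := by intro h0; have := congrArg im h0; simp at this; linarith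
      push_cast
      have e : (N : ℂ) * -1 * (-1 / (N * z)) + 1 = (z + 1) / z := by field_simp; ring
      rw [e]
      field_simp
      ring) hw
    set K : ℂ := (N : ℂ) ^ m with hK
    have hK0 : K ≠ 0 := pow_ne_zero _ hNC
    obtain ⟨P, hP⟩ := ih (fun z => g z + (-c * K ^ (2 * (M + 1))) * hm N m z ^ (M + 1)) (by
      intro z hz
      exact (hd z hz).fun_add ((hm_diff h hz).fun_pow _ |>.const_mul _)) (by
      intro a b c d hdet z hz
      simp only [hi a b c d hdet z hz, hm_inv h hdet hz]) (hb.add ((BddInf.const _).mul ((hm_bdd h).pow _))) (by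
      refine hc.congr fun z hz => ?_
      have h0 := hm_ne h hz
      simp only [hm_w h hz, ← hK]
      have e : K ^ (2 * (M + 1)) * (1 / (K ^ 2 * hm N m z)) ^ (M + 1) * hm N m z ^ (M + 1) = 1 := by
        rw [pow_mul, ← mul_pow, ← mul_pow]
        have : K ^ 2 * (1 / (K ^ 2 * hm N m z)) * hm N m z = 1 := by field_simp
        rw [this, one_pow]
      rw [div_eq_iff h0]
      linear_combination c * e)
    refine ⟨P + Polynomial.C (c * K ^ (2 * (M + 1))) * Polynomial.X ^ (M + 1), fun z hz => ?_⟩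
    have := hP z hz
    simp only [Polynomial.eval_add, Polynomial.eval_mul, Polynomial.eval_C, Polynomial.eval_pow,
      Polynomial.eval_X, ← this]
    ring

theorem exists_q {q : ℂ} (h0 : q ≠ 0) (hq' : ‖q‖ < 1) : ∃ z : ℂ, 0 < z.im ∧ cexp (2 * Real.pi * I * z) = q := by
  let z := Function.Periodic.invQParam 1 q
  have hz : cexp (2 * Real.pi * I * z) = q := by
    have := Function.Periodic.qParam_right_inv (h := 1) one_ne_zero h0
    rw [Function.Periodic.qParam] at this
    simpa using this
  refine ⟨z, ?_, hz⟩
  by_contra hcon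
  have : ‖q‖ < 1 := by simpa using hq'
  rw [← hz, norm_exp] at this
  have e : (2 * Real.pi * I * z).re = -2 * Real.pi * z.im := by simp [mul_re, mul_im]
  rw [e, Real.exp_lt_one_iff] at this
  nlinarith [Real.pi_pos]

theorem hm_not_const {N m : ℕ} (h : NM N m) (c : ℂ) : ¬ ∀ z : ℂ, 0 < z.im → hm N m z = c := by
  intro hc
  have hcne : c ≠ 0 := by rw [← hc I (by simp)]; exact hm_ne h (by simp)
  have h1 : Filter.Tendsto (hq N m) (nhdsWithin 0 {0}ᶜ) (nhds 0) := by
    have := (hq_cont h).tendsto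
    rw [hq_zero] at this
    exact this.mono_left nhdsWithin_le_nhds
  have h2 : Filter.Tendsto (hq N m) (nhdsWithin 0 {0}ᶜ) (nhds c) := by
    refine tendsto_const_nhds.congr' ?_
    filter_upwards [self_mem_nhdsWithin, nhdsWithin_le_nhds (Metric.ball_mem_nhds (0 : ℂ) one_pos)] with q h0 hq'
    obtain ⟨z, hz, e⟩ := exists_q (q := q) h0 (by simpa using hq')
    rw [← hc z hz, hm_eq_hq h hz, e]
  exact hcne (tendsto_nhds_unique h2 h1)

theorem hm_surj {N m : ℕ} (h : NM N m) (t : ℂ) (ht : t ≠ 0) : ∃ z : ℂ, 0 < z.im ∧ hm N m z = t := by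
  by_contra! hcon
  have hN := h.pos
  obtain ⟨c, hc⟩ := inv_const h (fun z => (hm N m z - t)⁻¹) (by
    intro z hz
    exact ((hm_diff h hz).sub_const t).fun_inv (sub_ne_zero.2 (hcon z hz))) (by
    intro a b c d hd z hz
    simp only [hm_inv h hd hz]) (by
    refine (bdd_of_q (φ := fun q => (hq N m q - t)⁻¹) ?_).congr fun z hz => by rw [hm_eq_hq h hz]
    exact ((hq_cont h).sub continuousAt_const).inv₀ (by simpa [hq_zero] using ht)) (by
    refine (bdd_of_q (φ := fun q => ((N : ℂ) ^ m) ^ 2 * hq N m q * (1 - t * ((N : ℂ) ^ m) ^ 2 * hq N m q)⁻¹) ?_).congr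
      fun z hz => ?_
    · exact (continuousAt_const.mul (hq_cont h)).mul
        ((continuousAt_const.sub (continuousAt_const.mul (hq_cont h))).inv₀ (by simp [hq_zero]))
    · have h0 := hm_ne h hz
      have h1 := hcon _ (im_w hN hz)
      rw [hm_w h hz] at h1 ⊢
      rw [← hm_eq_hq h hz]
      have hK0 : ((N : ℂ) ^ m) ≠ 0 := pow_ne_zero _ (by exact_mod_cast hN.ne')
      have h2 := sub_ne_zero.2 h1
      have e : 1 / (((N : ℂ) ^ m) ^ 2 * hm N m z) - t = (1 - t * ((N : ℂ) ^ m) ^ 2 * hm N m z) / (((N : ℂ) ^ m) ^ 2 * hm N m z) := by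
        field_simp
      rw [e, inv_div, div_eq_mul_inv])
  refine hm_not_const h (c⁻¹ + t) fun z hz => ?_
  rw [← hc z hz]; simp
end Shih

set_option maxHeartbeats 400000
set_option linter.all false
namespace Shih
open Complex OnePoint

/-- the conjugate functions -/
noncomputable def sk (N m p : ℕ) (i : OnePoint (ZMod p)) (z : ℂ) : ℂ :=
  i.elim (hm N m (p * z)) (fun k => hm N m ((z + k.val) / p))

section
variable {N m p : ℕ} [hp : Fact p.Prime] (h : NM N m)
include h

theorem sk_inf (z : ℂ) : sk N m p ∞ z = hm N m (p * z) := rfl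
theorem sk_some (k : ZMod p) (z : ℂ) : sk N m p (k : OnePoint (ZMod p)) z = hm N m ((z + k.val) / p) := rfl

theorem im_div {z : ℂ} (hz : 0 < z.im) (k : ℕ) : 0 < ((z + k) / p).im := by
  have := hp.out.pos
  rw [Complex.div_natCast_im]; simp; positivity

theorem sA_inf {a b c d : ℤ} (hdet : a * d - b * (N * c) = p) (ha : (a : ZMod p) = 0) (hc : (c : ZMod p) = 0)
    {z : ℂ} (hz : 0 < z.im) : hm N m ((a * z + b) / (N * c * z + d)) = sk N m p ∞ z := by
  obtain ⟨a, rfl⟩ := (ZMod.intCast_zmod_eq_zero_iff_dvd _ _).1 ha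
  obtain ⟨c, rfl⟩ := (ZMod.intCast_zmod_eq_zero_iff_dvd _ _).1 hc
  have hp0 : (p : ℤ) ≠ 0 := by exact_mod_cast hp.out.ne_zero
  have h1 : a * d - b * (N * c) = 1 := by
    apply mul_left_cancel₀ hp0; linear_combination hdet
  rw [sk_inf h, ← hm_inv h h1 (im_mul hp.out.pos hz)]
  congr 1; push_cast; ring

theorem sA_some {a b c d : ℤ} (hdet : a * d - b * (N * c) = p) (k : ZMod p) (hb : (b : ZMod p) = a * k)
    (hd : (d : ZMod p) = N * c * k)
    {z : ℂ} (hz : 0 < z.im) : hm N m ((a * z + b) / (N * c * z + d)) = sk N m p (k : OnePoint (ZMod p)) z := by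
  have hb' : ((b - a * k.val : ℤ) : ZMod p) = 0 := by push_cast; rw [ZMod.natCast_zmod_val, hb, sub_self]
  have hd' : ((d - N * c * k.val : ℤ) : ZMod p) = 0 := by push_cast; rw [ZMod.natCast_zmod_val, hd, sub_self]
  obtain ⟨b', hb'⟩ := (ZMod.intCast_zmod_eq_zero_iff_dvd _ _).1 hb'
  obtain ⟨d', hd'⟩ := (ZMod.intCast_zmod_eq_zero_iff_dvd _ _).1 hd'
  have hp0 : (p : ℤ) ≠ 0 := by exact_mod_cast hp.out.ne_zero
  have h1 : a * d' - b' * (N * c) = 1 := by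
    apply mul_left_cancel₀ hp0; linear_combination hdet - a * hd' + N * c * hb'
  rw [sk_some h, ← hm_inv h h1 (im_div h hz _)]
  have hpC : (p : ℂ) ≠ 0 := by exact_mod_cast hp.out.ne_zero
  have e1 : (b : ℂ) - a * k.val = p * b' := by exact_mod_cast hb'
  have e2 : (d : ℂ) - N * c * k.val = p * d' := by exact_mod_cast hd'
  have e3 : (a : ℂ) * ((z + k.val) / p) + b' = (a * z + b) / p := by
    rw [eq_div_iff hpC, add_mul, mul_assoc, div_mul_cancel₀ _ hpC]; linear_combination -e1
  have e4 : (N * c : ℂ) * ((z + k.val) / p) + d' = (N * c * z + d) / p := by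
    rw [eq_div_iff hpC, add_mul, mul_assoc, div_mul_cancel₀ _ hpC]; linear_combination -e2
  rw [e3, e4, div_div_div_cancel_right₀ hpC]

theorem sk_act {a b c d : ℤ} (hdet : a * d - b * (N * c) = 1) (g : GL (Fin 2) (ZMod p))
    (h00 : g 0 0 = d) (h01 : g 0 1 = b) (h10 : g 1 0 = N * c) (h11 : g 1 1 = a) (hNp : (N : ZMod p) ≠ 0)
    (i : OnePoint (ZMod p)) {z : ℂ} (hz : 0 < z.im) :
    sk N m p i ((a * z + b) / (N * c * z + d)) = sk N m p (g • i) z := by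
  have hpC : (p : ℂ) ≠ 0 := by exact_mod_cast hp.out.ne_zero
  have hden : ((N * c * z + d : ℂ)) ≠ 0 := by
    have := (im_moeb (a := a) (b := b) (c := N * c) (d := d) hz (by
      have : ((a * d - b * (N * c) : ℤ) : ℝ) = 1 := by rw [hdet]; simp
      push_cast at this; rw [this]; exact one_pos)).2
    simpa using this
  cases i with
  | infty =>
    rw [smul_infty_eq_ite, h00, h10, sk_inf h]
    have e : (p : ℂ) * ((a * z + b) / (N * c * z + d)) = (((p * a : ℤ) : ℂ) * z + ((p * b : ℤ) : ℂ)) / (N * c * z + d) := by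
      push_cast; ring
    have hdet' : (p * a) * d - (p * b) * (N * c) = (p : ℤ) := by linear_combination p * hdet
    rw [e]
    split_ifs with h0
    · exact sA_inf h hdet' (by simp) (by simpa [hNp] using h0) hz
    · refine sA_some h hdet' _ (by simp) ?_ hz
      rw [mul_div_assoc', eq_div_iff h0]; ring
  | coe k =>
    rw [smul_some_eq_ite, h00, h01, h10, h11, sk_some h]
    have e : ((a * z + b) / (N * c * z + d) + k.val) / p = (((a + k.val * (N * c) : ℤ) : ℂ) * z + ((b + k.val * d : ℤ) : ℂ)) /
       (N * ((p * c : ℤ) : ℂ) * z + ((p * d : ℤ) : ℂ)) := by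
      have : (N * ((p * c : ℤ) : ℂ) * z + ((p * d : ℤ) : ℂ)) = p * (N * c * z + d) := by push_cast; ring
      rw [this, div_add' _ _ _ hden, div_div, mul_comm _ (p : ℂ)]; congr 1; push_cast; ring
    have hdet' : (a + k.val * (N * c)) * (p * d) - (b + k.val * d) * (N * (p * c)) = (p : ℤ) := by
      linear_combination p * hdet
    rw [e]
    split_ifs with h0
    · refine sA_inf h hdet' ?_ (by simp) hz
      push_cast; rw [ZMod.natCast_zmod_val]; linear_combination h0
    · refine sA_some h hdet' _ ?_ (by simp) hz
      push_cast; rw [ZMod.natCast_zmod_val]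
      rw [mul_div_assoc', eq_div_iff h0]; ring

theorem sk_w (g : GL (Fin 2) (ZMod p))
    (h00 : g 0 0 = 0) (h01 : g 0 1 = -1) (h10 : g 1 0 = N) (h11 : g 1 1 = 0) (hNp : (N : ZMod p) ≠ 0)
    (i : OnePoint (ZMod p)) {z : ℂ} (hz : 0 < z.im) :
    sk N m p i (-1 / (N * z)) = 1 / (((N : ℂ) ^ m) ^ 2 * sk N m p (g • i) z) := by
  have hpC : (p : ℂ) ≠ 0 := by exact_mod_cast hp.out.ne_zero
  have hNC : (N : ℂ) ≠ 0 := by exact_mod_cast h.pos.ne'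
  have hz0 : z ≠ 0 := by rintro rfl; simp at hz
  cases i with
  | infty =>
    rw [smul_infty_eq_ite, h00, h10, sk_inf h, if_neg hNp, zero_div, sk_some h]
    have := hm_w h (im_div (p := p) h hz 0)
    simp only [ZMod.val_zero, Nat.cast_zero, add_zero] at this ⊢
    rw [← this]; congr 1; field_simp
  | coe k =>
    rw [smul_some_eq_ite, h00, h01, h10, h11, sk_some h]
    by_cases hk : k = 0
    · subst hk
      rw [if_pos (by simp), sk_inf h, ← hm_w h (im_mul hp.out.pos hz)]
      congr 1; simp; field_simp
    · have hNk : (N : ZMod p) * k ≠ 0 := mul_ne_zero hNp hk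
      rw [if_neg (by simpa using ⟨hNp, hk⟩)]
      have hdet' : (-p) * (-1) - 0 * ((N : ℤ) * (k.val : ℤ)) = (p : ℤ) := by ring
      have := sA_some h (a := -p) (b := 0) (c := k.val) (d := -1) hdet' ((0 * k + -1) / (N * k + 0)) (by simp) (by
        push_cast; rw [ZMod.natCast_zmod_val, zero_mul, zero_add, add_zero, mul_div_assoc', eq_div_iff hNk]; ring) hz
      rw [← this]
      have hden := (im_moeb (a := -p) (b := 0) (c := N * k.val) (d := -1) hz (by simp; exact_mod_cast hp.out.pos))
      push_cast at hden ⊢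
      rw [← hm_w h hden.1]
      congr 1
      have := hden.2
      rw [add_zero]
      field_simp
      ring
end
end Shih

set_option maxHeartbeats 400000
set_option linter.all false
namespace Shih
open Complex OnePoint

theorem BddInf.comp {f : ℂ → ℂ} (hf : BddInf f) {α : ℝ} (hα : 0 < α) (φ : ℂ → ℂ)
    (hφ : ∀ z, (φ z).im = α * z.im) : BddInf (fun z => f (φ z)) := by
  obtain ⟨C, A, h⟩ := hf
  refine ⟨C, A / α, fun z hz hA => h _ (by rw [hφ]; positivity) ?_⟩
  rw [hφ]; rwa [div_le_iff₀' hα] at hA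

theorem im_aff {p : ℕ} (k : ℕ) (z : ℂ) : ((z + k) / (p : ℂ)).im = (p : ℝ)⁻¹ * z.im := by
  rw [Complex.div_natCast_im]; simp; ring

theorem toGL_apply {p : ℕ} (g : Matrix.SpecialLinearGroup (Fin 2) (ZMod p)) (i j : Fin 2) :
    (Matrix.SpecialLinearGroup.toGL g) i j = g i j := rfl

/-- invariance of a polynomial under `SL₂(𝔽_p)` -/
def GInv {p : ℕ} [Fact p.Prime] (f : MvPolynomial (OnePoint (ZMod p)) ℤ) : Prop :=
  ∀ g : Matrix.SpecialLinearGroup (Fin 2) (ZMod p),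
    MvPolynomial.rename (fun i => (Matrix.SpecialLinearGroup.toGL g) • i) f = f

theorem GInv.aeval {p : ℕ} [Fact p.Prime] {f : MvPolynomial (OnePoint (ZMod p)) ℤ} (hf : GInv f)
    {R : Type*} [CommRing R] (g : Matrix.SpecialLinearGroup (Fin 2) (ZMod p)) (v : OnePoint (ZMod p) → R) :
    MvPolynomial.aeval (fun i => v ((Matrix.SpecialLinearGroup.toGL g) • i)) f = MvPolynomial.aeval v f := by
  conv_rhs => rw [← hf g, MvPolynomial.aeval_rename]
  rfl

section
variable {N m p : ℕ} [hp : Fact p.Prime] (h : NM N m)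
include h

theorem sk_hol (i : OnePoint (ZMod p)) : Hol (sk N m p i) := by
  intro z hz
  cases i with
  | infty => 
    have h1 : DifferentiableAt ℂ (fun z : ℂ => (p : ℂ) * z) z := by fun_prop
    exact DifferentiableAt.comp z (g := hm N m) (f := fun z : ℂ => (p : ℂ) * z) (hm_diff h (im_mul hp.out.pos hz)) h1
  | coe k => 
    have h1 : DifferentiableAt ℂ (fun z : ℂ => (z + k.val) / p) z := by fun_prop
    exact DifferentiableAt.comp z (g := hm N m) (f := fun z : ℂ => (z + k.val) / p) (hm_diff h (im_div h hz _)) h1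

theorem sk_ne (i : OnePoint (ZMod p)) {z : ℂ} (hz : 0 < z.im) : sk N m p i z ≠ 0 := by
  cases i with
  | infty => exact hm_ne h (im_mul hp.out.pos hz)
  | coe k => exact hm_ne h (im_div h hz _)

theorem sk_bdd (i : OnePoint (ZMod p)) : BddInf (sk N m p i) := by
  have hpp : (0 : ℝ) < p := by exact_mod_cast hp.out.pos
  cases i with
  | infty => exact (hm_bdd h).comp (α := p) hpp (fun z => p * z) (by simp)
  | coe k => exact (hm_bdd h).comp (α := (p : ℝ)⁻¹) (by positivity) (fun z => (z + k.val) / p) (im_aff k.val)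

theorem hm_div_q_bdd : BddInf (fun z => hm N m z / cexp (2 * Real.pi * I * z)) := by
  have hc : ContinuousAt (fun q => ((eul (q ^ N) / eul q) ^ (4 * m))) 0 := by
    have h1 : ContinuousAt eul 0 := (eul_diff.differentiableAt (Metric.ball_mem_nhds 0 one_pos)).continuousAt
    have h2 : ContinuousAt (fun q : ℂ => eul (q ^ N)) 0 := by
      refine ContinuousAt.comp (g := eul) (f := fun q : ℂ => q ^ N) ?_ (by fun_prop)
      simpa [h.pos.ne'] using h1
    have h0 : eul 0 ≠ 0 := eul_ne (by simp)
    exact ((h2.div h1 h0).pow _)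
  refine (bdd_of_q hc).congr (fun z hz => ?_)
  rw [hm_eq_hq h hz, hq]
  have := exp_ne_zero (2 * Real.pi * I * z)
  field_simp

theorem sk_inv_bdd (i : OnePoint (ZMod p)) : BddInf (fun z => hm N m z ^ p / sk N m p i z) := by
  have hpp : (0 : ℝ) < p := by exact_mod_cast hp.out.pos
  have hpC : (p : ℂ) ≠ 0 := by exact_mod_cast hp.out.ne_zero
  cases i with
  | infty =>
    refine (((hm_div_q_bdd h).pow p).mul ((q_div_hm_bdd h).comp (α := p) hpp (fun z => p * z) (by simp))).congr
      fun z hz => ?_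
    have := hm_ne h (im_mul hp.out.pos hz)
    have e : cexp (2 * Real.pi * I * (p * z)) = cexp (2 * Real.pi * I * z) ^ p := by
      rw [← exp_nat_mul]; congr 1; ring
    have := exp_ne_zero (2 * Real.pi * I * z)
    rw [sk_inf h, e, div_pow]
    field_simp
  | coe k =>
    have hb : BddInf (fun z => cexp (2 * Real.pi * I * z) ^ p / cexp (2 * Real.pi * I * ((z + k.val) / p))) := by
      refine ⟨1, 0, fun z hz _ => ?_⟩
      beta_reduce
      rw [← exp_nat_mul, ← exp_sub, norm_exp, Real.exp_le_one_iff]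
      have e : (p * (2 * Real.pi * I * z) - 2 * Real.pi * I * ((z + k.val) / p)).re =
        -(2 * Real.pi * (p - 1 / p) * z.im) := by
        have e1 : (2 * Real.pi * I * ((z + k.val) / p)).re = - (2 * Real.pi * (z.im / p)) := by
          have : ((z + k.val) / (p : ℂ)).im = z.im / p := by rw [im_aff]; ring
          rw [← this]
          simp [mul_re, mul_im]
        rw [sub_re, e1]
        simp [mul_re, mul_im]
        ring
      rw [e, Left.neg_nonpos_iff]
      have h1 : (1 : ℝ) / p ≤ 1 := by
        rw [div_le_one hpp]; exact_mod_cast hp.out.one_lt.le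
      have h2 : (1 : ℝ) ≤ p := by exact_mod_cast hp.out.one_lt.le
      have h3 : (0 : ℝ) ≤ p - 1 / p := by linarith
      positivity
    refine ((((hm_div_q_bdd h).pow p).mul hb).mul ((q_div_hm_bdd h).comp (α := (p : ℝ)⁻¹) (by positivity)
      (fun z => (z + k.val) / p) (im_aff k.val))).congr
      fun z hz => ?_
    have := hm_ne h (im_div (p := p) h hz k.val)
    have := exp_ne_zero (2 * Real.pi * I * z)
    have := exp_ne_zero (2 * Real.pi * I * ((z + k.val) / p))
    rw [sk_some h, div_pow]
    generalize cexp (2 * Real.pi * I * ((z + k.val) / p)) = x at *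
    field_simp

theorem poly_of_inv (hNp : (N : ZMod p) ≠ 0) (f : MvPolynomial (OnePoint (ZMod p)) ℤ) (hf : GInv f) :
    ∃ P : Polynomial ℂ, ∀ z : ℂ, 0 < z.im → MvPolynomial.aeval (fun i => sk N m p i z) f = P.eval (hm N m z) := by
  let w : GL (Fin 2) (ZMod p) := Matrix.GeneralLinearGroup.mkOfDetNeZero !![0, -1; (N : ZMod p), 0] (by
    rw [Matrix.det_fin_two_of]; simpa using hNp)
  have hM : ∃ M : ℕ, BddInf (fun z => MvPolynomial.aeval (fun i => sk N m p i (-1 / (N * z))) f * hm N m z ^ M) := by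
    clear hf
    induction f using MvPolynomial.induction_on with
    | C a => exact ⟨0, (BddInf.const (a : ℂ)).congr fun z hz => by simp⟩
    | add f g hf hg =>
      obtain ⟨M, hM⟩ := hf
      obtain ⟨M', hM'⟩ := hg
      refine ⟨M + M', ((hM.mul ((hm_bdd h).pow M')).add (hM'.mul ((hm_bdd h).pow M))).congr fun z hz => ?_⟩
      rw [map_add]; ring
    | mul_X f i hf =>
      obtain ⟨M, hM⟩ := hf
      refine ⟨M + p, ((hM.mul (sk_inv_bdd h (w • i))).mul (BddInf.const (1 / ((N : ℂ) ^ m) ^ 2))).congr fun z hz => ?_⟩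
      rw [map_mul, MvPolynomial.aeval_X, sk_w h w rfl rfl rfl rfl hNp i hz]
      have hNC : (N : ℂ) ≠ 0 := by exact_mod_cast h.pos.ne'
      have := sk_ne h (w • i) hz
      field_simp
      ring
  obtain ⟨M, hM⟩ := hM
  refine haupt h M (fun z => MvPolynomial.aeval (fun i => sk N m p i z) f) ?_ ?_ ?_ hM
  · clear hM hf
    induction f using MvPolynomial.induction_on with
    | C a => intro z hz; simp
    | add f g hf hg => intro z hz; simpa only [map_add] using (hf z hz).fun_add (hg z hz)
    | mul_X f i hf => intro z hz; simpa only [map_mul, MvPolynomial.aeval_X] using (hf z hz).fun_mul (sk_hol h i z hz)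
  · intro a b c d hd z hz
    let g : Matrix.SpecialLinearGroup (Fin 2) (ZMod p) := ⟨!![(d : ZMod p), b; N * c, a], by
      rw [Matrix.det_fin_two_of]
      have := congrArg (Int.cast : ℤ → ZMod p) hd
      push_cast at this
      linear_combination this⟩
    have := hf.aeval g (fun i => sk N m p i z)
    beta_reduce
    rw [← this]
    congr 2
    funext i
    exact sk_act h hd (Matrix.SpecialLinearGroup.toGL g) (by rw [toGL_apply]; rfl) (by rw [toGL_apply]; rfl) (by rw [toGL_apply]; rfl) (by rw [toGL_apply]; rfl) hNp i hz
  · clear hM hf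
    induction f using MvPolynomial.induction_on with
    | C a => exact (BddInf.const (a : ℂ)).congr fun z hz => by simp
    | add f g hf hg => exact (hf.add hg).congr fun z hz => by simp
    | mul_X f i hf => exact (hf.mul (sk_bdd h i)).congr fun z hz => by simp
end
end Shih

set_option maxHeartbeats 400000
set_option linter.all false
namespace Shih
open Complex OnePoint PowerSeries

theorem triangular {A B : Type*} [CommRing A] [CommRing B] (ψ : A →+* B) (p : ℕ) (hp : 0 < p) (u h : A⟦X⟧)
    (hu : constantCoeff u = 1) (P : Polynomial B)
    (hP : P.eval₂ (C : B →+* B⟦X⟧) (PowerSeries.map ψ (X ^ p * u)) = PowerSeries.map ψ h) :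
    ∃ Q : Polynomial A, Q.map ψ = P := by
  have key : ∀ n, P.coeff n ∈ ψ.range := by
    intro n
    induction n using Nat.strong_induction_on with
    | _ n ih =>
    have h1 := congrArg (coeff (p * n)) hP
    rw [Polynomial.eval₂_eq_sum_range, map_sum, coeff_map] at h1
    have h2 : ∀ j, coeff (p * n) (C (P.coeff j) * (PowerSeries.map ψ (X ^ p * u)) ^ j) =
        if j ≤ n then P.coeff j * ψ (coeff (p * n - p * j) (u ^ j)) else 0 := by
      intro j
      rw [coeff_C_mul, ← map_pow, coeff_map, mul_pow, ← pow_mul, coeff_X_pow_mul']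
      have : p * j ≤ p * n ↔ j ≤ n := Nat.mul_le_mul_left_iff hp
      simp only [this]
      split_ifs <;> simp
    by_cases hn : n ≤ P.natDegree
    · simp only [h2] at h1
      rw [← Finset.add_sum_erase _ _ (Finset.mem_range.2 (Nat.lt_succ_of_le hn)), if_pos le_rfl, Nat.sub_self] at h1
      have h3 : coeff 0 (u ^ n) = 1 := by simp [hu]
      rw [h3, map_one, mul_one] at h1
      rw [eq_sub_of_add_eq h1]
      refine sub_mem ⟨_, rfl⟩ (sum_mem fun j hj => ?_)
      split_ifs with hjn
      · have := ih j (lt_of_le_of_ne hjn (Finset.ne_of_mem_erase hj))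
        exact mul_mem this ⟨_, rfl⟩
      · exact zero_mem _
    · rw [Polynomial.coeff_eq_zero_of_natDegree_lt (not_le.1 hn)]; exact zero_mem _
  have := (Polynomial.mem_lifts P).1 ((Polynomial.lifts_iff_coeff_lifts P).2 key)
  exact this

/-- the chosen integral expansion -/
noncomputable def FF {N m : ℕ} (h : NM N m) : ℤ⟦X⟧ := (hq_series h).choose
theorem FF_0 {N m : ℕ} (h : NM N m) : coeff 0 (FF h) = 0 := (hq_series h).choose_spec.1
theorem FF_1 {N m : ℕ} (h : NM N m) : coeff 1 (FF h) = 1 := (hq_series h).choose_spec.2.1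
theorem FF_val {N m : ℕ} (h : NM N m) : Val ((FF h).map (Int.castRingHom ℂ)) (hq N m) := (hq_series h).choose_spec.2.2

/-- the ring of cyclotomic integers -/
abbrev AA (p : ℕ) := AdjoinRoot (Polynomial.cyclotomic p ℤ)

/-- root of unity -/
noncomputable def zt (p : ℕ) : ℂ := cexp (2 * Real.pi * I / p)

section
variable {N m p : ℕ} [hp : Fact p.Prime] (h : NM N m)

theorem zt_prim : IsPrimitiveRoot (zt p) p := Complex.isPrimitiveRoot_exp p hp.out.ne_zero

theorem zt_pow_prim (a : (ZMod p)ˣ) : IsPrimitiveRoot (zt p ^ (a : ZMod p).val) p :=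
  zt_prim.pow_of_coprime _ (ZMod.val_coe_unit_coprime a)

/-- embeddings of the cyclotomic ring -/
noncomputable def psi (a : (ZMod p)ˣ) : AA p →+* ℂ :=
  AdjoinRoot.lift (Int.castRingHom ℂ) (zt p ^ (a : ZMod p).val) (by
    have := (zt_pow_prim a).isRoot_cyclotomic hp.out.pos
    rw [Polynomial.IsRoot, ← Polynomial.map_cyclotomic_int, Polynomial.eval_map] at this
    exact this)

theorem psi_root (a : (ZMod p)ˣ) : psi a (AdjoinRoot.root _) = zt p ^ (a : ZMod p).val := AdjoinRoot.lift_root _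

theorem psi_mk (a : (ZMod p)ˣ) (r : Polynomial ℤ) :
    psi a (AdjoinRoot.mk _ r) = r.eval₂ (Int.castRingHom ℂ) (zt p ^ (a : ZMod p).val) := AdjoinRoot.lift_mk _ _

theorem psi_inj (a : (ZMod p)ˣ) : Function.Injective (psi (p := p) a) := by
  rw [injective_iff_map_eq_zero]
  intro x hx
  obtain ⟨r, rfl⟩ := AdjoinRoot.mk_surjective x
  rw [psi_mk] at hx
  rw [AdjoinRoot.mk_eq_zero, Polynomial.cyclotomic_eq_minpoly (zt_pow_prim a) hp.out.pos]
  exact minpoly.isIntegrallyClosed_dvd ((zt_pow_prim a).isIntegral hp.out.pos) hx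

theorem psi_const (x : AA p) (hx : ∀ a : (ZMod p)ˣ, psi a x = psi 1 x) : ∃ n : ℤ, x = n := by
  have hmon : (Polynomial.cyclotomic p ℤ).Monic := Polynomial.cyclotomic.monic p ℤ
  obtain ⟨r, rfl⟩ := AdjoinRoot.mk_surjective x
  set r' := r %ₘ Polynomial.cyclotomic p ℤ with hr'
  have e : AdjoinRoot.mk (Polynomial.cyclotomic p ℤ) r = AdjoinRoot.mk _ r' := by
    rw [AdjoinRoot.mk_eq_mk, hr']
    refine ⟨r /ₘ Polynomial.cyclotomic p ℤ, ?_⟩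
    have := Polynomial.modByMonic_add_div r (Polynomial.cyclotomic p ℤ)
    linear_combination -this
  rw [e] at hx ⊢
  have hdeg : r'.natDegree < p - 1 := by
    have := Polynomial.natDegree_modByMonic_lt r hmon (by
      intro h1
      have := congrArg Polynomial.natDegree h1
      rw [Polynomial.natDegree_cyclotomic, Nat.totient_prime hp.out] at this
      have h2 := hp.out.two_le
      simp at this; omega)
    rwa [Polynomial.natDegree_cyclotomic, Nat.totient_prime hp.out] at this
  set c := psi (p := p) 1 (AdjoinRoot.mk _ r') with hc
  have hz : (r'.map (Int.castRingHom ℂ) - Polynomial.C c) = 0 := by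
    refine Polynomial.eq_zero_of_natDegree_lt_card_of_eval_eq_zero (ι := (ZMod p)ˣ) _
      (f := fun a => zt p ^ (a : ZMod p).val) ?_ ?_ ?_
    · intro a b hab
      have := zt_prim.pow_inj (ZMod.val_lt _) (ZMod.val_lt _) hab
      exact Units.ext (ZMod.val_injective p this)
    · intro a
      have := hx a
      rw [psi_mk, ← Polynomial.eval_map] at this
      simp [this, hc]
    · rw [ZMod.card_units_eq_totient, Nat.totient_prime hp.out]
      refine lt_of_le_of_lt (Polynomial.natDegree_sub_C (a := c)).le ?_
      exact lt_of_le_of_lt Polynomial.natDegree_map_le hdeg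
  have h0 : r'.natDegree = 0 := by
    rw [sub_eq_zero] at hz
    have h3 := Polynomial.natDegree_map_eq_of_injective (f := Int.castRingHom ℂ) Int.cast_injective r'
    rw [← h3, hz, Polynomial.natDegree_C]
  rw [Polynomial.eq_C_of_natDegree_eq_zero h0]
  exact ⟨r'.coeff 0, by simp⟩

end
end Shih

set_option maxHeartbeats 400000
set_option linter.all false
namespace Shih
open Complex OnePoint PowerSeries

section
variable {N m p : ℕ} [hp : Fact p.Prime] (h : NM N m)

/-- formal conjugates -/
noncomputable def sh (p : ℕ) [hp : Fact p.Prime] (h : NM N m) (i : OnePoint (ZMod p)) : (AA p)⟦X⟧ :=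
  i.elim (PowerSeries.expand (p ^ 2) (pow_ne_zero 2 hp.out.ne_zero) ((FF h).map (Int.castRingHom (AA p))))
    (fun k => PowerSeries.rescale (AdjoinRoot.root _ ^ k.val) ((FF h).map (Int.castRingHom (AA p))))

/-- formal Hauptmodul -/
noncomputable def sg (p : ℕ) [hp : Fact p.Prime] (h : NM N m) : (AA p)⟦X⟧ :=
  PowerSeries.expand p hp.out.ne_zero ((FF h).map (Int.castRingHom (AA p)))

/-- multiplication by a unit on the projective line -/
def ma (a : (ZMod p)ˣ) (i : OnePoint (ZMod p)) : OnePoint (ZMod p) := i.elim ∞ (fun k => ((a * k : ZMod p) : OnePoint (ZMod p)))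

theorem map_psi_FF (a : (ZMod p)ˣ) : PowerSeries.map (psi a) ((FF h).map (Int.castRingHom (AA p))) =
    (FF h).map (Int.castRingHom ℂ) := by
  ext n; simp

theorem map_expand' {R S : Type*} [CommRing R] [CommRing S] (f : R →+* S) (k : ℕ) (hk : k ≠ 0) (F : R⟦X⟧) :
    PowerSeries.map f (PowerSeries.expand k hk F) = PowerSeries.expand k hk (PowerSeries.map f F) := by
  ext n; simp only [coeff_map, coeff_expand]; split_ifs <;> simp

theorem map_rescale' {R S : Type*} [CommRing R] [CommRing S] (f : R →+* S) (u : R) (F : R⟦X⟧) :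
    PowerSeries.map f (PowerSeries.rescale u F) = PowerSeries.rescale (f u) (PowerSeries.map f F) := by
  ext n; simp [coeff_rescale]

theorem sg_val (a : (ZMod p)ˣ) : Val (PowerSeries.map (psi a) (sg p h)) (fun q => hq N m (q ^ p)) := by
  rw [sg, map_expand', map_psi_FF]
  exact (FF_val h).expand _ _

theorem sh_inf_val (a : (ZMod p)ˣ) : Val (PowerSeries.map (psi a) (sh p h ∞)) (fun q => hq N m (q ^ (p ^ 2))) := by
  change Val (PowerSeries.map (psi a) (PowerSeries.expand _ _ _)) _
  rw [map_expand', map_psi_FF]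
  exact (FF_val h).expand _ _

theorem sh_some_val (a : (ZMod p)ˣ) (k : ZMod p) : Val (PowerSeries.map (psi a) (sh p h (k : OnePoint (ZMod p))))
    (fun q => hq N m (zt p ^ (a * k : ZMod p).val * q)) := by
  change Val (PowerSeries.map (psi a) (PowerSeries.rescale _ _)) _
  rw [map_rescale', map_psi_FF, map_pow, psi_root, ← pow_mul]
  have e : zt p ^ ((a : ZMod p).val * k.val) = zt p ^ (a * k : ZMod p).val := by
    rw [ZMod.val_mul]; exact pow_eq_pow_mod _ zt_prim.pow_eq_one
  rw [e]
  refine (FF_val h).rescale _ ?_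
  rw [norm_pow, zt_prim.norm'_eq_one hp.out.ne_zero, one_pow]

theorem sh_mem (a : (ZMod p)ˣ) (i : OnePoint (ZMod p)) : PowerSeries.map (psi a) (sh p h i) ∈ Conv := by
  cases i with
  | infty => exact (sh_inf_val h a).mem
  | coe k => exact (sh_some_val h a k).mem

theorem sg_mem (a : (ZMod p)ˣ) : PowerSeries.map (psi a) (sg p h) ∈ Conv := (sg_val h a).mem

/-- parameter -/
noncomputable def qp (p : ℕ) (z : ℂ) : ℂ := cexp (2 * Real.pi * I * (z / p))

include h in
theorem qp_lt {z : ℂ} (hz : 0 < z.im) : ‖qp p z‖ < 1 := by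
  have := im_div (p := p) h hz 0
  exact norm_q_lt (by simpa using this)

theorem ev_sg (a : (ZMod p)ˣ) {z : ℂ} (hz : 0 < z.im) :
    ev (qp p z) (qp_lt h hz) ⟨_, sg_mem h a⟩ = hm N m z := by
  rw [(sg_val h a).ev, hm_eq_hq h hz, qp, ← exp_nat_mul]
  congr 2
  have hpC : (p : ℂ) ≠ 0 := by exact_mod_cast hp.out.ne_zero
  field_simp

theorem ev_sh (a : (ZMod p)ˣ) (i : OnePoint (ZMod p)) {z : ℂ} (hz : 0 < z.im) :
    ev (qp p z) (qp_lt h hz) ⟨_, sh_mem h a i⟩ = sk N m p (ma a i) z := by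
  have hpC : (p : ℂ) ≠ 0 := by exact_mod_cast hp.out.ne_zero
  cases i with
  | infty =>
    rw [(sh_inf_val h a).ev]
    change _ = sk N m p ∞ z
    rw [sk_inf h, hm_eq_hq h (im_mul hp.out.pos hz), qp, ← exp_nat_mul]
    congr 2
    push_cast
    field_simp
  | coe k =>
    rw [(sh_some_val h a k).ev]
    change _ = sk N m p ((a * k : ZMod p) : OnePoint (ZMod p)) z
    rw [sk_some h, hm_eq_hq h (im_div h hz _), qp, zt, ← exp_nat_mul, ← exp_add]
    congr 2
    field_simp
    ring

theorem exists_qp {q : ℂ} (h0 : q ≠ 0) (hq' : ‖q‖ < 1) : ∃ z : ℂ, 0 < z.im ∧ qp p z = q := by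
  obtain ⟨z, hz, e⟩ := exists_q h0 hq'
  refine ⟨p * z, im_mul hp.out.pos hz, ?_⟩
  have hpC : (p : ℂ) ≠ 0 := by exact_mod_cast hp.out.ne_zero
  rw [qp, mul_div_cancel_left₀ _ hpC, e]

theorem sg_eq : ∃ u : (AA p)⟦X⟧, constantCoeff u = 1 ∧ sg p h = X ^ p * u := by
  have hp0 := hp.out.ne_zero
  have h1 : (X : ℤ⟦X⟧) ∣ FF h := by
    rw [X_dvd_iff, ← coeff_zero_eq_constantCoeff_apply, FF_0]
  obtain ⟨v, hv⟩ := h1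
  have hv1 : constantCoeff v = 1 := by
    have := FF_1 h
    rw [hv, show (1 : ℕ) = 0 + 1 from rfl, coeff_succ_X_mul] at this
    simpa using this
  refine ⟨PowerSeries.expand p hp0 (v.map (Int.castRingHom (AA p))), by
    rw [constantCoeff_expand, ← coeff_zero_eq_constantCoeff_apply, coeff_map, coeff_zero_eq_constantCoeff_apply, hv1]; simp, ?_⟩
  rw [sg, hv, map_mul, map_X, map_mul, expand_X]

/-- constants as convergent series -/
noncomputable def Cc : ℂ →+* Conv where
  toFun c := ⟨C c, C_mem c⟩
  map_one' := by ext1; simp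
  map_mul' a b := by ext1; simp
  map_zero' := by ext1; simp
  map_add' a b := by ext1; simp

theorem A1 (hNp : (N : ZMod p) ≠ 0) (f : MvPolynomial (OnePoint (ZMod p)) ℤ) (hf : GInv f) :
    ∃ Q : Polynomial (AA p), Q.eval₂ (C : AA p →+* _) (sg p h) = MvPolynomial.aeval (sh p h) f ∧
      ∀ (a : (ZMod p)ˣ) (z : ℂ), 0 < z.im →
      MvPolynomial.aeval (fun i => sk N m p (ma a i) z) f = (Q.map (psi a)).eval (hm N m z) := by
  obtain ⟨P, hP⟩ := poly_of_inv h hNp f hf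
  have hma1 : ∀ i : OnePoint (ZMod p), ma 1 i = i := by
    intro i; cases i <;> simp [ma]
  have hev : ∀ (a : (ZMod p)ˣ) (z : ℂ) (hz : 0 < z.im), ev (qp p z) (qp_lt h hz)
      (MvPolynomial.aeval (fun i => (⟨_, sh_mem h a i⟩ : Conv)) f) = MvPolynomial.aeval (fun i => sk N m p (ma a i) z) f := by
    intro a z hz
    rw [MvPolynomial.aeval_def, MvPolynomial.aeval_def, MvPolynomial.hom_eval₂]
    congr 1
    · exact RingHom.ext_int _ _
    · funext i; exact ev_sh h a i hz
  have hco : ∀ a : (ZMod p)ˣ, ((MvPolynomial.aeval (fun i => (⟨_, sh_mem h a i⟩ : Conv)) f : Conv) : ℂ⟦X⟧) =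
      PowerSeries.map (psi a) (MvPolynomial.aeval (sh p h) f) := by
    intro a
    change Conv.subtype _ = _
    rw [MvPolynomial.aeval_def, MvPolynomial.aeval_def, MvPolynomial.hom_eval₂, MvPolynomial.hom_eval₂]
    congr 1
    exact RingHom.ext_int _ _
  have key : MvPolynomial.aeval (fun i => (⟨_, sh_mem h 1 i⟩ : Conv)) f = P.eval₂ Cc ⟨_, sg_mem h (1 : (ZMod p)ˣ)⟩ := by
    refine ev_inj' _ _ fun q hq h0 => ?_
    obtain ⟨z, hz, rfl⟩ := exists_qp (p := p) h0 hq
    rw [hev 1 z hz]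
    simp only [hma1]
    rw [hP z hz, Polynomial.hom_eval₂, ev_sg h 1 hz, ← Polynomial.eval₂_id]
    congr 1
    ext c
    exact (ev_C c (qp p z) (qp_lt h hz)).symm
  have key2 : P.eval₂ (C : ℂ →+* ℂ⟦X⟧) (PowerSeries.map (psi (1 : (ZMod p)ˣ)) (sg p h)) =
      PowerSeries.map (psi 1) (MvPolynomial.aeval (sh p h) f) := by
    rw [← hco, key]
    change _ = Conv.subtype _
    rw [Polynomial.hom_eval₂]
    rfl
  obtain ⟨u, hu1, hu⟩ := sg_eq (p := p) h
  obtain ⟨Q, rfl⟩ := triangular (psi (1 : (ZMod p)ˣ)) p hp.out.pos u _ hu1 P (by rw [← hu]; exact key2)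
  have hQ : Q.eval₂ (C : AA p →+* _) (sg p h) = MvPolynomial.aeval (sh p h) f := by
    apply PowerSeries.map_injective (psi (1 : (ZMod p)ˣ)) (psi_inj 1)
    rw [← key2, Polynomial.eval₂_map, Polynomial.hom_eval₂]
    congr 1
    refine RingHom.ext fun c => ?_
    simp
  refine ⟨Q, hQ, fun a z hz => ?_⟩
  have h3 : MvPolynomial.aeval (fun i => (⟨_, sh_mem h a i⟩ : Conv)) f = (Q.map (psi a)).eval₂ Cc ⟨_, sg_mem h a⟩ := by
    apply Subtype.ext
    rw [hco, ← hQ]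
    change _ = Conv.subtype _
    rw [Polynomial.hom_eval₂, Polynomial.hom_eval₂, Polynomial.eval₂_map]
    congr 1
    refine RingHom.ext fun c => ?_
    simp [Cc]
  rw [← hev a z hz, h3, Polynomial.hom_eval₂, ev_sg h a hz, ← Polynomial.eval₂_id]
  congr 1
  ext c
  exact ev_C c (qp p z) (qp_lt h hz)

end
end Shih

set_option maxHeartbeats 400000
set_option linter.all false
namespace Shih
open Complex OnePoint

theorem prod_onePoint {p : ℕ} [Fact p.Prime] {M : Type*} [CommMonoid M] (f : OnePoint (ZMod p) → M) :
    ∏ i, f i = f ∞ * ∏ k : ZMod p, f (k : OnePoint (ZMod p)) := Fintype.prod_option f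

theorem card_onePoint {p : ℕ} [hp : Fact p.Prime] : Fintype.card (OnePoint (ZMod p)) = p + 1 := by
  rw [show Fintype.card (OnePoint (ZMod p)) = Fintype.card (Option (ZMod p)) from Fintype.card_congr (Equiv.refl _)]
  simp [ZMod.card]

section
variable {N m p : ℕ} [hp : Fact p.Prime] (h : NM N m)

theorem ma_inj (a : (ZMod p)ˣ) : Function.Injective (ma a) := by
  intro i j hij
  cases i <;> cases j
  · rfl
  · exact absurd hij (infty_ne_coe _)
  · exact absurd hij (coe_ne_infty _)
  · have h1 := OnePoint.coe_injective hij
    rw [Units.mul_right_inj] at h1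
    rw [h1]

/-- specialization of the formal variable -/
noncomputable def eta' (p : ℕ) [hp : Fact p.Prime] (h : NM N m) : Polynomial ℤ →+* PowerSeries (AA p) :=
  Polynomial.eval₂RingHom (Int.castRingHom _) (sg p h)

/-- specialization at a point -/
noncomputable def evz (t : ℂ) : Polynomial ℤ →+* ℂ := Polynomial.eval₂RingHom (Int.castRingHom ℂ) t

theorem evz_apply (t : ℂ) (R : Polynomial ℤ) : evz t R = (R.map (Int.castRingHom ℂ)).eval t := by
  rw [Polynomial.eval_map]; rfl

theorem A1sym (hNp : (N : ZMod p) ≠ 0) (f : MvPolynomial (OnePoint (ZMod p)) ℤ)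
    (hf : ∀ e : Equiv.Perm (OnePoint (ZMod p)), MvPolynomial.rename e f = f) :
    ∃ R : Polynomial ℤ, eta' p h R = MvPolynomial.aeval (sh p h) f ∧
      ∀ (z : ℂ), 0 < z.im → evz (hm N m z) R = MvPolynomial.aeval (fun i => sk N m p i z) f := by
  obtain ⟨Q, hQ1, hQ2⟩ := A1 h hNp f (fun g => hf (MulAction.toPerm (Matrix.SpecialLinearGroup.toGL g)))
  have hQ3 : ∀ (a : (ZMod p)ˣ) (z : ℂ), 0 < z.im →
      MvPolynomial.aeval (fun i => sk N m p i z) f = (Q.map (psi a)).eval (hm N m z) := by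
    intro a z hz
    rw [← hQ2 a z hz]
    let e : Equiv.Perm (OnePoint (ZMod p)) := Equiv.ofBijective (ma a) (Finite.injective_iff_bijective.1 (ma_inj a))
    conv_lhs => rw [← hf e, MvPolynomial.aeval_rename]
    rfl
  have hQ4 : ∀ a : (ZMod p)ˣ, Q.map (psi a) = Q.map (psi 1) := by
    intro a
    refine Polynomial.eq_of_infinite_eval_eq _ _ ((Set.infinite_of_finite_compl (s := ({0}ᶜ : Set ℂ)) (by simp)).mono ?_)
    intro t ht
    obtain ⟨z, hz, rfl⟩ := hm_surj h t ht
    change Polynomial.eval _ _ = Polynomial.eval _ _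
    rw [← hQ3 a z hz, ← hQ3 1 z hz]
  have hl : Q ∈ Polynomial.lifts (Int.castRingHom (AA p)) := by
    rw [Polynomial.lifts_iff_coeff_lifts]
    intro n
    obtain ⟨c, hc⟩ := psi_const (Q.coeff n) (fun a => by
      have := congrArg (fun P => Polynomial.coeff P n) (hQ4 a)
      simpa only [Polynomial.coeff_map] using this)
    exact ⟨c, by simp [hc]⟩
  obtain ⟨R, rfl⟩ := (Polynomial.mem_lifts Q).1 hl
  refine ⟨R, ?_, fun z hz => ?_⟩
  · rw [← hQ1, Polynomial.eval₂_map]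
    change Polynomial.eval₂ _ _ _ = _
    congr 1
    exact RingHom.ext_int _ _
  · rw [hQ3 1 z hz, Polynomial.map_map, evz_apply]
    congr 2
    exact RingHom.ext_int _ _

/-- generic polynomial -/
noncomputable def Phi (p : ℕ) [Fact p.Prime] : Polynomial (MvPolynomial (OnePoint (ZMod p)) ℤ) :=
  ∏ i, (Polynomial.X - Polynomial.C (MvPolynomial.X i))

theorem Phi_monic : (Phi p).Monic := Polynomial.monic_prod_of_monic _ _ fun i _ => Polynomial.monic_X_sub_C _

theorem Phi_deg : (Phi p).natDegree = p + 1 := by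
  rw [Phi, Polynomial.natDegree_prod_of_monic _ _ (fun i _ => Polynomial.monic_X_sub_C _)]
  simp [card_onePoint]

theorem Phi_map {T : Type*} [CommRing T] (v : OnePoint (ZMod p) → T) :
    (Phi p).map (MvPolynomial.eval₂Hom (Int.castRingHom T) v) = ∏ i, (Polynomial.X - Polynomial.C (v i)) := by
  rw [Phi, Polynomial.map_prod]
  refine Finset.prod_congr rfl fun i _ => ?_
  simp

theorem Phi_sym (e : Equiv.Perm (OnePoint (ZMod p))) (j : ℕ) :
    MvPolynomial.rename e ((Phi p).coeff j) = (Phi p).coeff j := by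
  have : (Phi p).map (MvPolynomial.rename (R := ℤ) e).toRingHom = Phi p := by
    conv_rhs => rw [Phi, ← Equiv.prod_comp e]
    rw [Phi, Polynomial.map_prod]
    refine Finset.prod_congr rfl fun i _ => ?_
    simp
  conv_rhs => rw [← this, Polynomial.coeff_map]
  rfl

theorem exists_Psi (hNp : (N : ZMod p) ≠ 0) : ∃ Ψ : Polynomial (Polynomial ℤ), Ψ.Monic ∧ Ψ.natDegree = p + 1 ∧
    Ψ.map (eta' p h) = ∏ i, (Polynomial.X - Polynomial.C (sh p h i)) ∧
    ∀ (z : ℂ), 0 < z.im → Ψ.map (evz (hm N m z)) = ∏ i, (Polynomial.X - Polynomial.C (sk N m p i z)) := by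
  choose R hR1 hR2 using fun j => A1sym h hNp ((Phi p).coeff j) (fun e => Phi_sym e j)
  let q : Polynomial (Polynomial ℤ) := ∑ j ∈ Finset.range (p + 1), Polynomial.C (R j) * Polynomial.X ^ j
  have hq : q.degree < ((p + 1 : ℕ) : WithBot ℕ) := by
    refine Polynomial.degree_sum_fin_lt (n := p + 1) (fun j => R j) |>.trans_eq' ?_
    simp only [q]
    rw [Finset.sum_range]
  have hΦ := (Phi_monic (p := p)).as_sum
  rw [Phi_deg] at hΦ
  have hmap : ∀ {T : Type} [CommRing T] (η : Polynomial ℤ →+* T) (v : OnePoint (ZMod p) → T),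
      (∀ j, η (R j) = MvPolynomial.eval₂ (Int.castRingHom T) v ((Phi p).coeff j)) → (Polynomial.X ^ (p + 1) + q).map η =
        ∏ i, (Polynomial.X - Polynomial.C (v i)) := by
    intro T _ η v hv
    rw [← Phi_map, hΦ]
    simp only [q, Polynomial.map_add, Polynomial.map_pow, Polynomial.map_X, Polynomial.map_sum, Polynomial.map_mul,
      Polynomial.map_C, hv]
    rfl
  refine ⟨Polynomial.X ^ (p + 1) + q, Polynomial.monic_X_pow_add hq, Polynomial.natDegree_eq_of_degree_eq_some ?_, hmap _ _ (fun j => ?_), fun z hz => ?_⟩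
  · rw [Polynomial.degree_add_eq_left_of_degree_lt (by rw [Polynomial.degree_X_pow]; exact hq), Polynomial.degree_X_pow]
  · rw [hR1 j, MvPolynomial.aeval_def]
    congr 1
    exact RingHom.ext_int _ _
  exact hmap _ _ fun j => (hR2 j z hz).trans rfl
end
end Shih

set_option maxHeartbeats 400000
set_option linter.all false
namespace Shih
open Complex OnePoint PowerSeries

section
variable {N m p : ℕ} [hp : Fact p.Prime] (h : NM N m)

instance : IsDomain (AA p) := (psi_inj (p := p) 1).isDomain (psi 1)

instance : CharZero (AA p) := by
  refine ⟨fun a b hab => ?_⟩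
  have := congrArg (psi (p := p) 1) hab
  simpa using this

theorem sh_coe_eq (k : ZMod p) : ∃ u : (AA p)⟦X⟧, constantCoeff u = AdjoinRoot.root _ ^ k.val ∧
    sh p h (k : OnePoint (ZMod p)) = X * u := by
  have h1 : (X : (AA p)⟦X⟧) ∣ sh p h (k : OnePoint (ZMod p)) := by
    rw [X_dvd_iff]
    change constantCoeff (rescale _ _) = 0
    rw [← coeff_zero_eq_constantCoeff_apply, coeff_rescale, PowerSeries.coeff_map, FF_0]
    simp
  obtain ⟨u, hu⟩ := h1
  refine ⟨u, ?_, hu⟩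
  have h2 : coeff 1 (sh p h (k : OnePoint (ZMod p))) = AdjoinRoot.root _ ^ k.val := by
    change coeff 1 (rescale _ _) = _
    rw [coeff_rescale, PowerSeries.coeff_map, FF_1]
    simp
  rw [hu, show (1 : ℕ) = 0 + 1 from rfl, coeff_succ_X_mul, coeff_zero_eq_constantCoeff_apply] at h2
  exact h2

theorem sh_inf_eq : ∃ u : (AA p)⟦X⟧, constantCoeff u = 1 ∧ sh p h ∞ = X ^ (p ^ 2) * u := by
  have h1 : (X : ℤ⟦X⟧) ∣ FF h := by
    rw [X_dvd_iff, ← coeff_zero_eq_constantCoeff_apply, FF_0]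
  obtain ⟨v, hv⟩ := h1
  have hv0 : constantCoeff v = 1 := by
    have := FF_1 h
    rw [hv, show (1 : ℕ) = 0 + 1 from rfl, coeff_succ_X_mul, coeff_zero_eq_constantCoeff_apply] at this
    exact this
  refine ⟨PowerSeries.expand (p ^ 2) (pow_ne_zero 2 hp.out.ne_zero) (v.map (Int.castRingHom _)), ?_, ?_⟩
  · rw [← coeff_zero_eq_constantCoeff_apply, coeff_expand]
    simp [hv0]
  · change PowerSeries.expand _ _ _ = _
    rw [hv, map_mul, map_mul]
    simp

theorem root_ne : (AdjoinRoot.root (Polynomial.cyclotomic p ℤ) : AA p) ≠ 0 := by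
  intro e
  have := congrArg (psi (p := p) 1) e
  rw [psi_root, map_zero] at this
  exact (zt_pow_prim (p := p) 1).ne_zero hp.out.ne_zero this

theorem root_inj {j k : ZMod p} (e : (AdjoinRoot.root (Polynomial.cyclotomic p ℤ) : AA p) ^ j.val = AdjoinRoot.root (Polynomial.cyclotomic p ℤ) ^ k.val) :
    j = k := by
  have := congrArg (psi (p := p) 1) e
  rw [map_pow, map_pow, psi_root] at this
  exact ZMod.val_injective p ((zt_pow_prim (p := p) 1).pow_inj (ZMod.val_lt j) (ZMod.val_lt k) this)

theorem root_pow : (AdjoinRoot.root (Polynomial.cyclotomic p ℤ) : AA p) ^ p = 1 := by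
  apply psi_inj 1
  rw [map_pow, psi_root, (zt_pow_prim (p := p) 1).pow_eq_one, map_one]

theorem prod_root (hodd : Odd p) : ∏ k : ZMod p, (AdjoinRoot.root (Polynomial.cyclotomic p ℤ) : AA p) ^ k.val = 1 := by
  refine Finset.prod_involution (fun k _ => -k) (fun k _ => ?_) (fun k _ hk => ?_) (fun _ _ => Finset.mem_univ _) (fun k _ => neg_neg k)
  · rw [← pow_add]
    by_cases hk : k = 0
    · simp [hk]
    · haveI : NeZero k := ⟨hk⟩
      rw [ZMod.val_neg_of_ne_zero, Nat.add_sub_cancel' (ZMod.val_lt k).le, root_pow]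
  · intro e
    apply hk
    have : k = 0 := by
      haveI : Fact (2 < p) := ⟨lt_of_le_of_ne hp.out.two_le (by rintro rfl; exact absurd hodd (by decide))⟩
      by_contra hk0
      exact ZMod.neg_one_ne_one (n := p) (mul_right_cancel₀ hk0 (by rw [neg_one_mul, one_mul, e]))
    simp [this]

theorem eta'_const (R : Polynomial ℤ) : constantCoeff (eta' p h R) = (R.coeff 0 : AA p) := by
  obtain ⟨u, hu, e⟩ := sg_eq (p := p) h
  have h0 : constantCoeff (sg p h) = 0 := by rw [e]; simp [hp.out.ne_zero]
  induction R using Polynomial.induction_on' with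
  | add a b ha hb => simp [ha, hb]
  | monomial n c =>
    rw [eta', Polynomial.coe_eval₂RingHom, Polynomial.eval₂_monomial, map_mul, map_pow, h0]
    cases n <;> simp

theorem sh_const (i : OnePoint (ZMod p)) : constantCoeff (sh p h i) = 0 := by
  cases i with
  | infty => obtain ⟨u, _, e⟩ := sh_inf_eq (p := p) h; rw [e]; simp [hp.out.ne_zero]
  | coe k => obtain ⟨u, _, e⟩ := sh_coe_eq (p := p) h k; rw [e]; simp

include h in
theorem exists_Psi' (hodd : Odd p) (hNp : (N : ZMod p) ≠ 0) : ∃ Ψ : Polynomial (Polynomial ℤ), Ψ.Monic ∧ Ψ.natDegree = p + 1 ∧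
    (∀ (z : ℂ), 0 < z.im → Ψ.map (evz (hm N m z)) = ∏ i, (Polynomial.X - Polynomial.C (sk N m p i z))) ∧
    (∀ j ≤ p, Polynomial.X ∣ Ψ.coeff j) ∧
    (∃ r, Ψ.coeff 1 = -Polynomial.X + Polynomial.X ^ 2 * r) ∧
    Ψ.coeff 0 = Polynomial.X ^ (p + 1) := by
  obtain ⟨Ψ, hm1, hdeg, hf, hz⟩ := exists_Psi h hNp
  have hp0 := hp.out.pos
  have hp2 := hp.out.two_le
  have hco : ∀ j ≤ p, Polynomial.X ∣ Ψ.coeff j := by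
    intro j hj
    rw [Polynomial.X_dvd_iff]
    have h1 := congrArg (Polynomial.map (constantCoeff (R := AA p))) hf
    rw [Polynomial.map_prod] at h1
    simp only [Polynomial.map_sub, Polynomial.map_X, Polynomial.map_C, sh_const, map_zero, sub_zero,
      Finset.prod_const, Finset.card_univ, card_onePoint] at h1
    have h2 := congrArg (fun P => Polynomial.coeff P j) h1
    simp only [Polynomial.coeff_map, eta'_const, Polynomial.coeff_X_pow] at h2
    rw [if_neg (by omega)] at h2
    exact_mod_cast h2
  choose u hu1 hu2 using fun k => sh_coe_eq (p := p) h k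
  obtain ⟨ui, hui1, hui2⟩ := sh_inf_eq (p := p) h
  obtain ⟨us, hus1, hus2⟩ := sg_eq (p := p) h
  have hXreg : ∀ {n : ℕ} {a b : (AA p)⟦X⟧}, X ^ n * a = X ^ n * b → a = b := fun {n a b} e =>
    mul_left_cancel₀ (pow_ne_zero n X_ne_zero) e
  refine ⟨Ψ, hm1, hdeg, hz, hco, ?_, ?_⟩
  · obtain ⟨R, hR⟩ := hco 1 (by omega)
    rw [prod_onePoint] at hf
    set P := ∏ k : ZMod p, (Polynomial.X - Polynomial.C (sh p h (k : OnePoint (ZMod p)))) with hP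
    have h1 := congrArg (fun P => Polynomial.coeff P 1) hf
    simp only [Polynomial.coeff_map, sub_mul, Polynomial.coeff_sub, Polynomial.coeff_C_mul] at h1
    rw [Polynomial.coeff_X_mul P 0] at h1
    have h2 : P.coeff 0 = - (X ^ p * ∏ k, u k) := by
      rw [hP, Polynomial.coeff_zero_prod]
      simp only [Polynomial.coeff_sub, Polynomial.coeff_X_zero, Polynomial.coeff_C_zero, zero_sub, hu2]
      rw [Finset.prod_neg, Finset.prod_mul_distrib]
      simp [ZMod.card, hodd.neg_one_pow]
    rw [h2, hui2, hR, map_mul] at h1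
    have h3 : eta' p h Polynomial.X = sg p h := by simp [eta']
    rw [h3, hus2, mul_assoc] at h1
    have h4 : X ^ p * (us * eta' p h R) = X ^ p * (- (∏ k, u k) - X ^ (p ^ 2 - p) * (ui * P.coeff 1)) := by
      have : p ^ 2 = p + (p ^ 2 - p) := by
        have : p ≤ p ^ 2 := by nlinarith
        omega
      rw [h1]; conv_lhs => rw [this, pow_add]
      ring
    have h5 := congrArg constantCoeff (hXreg h4)
    have h6 : p ^ 2 - p ≠ 0 := by
      have : p < p ^ 2 := by nlinarith
      omega
    rw [map_mul, hus1, eta'_const, map_sub, map_neg, map_prod, map_mul, map_pow, constantCoeff_X, zero_pow h6] at h5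
    simp only [hu1] at h5
    rw [prod_root hodd] at h5
    have h7 : R.coeff 0 = -1 := by
      have : ((R.coeff 0 : ℤ) : AA p) = ((-1 : ℤ) : AA p) := by simpa using h5
      exact_mod_cast this
    refine ⟨R.divX, ?_⟩
    rw [hR]
    conv_lhs => rw [← Polynomial.X_mul_divX_add R, h7]
    simp; ring
  · set R := Ψ.coeff 0 with hR
    have h1 : ∀ z : ℂ, 0 < z.im → evz (hm N m z) R = ∏ i, sk N m p i z := by
      intro z hz'
      have := congrArg (fun P => Polynomial.coeff P 0) (hz z hz')
      simp only [Polynomial.coeff_map, Polynomial.coeff_zero_prod, Polynomial.coeff_sub, Polynomial.coeff_X_zero, Polynomial.coeff_C_zero, zero_sub] at this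
      rw [this, Finset.prod_neg, Finset.card_univ, card_onePoint, (hodd.add_one).neg_one_pow, one_mul]
    set RC := R.map (Int.castRingHom ℂ) with hRC
    have hroots : ∀ t, RC.IsRoot t → t = 0 := by
      intro t ht
      by_contra ht0
      obtain ⟨z, hz', rfl⟩ := hm_surj h t ht0
      have := h1 z hz'
      rw [evz_apply, ← hRC, ht.eq_zero, eq_comm, Finset.prod_eq_zero_iff] at this
      obtain ⟨i, _, hi⟩ := this
      exact sk_ne h i hz' hi
    have hsp := (IsAlgClosed.splits RC).eq_prod_roots
    have hrep : RC.roots = Multiset.replicate (Multiset.card RC.roots) 0 :=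
      Multiset.eq_replicate.2 ⟨rfl, fun b hb => hroots b (Polynomial.isRoot_of_mem_roots hb)⟩
    rw [hrep] at hsp
    simp only [Multiset.map_replicate, map_zero, sub_zero, Multiset.prod_replicate] at hsp
    set n := Multiset.card RC.roots
    have hRn : R = Polynomial.C R.leadingCoeff * Polynomial.X ^ n := by
      apply Polynomial.map_injective (Int.castRingHom ℂ) Int.cast_injective
      rw [← hRC, hsp, Polynomial.map_mul, Polynomial.map_pow, Polynomial.map_X, Polynomial.map_C]
      rw [Polynomial.leadingCoeff_map_of_injective Int.cast_injective]
    have h2 := congrArg (fun P => Polynomial.coeff P 0) hf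
    simp only [Polynomial.coeff_map, Polynomial.coeff_zero_prod, Polynomial.coeff_sub, Polynomial.coeff_X_zero, Polynomial.coeff_C_zero, zero_sub] at h2
    rw [Finset.prod_neg, Finset.card_univ, card_onePoint, (hodd.add_one).neg_one_pow, one_mul, prod_onePoint, ← hR, hRn] at h2
    simp only [hui2, hu2, eta', Polynomial.coe_eval₂RingHom, Polynomial.eval₂_mul, Polynomial.eval₂_C, Polynomial.eval₂_X_pow, hus2] at h2
    rw [Finset.prod_mul_distrib, Finset.prod_const, Finset.card_univ, ZMod.card] at h2
    set c := R.leadingCoeff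
    set U := ui * ∏ k, u k with hU
    have hU1 : constantCoeff U = 1 := by rw [hU, map_mul, map_prod]; simp only [hu1]; rw [prod_root hodd, hui1, mul_one]
    have h3 : X ^ (p * n) * (C (c : AA p) * us ^ n) = X ^ (p * (p + 1)) * U := by
      rw [hU]
      have e : ((Int.castRingHom (AA p)⟦X⟧) c) = C (c : AA p) := by simp
      rw [e] at h2
      calc _ = C (c : AA p) * (X ^ p * us) ^ n := by ring
        _ = _ := by rw [h2]; ring
    have hn : n = p + 1 := by
      by_contra hne
      rcases lt_or_gt_of_ne hne with hlt | hlt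
      · obtain ⟨d, hd, hd'⟩ : ∃ d, d ≠ 0 ∧ p * (p + 1) = p * n + d := by
          refine ⟨p * (p + 1 - n), ?_, ?_⟩
          · have : p + 1 - n ≠ 0 := by omega
            positivity
          · rw [← mul_add]; congr 1; omega
        rw [hd', pow_add, mul_assoc] at h3
        have h4 := congrArg constantCoeff (hXreg h3)
        simp [hd, hus1] at h4
        have : c = 0 := by exact_mod_cast h4
        have hR0 : R = 0 := Polynomial.leadingCoeff_eq_zero.1 this
        obtain ⟨z, hz', _⟩ := hm_surj h 1 one_ne_zero
        have h5 := h1 z hz'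
        rw [hR0, map_zero, eq_comm, Finset.prod_eq_zero_iff] at h5
        obtain ⟨i, _, hi⟩ := h5
        exact sk_ne h i hz' hi
      · obtain ⟨d, hd, hd'⟩ : ∃ d, d ≠ 0 ∧ p * n = p * (p + 1) + d := by
          refine ⟨p * (n - (p + 1)), ?_, ?_⟩
          · have : n - (p + 1) ≠ 0 := by omega
            positivity
          · rw [← mul_add]; congr 1; omega
        rw [hd', pow_add, mul_assoc] at h3
        have h4 := congrArg constantCoeff (hXreg h3)
        simp [hd, hU1] at h4
    rw [hn] at h3 hRn
    have h4 := congrArg constantCoeff (hXreg h3)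
    rw [map_mul, map_pow, hus1, hU1, one_pow, mul_one, constantCoeff_C] at h4
    have : c = 1 := by exact_mod_cast h4
    rw [hRn, this]; simp
end
end Shih

set_option maxHeartbeats 400000
set_option linter.all false
namespace Shih
open Complex OnePoint PowerSeries

section
variable {N m p : ℕ} [hp : Fact p.Prime] (h : NM N m)

theorem sh_coe_1 (k : ZMod p) : coeff 1 (sh p h (k : OnePoint (ZMod p))) = AdjoinRoot.root _ ^ k.val := by
  obtain ⟨u, h1, h2⟩ := sh_coe_eq (p := p) h k
  rw [h2, show (1 : ℕ) = 0 + 1 from rfl, coeff_succ_X_mul, coeff_zero_eq_constantCoeff_apply, h1]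

theorem sh_inf_1 : coeff 1 (sh p h ∞) = 0 := by
  obtain ⟨u, h1, h2⟩ := sh_inf_eq (p := p) h
  rw [h2]
  refine coeff_of_lt_order _ ?_
  refine lt_of_lt_of_le ?_ (le_order_mul (φ := X ^ p ^ 2) (ψ := u))
  rw [order_X_pow]
  refine lt_of_lt_of_le ?_ le_self_add
  have := hp.out.one_lt
  exact_mod_cast (by nlinarith : 1 < p ^ 2)

theorem sh_inj : Function.Injective (sh p h) := by
  intro i j e
  have e1 := congrArg (coeff 1) e
  have hne : ∀ k : ZMod p, (AdjoinRoot.root (Polynomial.cyclotomic p ℤ) : AA p) ^ k.val ≠ 0 := fun k => pow_ne_zero _ root_ne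
  cases i with
  | infty =>
    cases j with
    | infty => rfl
    | coe k => rw [sh_inf_1, sh_coe_1] at e1; exact absurd e1.symm (hne k)
  | coe k =>
    cases j with
    | infty => rw [sh_inf_1, sh_coe_1] at e1; exact absurd e1 (hne k)
    | coe l => rw [sh_coe_1, sh_coe_1] at e1; rw [root_inj e1]

include h in
open Classical in
theorem A5 (hNp : (N : ZMod p) ≠ 0) : ∃ D : Polynomial ℤ, D ≠ 0 ∧ ∀ z : ℂ, 0 < z.im → evz (hm N m z) D ≠ 0 →
    Function.Injective (fun i => sk N m p i z) ∧ ∀ i, (N : ℂ) ^ m * sk N m p i z + 1 ≠ 0 := by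
  let f : MvPolynomial (OnePoint (ZMod p)) ℤ :=
    (∏ x ∈ (Finset.univ : Finset (OnePoint (ZMod p))).offDiag, (MvPolynomial.X x.1 - MvPolynomial.X x.2)) *
      ∏ i, ((N : MvPolynomial (OnePoint (ZMod p)) ℤ) ^ m * MvPolynomial.X i + 1)
  have hf : ∀ e : Equiv.Perm (OnePoint (ZMod p)), MvPolynomial.rename e f = f := by
    intro e
    simp only [f, map_mul, map_prod, map_sub, map_add, map_one, map_pow, map_natCast, MvPolynomial.rename_X]
    congr 1
    · refine Finset.prod_nbij' (fun x => (e x.1, e x.2)) (fun x => (e.symm x.1, e.symm x.2)) ?_ ?_ ?_ ?_ ?_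
      all_goals simp
    · exact Equiv.prod_comp e (fun i => ((N : MvPolynomial (OnePoint (ZMod p)) ℤ) ^ m * MvPolynomial.X i + 1))
  obtain ⟨R, hR1, hR2⟩ := A1sym h hNp f hf
  refine ⟨R, ?_, fun z hz hne => ?_⟩
  · rintro rfl
    rw [map_zero] at hR1
    simp only [f, map_mul, map_prod, map_sub, map_add, map_one, map_pow, map_natCast, MvPolynomial.aeval_X] at hR1
    rcases mul_eq_zero.1 hR1.symm with h1 | h1
    · obtain ⟨x, hx, h2⟩ := Finset.prod_eq_zero_iff.1 h1
      exact (Finset.mem_offDiag.1 hx).2.2 (sh_inj h (sub_eq_zero.1 h2))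
    · obtain ⟨x, hx, h2⟩ := Finset.prod_eq_zero_iff.1 h1
      have := congrArg constantCoeff h2
      simp [sh_const] at this
  · rw [hR2 z hz] at hne
    simp only [f, map_mul, map_prod, map_sub, map_add, map_one, map_pow, map_natCast, MvPolynomial.aeval_X] at hne
    have h1 := left_ne_zero_of_mul hne
    have h2 := right_ne_zero_of_mul hne
    rw [Finset.prod_ne_zero_iff] at h1 h2
    refine ⟨fun i j hij => ?_, fun i => h2 i (Finset.mem_univ _)⟩
    by_contra hc
    exact h1 (i, j) (by simpa using hc) (sub_eq_zero.2 hij)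

theorem ma_one (i : OnePoint (ZMod p)) : ma 1 i = i := by cases i <;> simp [ma]

theorem A6_aux (c : ℂ) (S : Finset (OnePoint (ZMod p))) (hS : ∀ z : ℂ, 0 < z.im → ∃ i ∈ S, sk N m p i z = c * hm N m z ^ p) :
    ∃ i ∈ S, PowerSeries.map (psi (1 : (ZMod p)ˣ)) (sh p h i) = C c * (PowerSeries.map (psi (1 : (ZMod p)ˣ)) (sg p h)) ^ p := by
  have h0 : ∏ i ∈ S, ((⟨_, sh_mem h 1 i⟩ : Conv) - Cc c * ⟨_, sg_mem h (1 : (ZMod p)ˣ)⟩ ^ p) = 0 := by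
    refine ev_inj' _ _ fun q hq h0 => ?_
    obtain ⟨z, hz, rfl⟩ := exists_qp (p := p) h0 hq
    rw [map_prod, map_zero, Finset.prod_eq_zero_iff]
    obtain ⟨i, hi, e⟩ := hS z hz
    refine ⟨i, hi, ?_⟩
    rw [map_sub, ev_sh h 1 i hz, map_mul, map_pow, ev_sg h 1 hz, ma_one, e]
    rw [show ev (qp p z) hq (Cc c) = c from ev_C c (qp p z) _, sub_self]
  obtain ⟨i, hi, e⟩ := Finset.prod_eq_zero_iff.1 h0
  exact ⟨i, hi, congrArg Subtype.val (sub_eq_zero.1 e)⟩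

include h in
theorem A6 (hNp : (N : ZMod p) ≠ 0) (c : ℂ) : ∃ z : ℂ, 0 < z.im ∧ ∀ i, sk N m p i z ≠ c * hm N m z ^ p := by
  have key : ∀ (c : ℂ) (k : ZMod p), PowerSeries.map (psi (1 : (ZMod p)ˣ)) (sh p h k) ≠ C c * (PowerSeries.map (psi (1 : (ZMod p)ˣ)) (sg p h)) ^ p := by
    intro c k e
    have e1 := congrArg (coeff 1) e
    rw [PowerSeries.coeff_map, sh_coe_1] at e1
    obtain ⟨u, hu1, hu⟩ := sg_eq (p := p) h
    have : coeff 1 (C c * (PowerSeries.map (psi (1 : (ZMod p)ˣ)) (sg p h)) ^ p) = 0 := by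
      rw [hu, map_mul (PowerSeries.map _), map_pow (PowerSeries.map _), PowerSeries.map_X, mul_pow, ← pow_mul, mul_left_comm, coeff_X_pow_mul', if_neg]
      have := hp.out.one_lt
      nlinarith
    rw [this] at e1
    exact pow_ne_zero k.val root_ne (psi_inj (p := p) 1 (e1.trans (map_zero _).symm))
  by_contra! hc
  obtain ⟨i, -, hi⟩ := A6_aux h c Finset.univ (fun z hz => by obtain ⟨i, hi⟩ := hc z hz; exact ⟨i, Finset.mem_univ _, hi⟩)
  cases i with
  | coe k => exact key c k hi
  | infty =>
    have h1 : ∀ z : ℂ, 0 < z.im → sk N m p ∞ z = c * hm N m z ^ p := by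
      intro z hz
      have e : (⟨_, sh_mem h (1 : (ZMod p)ˣ) ∞⟩ : Conv) = Cc c * ⟨_, sg_mem h (1 : (ZMod p)ˣ)⟩ ^ p := Subtype.ext hi
      have e2 := congrArg (ev (qp p z) (qp_lt h hz)) e
      rw [ev_sh h 1 _ hz, map_mul, map_pow, ev_sg h 1 hz, ma_one] at e2
      rw [e2, show ev (qp p z) _ (Cc c) = c from ev_C c (qp p z) _]
    have hK : ((N : ℂ) ^ m) ^ 2 ≠ 0 := by have := h.pos.ne'; positivity
    have hc0 : c ≠ 0 := by
      rintro rfl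
      obtain ⟨z, hz, _⟩ := hm_surj h 1 one_ne_zero
      exact sk_ne h ∞ hz (by rw [h1 z hz, zero_mul])
    let g : GL (Fin 2) (ZMod p) := Matrix.GeneralLinearGroup.mkOfDetNeZero !![0, -1; (N : ZMod p), 0] (by simpa using hNp)
    have hg : g • (∞ : OnePoint (ZMod p)) = ((0 : ZMod p) : OnePoint (ZMod p)) := by
      rw [OnePoint.smul_infty_eq_ite]
      have e1 : g 1 0 = N := rfl
      have e2 : g 0 0 = 0 := rfl
      rw [e1, e2, if_neg hNp]; simp
    obtain ⟨i, hi', e⟩ := A6_aux (p := p) h ((((N : ℂ) ^ m) ^ 2) ^ p / (((N : ℂ) ^ m) ^ 2 * c)) {((0 : ZMod p) : OnePoint (ZMod p))} (by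
      intro z hz
      refine ⟨_, Finset.mem_singleton_self _, ?_⟩
      have h2 := h1 _ (im_w h.pos hz)
      rw [sk_w h g rfl rfl rfl rfl hNp ∞ hz, hg, hm_w h hz] at h2
      have n1 := sk_ne h ((0 : ZMod p) : OnePoint (ZMod p)) hz
      have n2 := hm_ne h hz
      have n3 := pow_ne_zero p n2
      have n4 := pow_ne_zero p hK
      rw [div_pow, one_pow, mul_pow] at h2
      field_simp at h2 ⊢
      first | linear_combination h2 | linear_combination -h2 | linear_combination h2 * 0)
    rw [Finset.mem_singleton] at hi'
    subst hi'
    exact key _ _ e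
end
end Shih

set_option maxHeartbeats 400000
set_option linter.all false
namespace Shih
open OnePoint
open scoped MatrixGroups

section
variable {p : ℕ} [hp : Fact p.Prime]

/-- SL₂ acting on the projective line -/
noncomputable def act (p : ℕ) [hp : Fact p.Prime] : Matrix.SpecialLinearGroup (Fin 2) (ZMod p) →* Equiv.Perm (OnePoint (ZMod p)) :=
  (MulAction.toPermHom (GL (Fin 2) (ZMod p)) (OnePoint (ZMod p))).comp Matrix.SpecialLinearGroup.toGL

theorem act_apply (g : Matrix.SpecialLinearGroup (Fin 2) (ZMod p)) (i) : act p g i = Matrix.SpecialLinearGroup.toGL g • i := rfl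

theorem smul_scale (g g' : GL (Fin 2) (ZMod p)) (r : ZMod p) (hr : r ≠ 0) (hg : ∀ i j, g i j = r * g' i j)
    (i : OnePoint (ZMod p)) : g • i = g' • i := by
  cases i with
  | infty =>
    rw [OnePoint.smul_infty_eq_ite, OnePoint.smul_infty_eq_ite, hg, hg]
    by_cases h : g' 1 0 = 0
    · simp [h]
    · rw [if_neg h, if_neg (mul_ne_zero hr h), mul_div_mul_left _ _ hr]
  | coe k =>
    rw [OnePoint.smul_some_eq_ite, OnePoint.smul_some_eq_ite, hg, hg, hg, hg]
    have e : r * g' 1 0 * k + r * g' 1 1 = r * (g' 1 0 * k + g' 1 1) := by ring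
    have e' : r * g' 0 0 * k + r * g' 0 1 = r * (g' 0 0 * k + g' 0 1) := by ring
    rw [e, e']
    by_cases h : g' 1 0 * k + g' 1 1 = 0
    · simp [h]
    · rw [if_neg h, if_neg (mul_ne_zero hr h), mul_div_mul_left _ _ hr]

theorem act_of_sq (g : GL (Fin 2) (ZMod p)) (hg : IsSquare (g.1.det)) : MulAction.toPerm g ∈ (act p).range := by
  obtain ⟨r, hr⟩ := hg
  have hdet : g.1.det ≠ 0 := by
    have := (Matrix.isUnit_iff_isUnit_det g.1).1 g.isUnit
    exact this.ne_zero
  have hr0 : r ≠ 0 := by rintro rfl; simp at hr; exact hdet hr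
  refine ⟨⟨r⁻¹ • g.1, ?_⟩, ?_⟩
  · rw [Matrix.det_smul, hr, Fintype.card_fin, inv_pow, ← sq, inv_mul_cancel₀ (pow_ne_zero 2 hr0)]
  · ext1 i
    refine (smul_scale g _ r hr0 ?_ i).symm
    intro i j
    exact (mul_inv_cancel_left₀ hr0 (g i j)).symm

theorem act_ker : (act p).ker = Subgroup.center (Matrix.SpecialLinearGroup (Fin 2) (ZMod p)) := by
  ext g
  rw [MonoidHom.mem_ker, Matrix.SpecialLinearGroup.mem_center_iff]
  constructor
  · intro hg
    have h1 : ∀ i, Matrix.SpecialLinearGroup.toGL g • i = i := fun i => by rw [← act_apply, hg]; rfl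
    have hdet := g.2
    rw [Matrix.det_fin_two] at hdet
    have h2 := h1 ∞
    rw [OnePoint.smul_infty_eq_self_iff, toGL_apply] at h2
    have h2' : g.1 1 0 = 0 := h2
    rw [h2', mul_zero, sub_zero] at hdet
    have hd : g.1 1 1 ≠ 0 := right_ne_zero_of_mul (hdet.trans_ne one_ne_zero)
    have h3 := h1 ((0 : ZMod p) : OnePoint (ZMod p))
    rw [OnePoint.smul_some_eq_ite] at h3
    simp only [toGL_apply, mul_zero, zero_add] at h3
    rw [if_neg hd] at h3
    have h4 : g.1 0 1 = 0 := by
      have := OnePoint.coe_injective h3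
      rw [div_eq_zero_iff] at this
      exact this.resolve_right hd
    have h5 := h1 ((1 : ZMod p) : OnePoint (ZMod p))
    rw [OnePoint.smul_some_eq_ite] at h5
    simp only [toGL_apply, mul_one] at h5
    rw [h2, h4, zero_add, add_zero, if_neg hd] at h5
    have h6 : g.1 0 0 = g.1 1 1 := by
      have := OnePoint.coe_injective h5
      rwa [div_eq_one_iff_eq hd] at this
    refine ⟨g.1 0 0, ?_, ?_⟩
    · rw [Fintype.card_fin, sq]; nth_rw 2 [h6]; exact hdet
    · ext i j
      fin_cases i <;> fin_cases j <;> simp [h2', h4, h6]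
  · rintro ⟨r, hr, e⟩
    have hr0 : r ≠ 0 := by rintro rfl; simp at hr
    ext1 i
    rw [act_apply]
    have := smul_scale (Matrix.SpecialLinearGroup.toGL g) 1 r hr0 (fun i j => by
      rw [toGL_apply]
      change g.1 i j = r * (1 : Matrix (Fin 2) (Fin 2) (ZMod p)) i j
      rw [← e]
      fin_cases i <;> fin_cases j <;> simp) i
    rw [this, one_smul]; rfl

/-- upper unipotent -/
def upp (x : ZMod p) : Matrix.SpecialLinearGroup (Fin 2) (ZMod p) := ⟨!![1, x; 0, 1], by simp⟩
/-- lower unipotent -/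
def low (x : ZMod p) : Matrix.SpecialLinearGroup (Fin 2) (ZMod p) := ⟨!![1, 0; x, 1], by simp⟩

theorem upp_val (x : ZMod p) : (upp x).1 = !![1, x; 0, 1] := rfl
theorem low_val (x : ZMod p) : (low x).1 = !![1, 0; x, 1] := rfl

theorem upp_pow (x : ZMod p) (n : ℕ) : upp x ^ n = upp ((n : ZMod p) * x) := by
  induction n with
  | zero => ext i j; fin_cases i <;> fin_cases j <;> simp [upp_val]
  | succ n ih =>
    rw [pow_succ, ih]
    ext i j
    fin_cases i <;> fin_cases j <;> simp [upp_val, Matrix.mul_apply, Fin.sum_univ_two]; ring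

theorem gen_top (H : Subgroup (Matrix.SpecialLinearGroup (Fin 2) (ZMod p))) (t : ZMod p) (ht : t ≠ 0) (hu : upp t ∈ H)
    (g : Matrix.SpecialLinearGroup (Fin 2) (ZMod p)) (hg : g ∈ H) (hc : g.1 1 0 ≠ 0) : H = ⊤ := by
  have hU : ∀ x, upp x ∈ H := by
    intro x
    have := H.pow_mem hu (x / t).val
    rw [upp_pow, ZMod.natCast_zmod_val, div_mul_cancel₀ _ ht] at this
    exact this
  have hdec : ∀ k : Matrix.SpecialLinearGroup (Fin 2) (ZMod p), k.1 1 0 ≠ 0 →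
      k = upp ((k.1 0 0 - 1) / k.1 1 0) * low (k.1 1 0) * upp ((k.1 1 1 - 1) / k.1 1 0) := by
    intro k hk
    have hdet := k.2
    rw [Matrix.det_fin_two] at hdet
    ext i j
    fin_cases i <;> fin_cases j <;> simp [upp_val, low_val, Matrix.mul_apply, Fin.sum_univ_two] <;> field_simp
    · ring
    · linear_combination -hdet
    · ring
  let w : Matrix.SpecialLinearGroup (Fin 2) (ZMod p) := ⟨!![0, -(g.1 1 0)⁻¹; g.1 1 0, 0], by simp [hc]⟩
  have hwv : w.1 = !![0, -(g.1 1 0)⁻¹; g.1 1 0, 0] := rfl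
  clear_value w
  have hw : w ∈ H := by
    have : w = upp (-(g.1 0 0) / g.1 1 0) * g * upp (-(g.1 1 1) / g.1 1 0) := by
      have hdet := g.2
      rw [Matrix.det_fin_two] at hdet
      ext i j
      fin_cases i <;> fin_cases j <;> simp [upp_val, hwv, Matrix.mul_apply, Fin.sum_univ_two, Matrix.vecMul, dotProduct] <;> (try field_simp)
      · ring
      · linear_combination hdet
      · ring
    rw [this]
    exact H.mul_mem (H.mul_mem (hU _) hg) (hU _)
  have hL : ∀ x, low x ∈ H := by
    intro x
    have : low x = w * upp (-x / (g.1 1 0) ^ 2) * w⁻¹ := by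
      rw [eq_mul_inv_iff_mul_eq]
      ext i j
      fin_cases i <;> fin_cases j <;> simp [upp_val, low_val, hwv, Matrix.mul_apply, Fin.sum_univ_two] <;> field_simp
    rw [this]
    exact H.mul_mem (H.mul_mem hw (hU _)) (H.inv_mem hw)
  have h1 : ∀ k : Matrix.SpecialLinearGroup (Fin 2) (ZMod p), k.1 1 0 ≠ 0 → k ∈ H := by
    intro k hk
    rw [hdec k hk]
    exact H.mul_mem (H.mul_mem (hU _) (hL _)) (hU _)
  rw [Subgroup.eq_top_iff']
  intro k
  by_cases hk : k.1 1 0 = 0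
  · have h2 : low 1 * k ∈ H := by
      apply h1
      have hdet := k.2
      rw [Matrix.det_fin_two, hk, mul_zero, sub_zero] at hdet
      simp [low_val, Matrix.mul_apply, Fin.sum_univ_two, hk]
      exact left_ne_zero_of_mul (hdet.trans_ne one_ne_zero)
    have := H.mul_mem (H.inv_mem (hL 1)) h2
    rwa [inv_mul_cancel_left] at this
  · exact h1 k hk

end
end Shih

set_option maxHeartbeats 400000
set_option linter.all false
namespace Shih
open OnePoint
open scoped MatrixGroups

section
variable {p : ℕ} [hp : Fact p.Prime]

theorem exists_fix (g : SL(2, ZMod p)) (hg : g ^ p = 1) : ∃ v : Fin 2 → ZMod p, v ≠ 0 ∧ g.1.mulVec v = v := by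
  have h1 : (g.1 - 1) ^ p = 0 := by
    rw [sub_pow_char_of_commute (p := p) (Commute.one_right g.1)]
    have := congrArg Subtype.val hg
    rw [Matrix.SpecialLinearGroup.coe_pow] at this
    rw [this, one_pow]; simp
  have h2 : (g.1 - 1).det = 0 := by
    have := congrArg Matrix.det h1
    rw [Matrix.det_pow, Matrix.det_zero] at this
    · exact pow_eq_zero_iff hp.out.ne_zero |>.1 this
  obtain ⟨v, hv, e⟩ := Matrix.exists_mulVec_eq_zero_iff.2 h2
  refine ⟨v, hv, ?_⟩
  rw [Matrix.sub_mulVec, Matrix.one_mulVec, sub_eq_zero] at e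
  exact e

theorem exists_col (v : Fin 2 → ZMod p) (hv : v ≠ 0) : ∃ x : SL(2, ZMod p), ∀ i, x.1 i 0 = v i := by
  by_cases h0 : v 0 = 0
  · have h1 : v 1 ≠ 0 := by
      intro h1; apply hv; ext i; fin_cases i <;> simp [h0, h1]
    refine ⟨⟨!![v 0, -(v 1)⁻¹; v 1, 0], by simp [h1]⟩, fun i => ?_⟩
    fin_cases i <;> simp
  · refine ⟨⟨!![v 0, 0; v 1, (v 0)⁻¹], by simp [h0]⟩, fun i => ?_⟩
    fin_cases i <;> simp

theorem sub_top (H : Subgroup (SL(2, ZMod p))) (hcard : p ∣ Nat.card H)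
    (hfix : ∀ i, ∃ g ∈ H, act p g i ≠ i) : H = ⊤ := by
  obtain ⟨g, hg⟩ := exists_prime_orderOf_dvd_card' (G := H) p hcard
  have hg1 : (g : SL(2, ZMod p)) ^ p = 1 := by
    have := pow_orderOf_eq_one g
    rw [hg] at this
    exact_mod_cast congrArg Subtype.val this
  have hgne : (g : SL(2, ZMod p)) ≠ 1 := by
    intro e
    have : g = 1 := Subtype.ext e
    rw [this, orderOf_one] at hg
    exact hp.out.one_lt.ne hg
  obtain ⟨v, hv, e⟩ := exists_fix _ hg1
  obtain ⟨x, hx⟩ := exists_col v hv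
  have hxv : x.1.mulVec ![1, 0] = v := by
    ext i
    simp [Matrix.mulVec, dotProduct, Fin.sum_univ_two, hx]
  set y := x⁻¹ * g.1 * x with hy
  have hy1 : y.1.mulVec ![1, 0] = ![1, 0] := by
    rw [hy, Matrix.SpecialLinearGroup.coe_mul, Matrix.SpecialLinearGroup.coe_mul, ← Matrix.mulVec_mulVec, ← Matrix.mulVec_mulVec, hxv, e, ← hxv,
      Matrix.mulVec_mulVec, ← Matrix.SpecialLinearGroup.coe_mul, inv_mul_cancel]
    simp
  have hy00 : y.1 0 0 = 1 := by simpa [Matrix.mulVec, dotProduct, Fin.sum_univ_two] using congrFun hy1 0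
  have hy10 : y.1 1 0 = 0 := by simpa [Matrix.mulVec, dotProduct, Fin.sum_univ_two] using congrFun hy1 1
  have hy11 : y.1 1 1 = 1 := by
    have := y.2
    rw [Matrix.det_fin_two, hy00, hy10] at this
    simpa using this
  have hyu : y = upp (y.1 0 1) := by
    ext i j
    fin_cases i <;> fin_cases j <;> simp [upp_val, hy00, hy10, hy11]
  have hyne : y.1 0 1 ≠ 0 := by
    intro h0
    apply hgne
    have : y = 1 := by
      rw [hyu, h0]
      ext i j
      fin_cases i <;> fin_cases j <;> simp [upp_val]
    rw [hy, mul_assoc, inv_mul_eq_one] at this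
    exact (mul_eq_right.1 this.symm)
  obtain ⟨k, hk, hk2⟩ := hfix (act p x ∞)
  have hk3 : (x⁻¹ * k * x).1 1 0 ≠ 0 := by
    intro h0
    have : act p (x⁻¹ * k * x) ∞ = ∞ := by
      rw [act_apply, OnePoint.smul_infty_eq_self_iff]; exact h0
    rw [map_mul, map_mul, map_inv, Equiv.Perm.mul_apply, Equiv.Perm.mul_apply, Equiv.Perm.inv_eq_iff_eq] at this
    exact hk2 this
  have htop := gen_top (H.comap (MulAut.conj x).toMonoidHom) _ hyne (by
    rw [← hyu, Subgroup.mem_comap]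
    change x * (x⁻¹ * g.1 * x) * x⁻¹ ∈ H
    have : x * (x⁻¹ * g.1 * x) * x⁻¹ = g.1 := by group
    rw [this]; exact g.2) (x⁻¹ * k * x) (by
    rw [Subgroup.mem_comap]
    change x * (x⁻¹ * k * x) * x⁻¹ ∈ H
    have : x * (x⁻¹ * k * x) * x⁻¹ = k := by group
    rw [this]; exact hk) hk3
  rw [Subgroup.eq_top_iff'] at htop ⊢
  intro b
  have := htop (x⁻¹ * b * x)
  rw [Subgroup.mem_comap] at this
  change x * (x⁻¹ * b * x) * x⁻¹ ∈ H at this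
  have e2 : x * (x⁻¹ * b * x) * x⁻¹ = b := by group
  rwa [e2] at this

theorem perm_sub_top (H : Subgroup (Equiv.Perm (OnePoint (ZMod p)))) (hH : H ≤ (act p).range) (hcard : p ∣ Nat.card H)
    (hfix : ∀ i, ∃ g ∈ H, g i ≠ i) : H = (act p).range := by
  have h1 : (H.comap (act p)).map (act p) = H := Subgroup.map_comap_eq_self hH
  have h2 : H.comap (act p) = ⊤ := by
    apply sub_top
    · refine hcard.trans ?_
      conv_lhs => rw [← h1]
      exact Subgroup.card_map_dvd _ _
    · intro i
      obtain ⟨g, hg, hgi⟩ := hfix i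
      obtain ⟨k, rfl⟩ := hH hg
      exact ⟨k, hg, hgi⟩
  rw [← h1, h2, MonoidHom.range_eq_map]

theorem separation (u v : OnePoint (ZMod p) → ℂ)
    (huv : ∀ f : MvPolynomial (OnePoint (ZMod p)) ℤ, GInv f → MvPolynomial.aeval u f = MvPolynomial.aeval v f) :
    ∃ σ ∈ (act p).range, ∀ i, v i = u (σ i) := by
  classical
  obtain ⟨e⟩ : Nonempty (OnePoint (ZMod p) ≃ Fin (p + 1)) := ⟨Fintype.equivFinOfCardEq card_onePoint⟩
  let L : ℕ → MvPolynomial (OnePoint (ZMod p)) ℤ := fun n => ∑ i, (n : MvPolynomial (OnePoint (ZMod p)) ℤ) ^ (e i : ℕ) * MvPolynomial.X i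
  let Q : ℕ → Polynomial (MvPolynomial (OnePoint (ZMod p)) ℤ) := fun n =>
    ∏ g : SL(2, ZMod p), (Polynomial.X - Polynomial.C (MvPolynomial.rename (act p g) (L n)))
  have hQ : ∀ n j, GInv ((Q n).coeff j) := by
    intro n j g
    have h1 : (Q n).map (MvPolynomial.rename (R := ℤ) (act p g)).toRingHom = Q n := by
      simp only [Q]
      rw [Polynomial.map_prod]
      refine Fintype.prod_equiv (Equiv.mulLeft g) _ _ fun k => ?_
      simp only [Polynomial.map_sub, Polynomial.map_X, Polynomial.map_C, Equiv.coe_mulLeft]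
      congr 2
      change MvPolynomial.rename _ (MvPolynomial.rename _ _) = _
      rw [MvPolynomial.rename_rename, map_mul]
      rfl
    conv_rhs => rw [← h1, Polynomial.coeff_map]
    rfl
  have key : ∀ n : ℕ, ∃ g : SL(2, ZMod p), ∑ i, (n : ℂ) ^ (e i : ℕ) * (v i - u (act p g i)) = 0 := by
    intro n
    have h1 : (Q n).map (MvPolynomial.aeval u).toRingHom = (Q n).map (MvPolynomial.aeval v).toRingHom := by
      ext j
      rw [Polynomial.coeff_map, Polynomial.coeff_map]
      exact huv _ (hQ n j)
    have h2 : ∀ w : OnePoint (ZMod p) → ℂ, ((Q n).map (MvPolynomial.aeval w).toRingHom).eval (MvPolynomial.aeval v (L n)) =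
        ∏ g : SL(2, ZMod p), (MvPolynomial.aeval v (L n) - MvPolynomial.aeval (w ∘ act p g) (L n)) := by
      intro w
      simp only [Q]
      rw [Polynomial.map_prod, Polynomial.eval_prod]
      refine Finset.prod_congr rfl fun g _ => ?_
      simp only [Polynomial.map_sub, Polynomial.map_X, Polynomial.map_C, Polynomial.eval_sub, Polynomial.eval_X, Polynomial.eval_C]
      congr 1
      exact MvPolynomial.aeval_rename _ _ _
    have h3 := h2 u
    rw [h1, h2 v, Finset.prod_eq_zero (Finset.mem_univ 1) (by rw [map_one]; exact sub_self _), eq_comm, Finset.prod_eq_zero_iff] at h3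
    obtain ⟨g, -, hg⟩ := h3
    refine ⟨g, ?_⟩
    rw [← hg]
    simp only [L, map_sum, map_mul, map_pow, map_natCast, MvPolynomial.aeval_X]
    rw [← Finset.sum_sub_distrib]
    exact Finset.sum_congr rfl fun i _ => by simp [mul_sub]
  choose g hg using key
  obtain ⟨g0, hg0⟩ := Finite.exists_infinite_fiber g
  refine ⟨act p g0, ⟨g0, rfl⟩, ?_⟩
  let P : Polynomial ℂ := ∑ i, Polynomial.C (v i - u (act p g0 i)) * Polynomial.X ^ (e i : ℕ)
  have hP : P = 0 := by
    refine Polynomial.eq_zero_of_infinite_isRoot P ?_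
    have : Set.Infinite ((fun n : ℕ => (n : ℂ)) '' (g ⁻¹' {g0})) :=
      (Set.infinite_coe_iff.1 hg0).image Nat.cast_injective.injOn
    refine this.mono ?_
    rintro _ ⟨n, hn, rfl⟩
    have h4 := hg n
    rw [show g n = g0 from hn] at h4
    change Polynomial.eval _ _ = 0
    simp only [P, Polynomial.eval_finset_sum, Polynomial.eval_mul, Polynomial.eval_C, Polynomial.eval_pow, Polynomial.eval_X]
    rw [← h4]
    exact Finset.sum_congr rfl fun i _ => mul_comm _ _
  intro i
  have h5 := congrArg (fun P => Polynomial.coeff P (e i : ℕ)) hP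
  simp only [P, Polynomial.finset_sum_coeff, Polynomial.coeff_C_mul, Polynomial.coeff_X_pow, Polynomial.coeff_zero] at h5
  rw [Finset.sum_eq_single i] at h5
  · simp at h5; exact sub_eq_zero.1 h5
  · intro j _ hj
    rw [if_neg, mul_zero]
    intro h6; exact hj (e.injective (Fin.ext h6)).symm
  · simp
end
end Shih

set_option maxHeartbeats 400000
set_option linter.all false
namespace Shih
open OnePoint
open scoped MatrixGroups

section
variable {N m p : ℕ} [hp : Fact p.Prime] (h : NM N m)

/-- diagonal matrix -/
noncomputable def dg (a : (ZMod p)ˣ) : GL (Fin 2) (ZMod p) := Matrix.GeneralLinearGroup.mkOfDetNeZero !![(a : ZMod p), 0; 0, 1] (by simp)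

theorem dg_smul (a : (ZMod p)ˣ) (i : OnePoint (ZMod p)) : dg a • i = ma a i := by
  have e1 : dg a 0 0 = a := rfl
  have e2 : dg a 0 1 = 0 := rfl
  have e3 : dg a 1 0 = 0 := rfl
  have e4 : dg a 1 1 = 1 := rfl
  cases i with
  | infty => rw [OnePoint.smul_infty_eq_ite, e3, if_pos rfl]; rfl
  | coe k => rw [OnePoint.smul_some_eq_ite, e1, e2, e3, e4]; simp [ma]

theorem dg_det (a : (ZMod p)ˣ) : (dg a).1.det = a := by
  change Matrix.det !![(a : ZMod p), 0; 0, 1] = a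
  simp

/-- Fricke matrix -/
noncomputable def wg (N : ℕ) (hNp : (N : ZMod p) ≠ 0) : GL (Fin 2) (ZMod p) :=
  Matrix.GeneralLinearGroup.mkOfDetNeZero !![0, -1; (N : ZMod p), 0] (by simpa using hNp)

theorem wg_det (hNp : (N : ZMod p) ≠ 0) : (wg N hNp).1.det = N := by
  change Matrix.det !![0, -1; (N : ZMod p), 0] = N
  simp

include h in
theorem gal_f (hNp : (N : ZMod p) ≠ 0) (L : IntermediateField ℚ ℂ) (φ : L →+* ℂ) (ζ s0 : L) (ξ : OnePoint (ZMod p) → L) (z : ℂ) (hz : 0 < z.im)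
    (hζ : (ζ : ℂ) = zt p) (hs : (s0 : ℂ) = hm N m z) (hξ : ∀ i, (ξ i : ℂ) = sk N m p i z)
    (a : (ZMod p)ˣ) (ha : φ ζ = zt p ^ (a : ZMod p).val) (z' : ℂ) (hz' : 0 < z'.im) (hs' : φ s0 = hm N m z')
    (f : MvPolynomial (OnePoint (ZMod p)) ℤ) (hf : GInv f) :
    MvPolynomial.aeval (fun i => sk N m p (ma a i) z') f = MvPolynomial.aeval (fun i => φ (ξ i)) f := by
  obtain ⟨Q, -, hQ⟩ := A1 h hNp f hf
  have hroot : (Polynomial.cyclotomic p ℤ).eval₂ (Int.castRingHom L) ζ = 0 := by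
    apply Subtype.val_injective
    change L.val.toRingHom _ = _
    rw [Polynomial.hom_eval₂]
    change _ = (0 : ℂ)
    have h1 := (zt_prim (p := p)).isRoot_cyclotomic hp.out.pos
    rw [Polynomial.IsRoot, ← Polynomial.map_cyclotomic_int, Polynomial.eval_map] at h1
    rw [← h1]
    congr 1
  let ψ : AA p →+* L := AdjoinRoot.lift (Int.castRingHom L) ζ hroot
  have hψ1 : ∀ x, L.val.toRingHom (ψ x) = psi 1 x := by
    intro x
    obtain ⟨r, rfl⟩ := AdjoinRoot.mk_surjective x
    rw [psi_mk, show ψ (AdjoinRoot.mk _ r) = _ from AdjoinRoot.lift_mk _ _, Polynomial.hom_eval₂]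
    congr 1
    · rw [Units.val_one, ZMod.val_one, pow_one]; exact hζ
  have hψa : ∀ x, φ (ψ x) = psi a x := by
    intro x
    obtain ⟨r, rfl⟩ := AdjoinRoot.mk_surjective x
    rw [psi_mk, show ψ (AdjoinRoot.mk _ r) = _ from AdjoinRoot.lift_mk _ _, Polynomial.hom_eval₂]
    congr 1
    · exact RingHom.ext_int _ _
  have h1 : MvPolynomial.eval₂ (Int.castRingHom L) ξ f = Q.eval₂ ψ s0 := by
    apply Subtype.val_injective
    change L.val.toRingHom _ = L.val.toRingHom _
    rw [MvPolynomial.hom_eval₂, Polynomial.hom_eval₂, show L.val.toRingHom.comp ψ = psi 1 from RingHom.ext hψ1]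
    have := hQ 1 z hz
    rw [Polynomial.eval_map, ← hs, MvPolynomial.aeval_def] at this
    refine Eq.trans ?_ this
    congr 1
    funext i
    rw [ma_one, ← hξ]; rfl
  have h2 := congrArg φ h1
  rw [MvPolynomial.hom_eval₂, Polynomial.hom_eval₂, show φ.comp ψ = psi a from RingHom.ext hψa] at h2
  rw [hQ a z' hz', Polynomial.eval_map, ← hs', ← h2, MvPolynomial.aeval_def]
  congr 1
  exact RingHom.ext_int _ _

include h in
theorem gal_sq (hNp : (N : ZMod p) ≠ 0) (L : IntermediateField ℚ ℂ) (φ : L →+* ℂ) (ζ s0 : L) (ξ : OnePoint (ZMod p) → L) (z : ℂ) (hz : 0 < z.im)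
    (hζ : (ζ : ℂ) = zt p) (hs : (s0 : ℂ) = hm N m z) (hξ : ∀ i, (ξ i : ℂ) = sk N m p i z)
    (a : (ZMod p)ˣ) (ha : φ ζ = zt p ^ (a : ZMod p).val) (hsq : IsSquare (a : ZMod p)) (hs' : φ s0 = s0) :
    ∃ σ ∈ (act p).range, ∀ i, φ (ξ i) = ξ (σ i) := by
  obtain ⟨σ, hσ, e⟩ := separation _ _ (gal_f h hNp L φ ζ s0 ξ z hz hζ hs hξ a ha z hz (hs'.trans hs))
  refine ⟨MulAction.toPerm (dg a) * σ, Subgroup.mul_mem _ (act_of_sq _ (by rw [dg_det]; exact hsq)) hσ, fun i => ?_⟩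
  rw [e, ← dg_smul, hξ]; rfl

include h in
theorem gal_nsq (hN : ¬ IsSquare (N : ZMod p)) (L : IntermediateField ℚ ℂ) (φ : L →+* ℂ) (ζ s0 : L) (ξ : OnePoint (ZMod p) → L) (z : ℂ) (hz : 0 < z.im)
    (hζ : (ζ : ℂ) = zt p) (hs : (s0 : ℂ) = hm N m z) (hξ : ∀ i, (ξ i : ℂ) = sk N m p i z)
    (a : (ZMod p)ˣ) (ha : φ ζ = zt p ^ (a : ZMod p).val) (hsq : ¬ IsSquare (a : ZMod p))
    (hs' : φ s0 = 1 / (((N : ℂ) ^ m) ^ 2 * s0)) :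
    ∃ σ ∈ (act p).range, ∀ i, φ (ξ i) = 1 / (((N : ℂ) ^ m) ^ 2 * ξ (σ i)) := by
  have hNp : (N : ZMod p) ≠ 0 := by intro e; rw [e] at hN; exact hN ⟨0, by simp⟩
  obtain ⟨σ, hσ, e⟩ := separation _ _ (gal_f h hNp L φ ζ s0 ξ z hz hζ hs hξ a ha (-1 / ((N : ℂ) * z)) (im_w h.pos hz) (by rw [hs', hm_w h hz, hs]))
  refine ⟨MulAction.toPerm (wg N hNp * dg a) * σ, Subgroup.mul_mem _ (act_of_sq _ ?_) hσ, fun i => ?_⟩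
  · rw [Units.val_mul, Matrix.det_mul, dg_det, wg_det]
    have h1 : quadraticChar (ZMod p) (N * a) = 1 := by
      rw [map_mul, quadraticChar_neg_one_iff_not_isSquare.2 hN, quadraticChar_neg_one_iff_not_isSquare.2 hsq]; norm_num
    exact (quadraticChar_one_iff_isSquare (mul_ne_zero hNp a.ne_zero)).1 h1
  · rw [e, sk_w h (wg N hNp) rfl rfl rfl rfl hNp _ hz, ← dg_smul, hξ, ← mul_smul]; rfl

end
end Shih

set_option maxHeartbeats 400000
set_option linter.all false
namespace Shih
open Polynomial

/-- specialization of the first variable -/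
noncomputable def sp {F : Type*} [Field F] (s : F) : ℤ[X] →+* F := Polynomial.eval₂RingHom (Int.castRingHom F) s

theorem sp_X {F : Type*} [Field F] (s : F) : sp s X = s := by simp [sp]

theorem sp_hom {F E : Type*} [Field F] [Field E] (φ : F →+* E) (s : F) (r : ℤ[X]) : φ (sp s r) = sp (φ s) r := by
  simp only [sp, coe_eval₂RingHom]
  rw [hom_eval₂]; congr 1; exact RingHom.ext_int _ _

/-- numerical properties of the modular equation -/
structure PsiOK (p : ℕ) (Ψ : ℤ[X][X]) : Prop where
  monic : Ψ.Monic
  deg : Ψ.natDegree = p + 1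
  dvd : ∀ j ≤ p, X ∣ Ψ.coeff j
  one : ∃ r, Ψ.coeff 1 = -X + X ^ 2 * r
  zero : Ψ.coeff 0 = X ^ (p + 1)

section
variable {p : ℕ} [hp : Fact p.Prime] {F : Type*} [Field F] {Γ : Type*} [LinearOrderedCommGroupWithZero Γ] (v : Valuation F Γ)

theorem PsiOK.eval {Ψ : ℤ[X][X]} (hΨ : PsiOK p Ψ) (s x : F) :
    (Ψ.map (sp s)).eval x = x ^ (p + 1) + ∑ j ∈ Finset.range (p + 1), sp s (Ψ.coeff j) * x ^ j := by
  rw [eval_map, eval₂_eq_sum_range, hΨ.deg, Finset.sum_range_succ, add_comm]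
  congr 1
  have : Ψ.coeff (p + 1) = 1 := by rw [← hΨ.deg]; exact hΨ.monic
  rw [this, map_one, one_mul]

theorem v_int (n : ℤ) : v (n : F) ≤ 1 := by
  have h := v.map_add
  have : (n : F) ∈ v.integer := intCast_mem _ n
  exact this

theorem v_sp (r : ℤ[X]) {s : F} (hs : v s ≤ 1) : v (sp s r) ≤ 1 := by
  have : sp s r ∈ v.integer := by
    simp only [sp, coe_eval₂RingHom, eval₂_eq_sum_range]
    exact Subring.sum_mem _ fun i _ => Subring.mul_mem _ (intCast_mem _ _) (Subring.pow_mem _ hs _)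
  exact this

theorem V1 {Ψ : ℤ[X][X]} (hΨ : PsiOK p Ψ) {s x : F} (hs : v s < 1) (hs0 : s ≠ 0) (hx0 : x ≠ 0)
    (h : (Ψ.map (sp s)).eval x = 0) : v x ^ p = v s ∨ v x = v s ^ p := by
  rw [hΨ.eval] at h
  have hp2 := hp.out.two_le
  have hvs : v s ≠ 0 := (Valuation.ne_zero_iff v).2 hs0
  have hvx : v x ≠ 0 := (Valuation.ne_zero_iff v).2 hx0
  have hvs' : 0 < v s := zero_lt_iff.2 hvs
  have hvx' : 0 < v x := zero_lt_iff.2 hvx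
  have hc : ∀ j ≤ p, v (sp s (Ψ.coeff j)) ≤ v s := by
    intro j hj
    obtain ⟨r, hr⟩ := hΨ.dvd j hj
    rw [hr, map_mul, sp_X, map_mul]
    exact mul_le_of_le_one_right' (v_sp v r hs.le)
  have hx1 : v x < 1 := by
    by_contra! hx1
    have h1 : v (∑ j ∈ Finset.range (p + 1), sp s (Ψ.coeff j) * x ^ j) < v x ^ (p + 1) := by
      refine v.map_sum_lt (pow_ne_zero _ hvx) fun j hj => ?_
      have hj : j ≤ p := by simpa [Nat.lt_succ_iff] using hj
      rw [map_mul, map_pow]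
      calc v (sp s (Ψ.coeff j)) * v x ^ j ≤ v s * v x ^ p := mul_le_mul' (hc j hj) (pow_le_pow_right₀ hx1 hj)
        _ < 1 * v x ^ p := by exact mul_lt_mul_of_pos_right hs (pow_pos hvx' _)
        _ ≤ v x ^ (p + 1) := by rw [one_mul]; exact pow_le_pow_right₀ hx1 (Nat.le_succ _)
    rw [← v.map_neg, ← eq_neg_of_add_eq_zero_left h, map_pow] at h1
    exact lt_irrefl _ h1
  obtain ⟨r, hr⟩ := hΨ.one
  have hc1 : v (sp s (Ψ.coeff 1)) = v s := by
    have e : sp s (Ψ.coeff 1) = s * (-1 + s * sp s r) := by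
      rw [hr, map_add, map_neg, map_mul, map_pow, sp_X]; ring
    have e2 : v (-1 + s * sp s r) = 1 := by
      rw [v.map_add_eq_of_lt_left, v.map_neg, map_one]
      rw [v.map_neg, map_one, map_mul]
      exact mul_lt_one_of_lt_of_le hs (v_sp v r hs.le)
    rw [e, map_mul, e2, mul_one]
  have hc0 : sp s (Ψ.coeff 0) = s ^ (p + 1) := by rw [hΨ.zero, map_pow, sp_X]
  rw [Finset.sum_range_succ', show p = (p - 1) + 1 by omega, Finset.sum_range_succ', show (p - 1) + 1 = p by omega] at h
  simp only [zero_add, pow_one, pow_zero, mul_one] at h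
  rw [hc0] at h
  set R := ∑ k ∈ Finset.range (p - 1), sp s (Ψ.coeff (k + 1 + 1)) * x ^ (k + 1 + 1)
  set B := sp s (Ψ.coeff 1) * x
  have hB : v B = v s * v x := by rw [map_mul, hc1]
  have hR : v R < v B := by
    rw [hB]
    refine v.map_sum_lt (mul_ne_zero hvs hvx) fun j hj => ?_
    have hj : j < p - 1 := by simpa using hj
    rw [map_mul, map_pow]
    calc v (sp s (Ψ.coeff (j + 1 + 1))) * v x ^ (j + 1 + 1) ≤ v s * v x ^ (j + 1 + 1) := mul_le_mul' (hc _ (by omega)) le_rfl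
      _ < v s * v x := by
        refine mul_lt_mul_of_pos_left ?_ hvs'
        conv_rhs => rw [← pow_one (v x)]
        exact pow_lt_pow_right_of_lt_one₀ hvx' hx1 (by omega)
  have hBR : v (R + B) = v s * v x := by rw [v.map_add_eq_of_lt_right hR, hB]
  by_contra! hcon
  obtain ⟨n1, n2⟩ := hcon
  have m1 : v (x ^ (p + 1)) ≠ v (R + B) := by
    rw [hBR, map_pow, pow_succ]
    intro e; exact n1 (mul_right_cancel₀ hvx e)
  have m2 : v (s ^ (p + 1)) ≠ v (R + B) := by
    rw [hBR, map_pow, pow_succ']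
    intro e; exact n2 (mul_left_cancel₀ hvs e).symm
  have e1 : R + B = -(x ^ (p + 1) + s ^ (p + 1)) := by linear_combination h
  have m3 : v (x ^ (p + 1)) = v (s ^ (p + 1)) := by
    by_contra hne
    rw [e1, v.map_neg] at m1 m2
    rw [Valuation.map_add_of_distinct_val v hne] at m1 m2
    rcases max_choice (v (x ^ (p + 1))) (v (s ^ (p + 1))) with e | e
    · exact m1 e.symm
    · exact m2 e.symm
  rw [map_pow, map_pow] at m3
  have m4 : v x = v s := (pow_left_inj₀ zero_le' zero_le' (Nat.succ_ne_zero p)).1 m3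
  have m5 : v (R + B) ≤ v (s ^ (p + 1)) := by
    rw [e1, v.map_neg]
    refine (v.map_add _ _).trans ?_
    rw [map_pow, map_pow, m4, max_self]
  rw [hBR, m4, map_pow] at m5
  have : v s ^ (p + 1) < v s * v s := by
    rw [← sq]; exact pow_lt_pow_right_of_lt_one₀ hvs' hs (by omega)
  exact absurd m5 this.not_ge

/-- degree bound in the first variable -/
noncomputable def bdeg (Ψ : ℤ[X][X]) : ℕ := ∑ j ∈ Finset.range (Ψ.natDegree + 1), (Ψ.coeff j).natDegree

theorem bdeg_le (Ψ : ℤ[X][X]) {j : ℕ} (hj : j ≤ Ψ.natDegree) : (Ψ.coeff j).natDegree ≤ bdeg Ψ :=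
  Finset.single_le_sum (f := fun j => (Ψ.coeff j).natDegree) (fun _ _ => Nat.zero_le _) (Finset.mem_range.2 (by omega))

theorem V2 {Ψ : ℤ[X][X]} (hΨ : PsiOK p Ψ) {s x : F} (D : ℤ) (hD0 : (D : F) ≠ 0) (hs : v (D * s) ≤ 1)
    (h : (Ψ.map (sp s)).eval x = 0) : v ((D : F) ^ bdeg Ψ * x) ≤ 1 := by
  rw [hΨ.eval] at h
  set n := bdeg Ψ
  have hDn : (D : F) ^ n ≠ 0 := pow_ne_zero _ hD0
  have hvD : v ((D : F) ^ n) ≠ 0 := (Valuation.ne_zero_iff v).2 hDn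
  have hvD1 : v ((D : F) ^ n) ≤ 1 := by rw [map_pow]; exact pow_le_one' (v_int v D) n
  have hc : ∀ j ≤ p, v ((D : F) ^ n * sp s (Ψ.coeff j)) ≤ 1 := by
    intro j hj
    have hjn : (Ψ.coeff j).natDegree ≤ n := bdeg_le Ψ (by rw [hΨ.deg]; omega)
    change _ ∈ v.integer
    simp only [sp, coe_eval₂RingHom, eval₂_eq_sum_range, Finset.mul_sum]
    refine Subring.sum_mem _ fun i hi => ?_
    have hi : i ≤ n := by have := Finset.mem_range.1 hi; omega
    have e : (D : F) ^ n * ((Int.castRingHom F) ((Ψ.coeff j).coeff i) * s ^ i) =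
        (((Ψ.coeff j).coeff i : ℤ) : F) * (D : F) ^ (n - i) * (D * s) ^ i := by
      rw [show (D : F) ^ n = D ^ (n - i) * D ^ i by rw [← pow_add]; congr 1; omega, mul_pow]
      simp; ring
    rw [e]
    exact Subring.mul_mem _ (Subring.mul_mem _ (intCast_mem _ _) (Subring.pow_mem _ (intCast_mem _ _) _)) (Subring.pow_mem _ hs _)
  by_contra! hx
  have hx1 : 1 ≤ v x := by
    rw [map_mul] at hx
    by_contra! hx1
    exact absurd (mul_le_one' hvD1 hx1.le) hx.not_ge
  have hvx' : 0 < v x := lt_of_lt_of_le zero_lt_one hx1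
  have h1 : v (∑ j ∈ Finset.range (p + 1), (D : F) ^ n * (sp s (Ψ.coeff j) * x ^ j)) < v ((D : F) ^ n * x ^ (p + 1)) := by
    refine v.map_sum_lt ?_ fun j hj => ?_
    · rw [map_mul, map_pow v x]; exact mul_ne_zero hvD (pow_ne_zero _ hvx'.ne')
    have hj : j ≤ p := by simpa [Nat.lt_succ_iff] using hj
    rw [← mul_assoc, map_mul, map_pow]
    calc v ((D : F) ^ n * sp s (Ψ.coeff j)) * v x ^ j ≤ 1 * v x ^ p := mul_le_mul' (hc j hj) (pow_le_pow_right₀ hx1 hj)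
      _ < v ((D : F) ^ n * x) * v x ^ p := by exact mul_lt_mul_of_pos_right hx (pow_pos hvx' _)
      _ = _ := by rw [map_mul, map_mul, map_pow v x (p + 1), pow_succ' _ p, mul_assoc]
  rw [← Finset.mul_sum, ← v.map_neg, ← mul_neg, ← eq_neg_of_add_eq_zero_left h] at h1
  exact lt_irrefl _ h1
end
end Shih

set_option maxHeartbeats 400000
set_option linter.all false
namespace Shih
open IsDedekindDomain NumberField

theorem V3 {F : Type*} [Field F] [NumberField F] [IsGalois ℚ F] (w : HeightOneSpectrum (𝓞 F)) {l : ℕ} (hl : l.Prime)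
    (hlw : w.valuation F (l : F) < 1) {p : ℕ} {x : F} (hx : w.valuation F x ^ p = w.valuation F (l : F)) :
    p ∣ Module.finrank ℚ F := by
  have hlZ : Prime (l : ℤ) := Nat.prime_iff_prime_int.1 hl
  let v : HeightOneSpectrum ℤ := ⟨Ideal.span {(l : ℤ)}, (Ideal.span_singleton_prime hlZ.ne_zero).2 hlZ, by
    simpa using hl.ne_zero⟩
  have hmem : ((l : ℕ) : 𝓞 F) ∈ w.asIdeal := by
    rw [← w.valuation_lt_one_iff_mem (K := F)]; simpa using hlw
  have hlies : w.asIdeal.LiesOver v.asIdeal := by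
    constructor
    have hmax : v.asIdeal.IsMaximal := v.isMaximal
    refine hmax.eq_of_le (Ideal.IsPrime.ne_top inferInstance) ?_
    change Ideal.span {(l : ℤ)} ≤ _
    rw [Ideal.span_singleton_le_iff_mem]
    simpa [Ideal.under, Ideal.mem_comap] using hmem
  have h1 := HeightOneSpectrum.intValuation_liesOver v w (l : ℤ)
  rw [v.intValuation_singleton (r := (l:ℤ)) hlZ.ne_zero rfl] at h1
  have h2 : w.intValuation (algebraMap ℤ (𝓞 F) l) = w.valuation F (l : F) := by
    rw [← w.valuation_of_algebraMap (K := F)]; simp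
  rw [h2, ← hx, Ideal.ramificationIdx'_eq_ramificationIdx v.asIdeal w.asIdeal v.ne_bot] at h1
  have hvp : v.asIdeal.IsPrime := v.isPrime
  have hvm : v.asIdeal.IsMaximal := v.isMaximal
  have hwp : w.asIdeal.IsPrime := w.isPrime
  have h3 := Ideal.ncard_primesOver_mul_ramificationIdxIn_mul_inertiaDegIn v.asIdeal (𝓞 F) (F ≃ₐ[ℚ] F)
  rw [IsGalois.card_aut_eq_finrank, Ideal.ramificationIdxIn_eq_ramificationIdx v.asIdeal w.asIdeal (F ≃ₐ[ℚ] F)] at h3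
  have hx0 : w.valuation F x ≠ 0 := by
    intro h0
    rw [h0] at h1
    rcases Nat.eq_zero_or_pos p with rfl | hp
    · rw [h0, pow_zero] at hx; exact hlw.ne hx.symm
    · rw [zero_pow hp.ne'] at h1
      exact pow_ne_zero _ (by simp) h1
  have h4 : (p : ℤ) ∣ (w.asIdeal.ramificationIdx ℤ : ℤ) := by
    have := congrArg WithZero.log h1
    rw [WithZero.log_pow, WithZero.log_pow, WithZero.log_exp] at this
    refine ⟨-(WithZero.log (w.valuation F x)), ?_⟩
    simp at this
    linarith
  rw [← h3]
  exact (Int.natCast_dvd_natCast.1 h4).mul_right _ |>.mul_left _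
end Shih

set_option maxHeartbeats 400000
set_option linter.all false
namespace Shih
variable (p : ℕ) [hp : Fact p.Prime]

/-- quadratic character with complex values -/
noncomputable def qc : MulChar (ZMod p) ℂ := (quadraticChar (ZMod p)).ringHomComp (Int.castRingHom ℂ)

/-- additive character -/
noncomputable def ac : AddChar (ZMod p) ℂ := AddChar.zmodChar p (zt_prim (p := p)).pow_eq_one

theorem ac_apply (a : ZMod p) : ac p a = zt p ^ a.val := AddChar.zmodChar_apply _ a

/-- quadratic Gauss sum -/
noncomputable def gs : ℂ := gaussSum (qc p) (ac p)

theorem qc_ne (hodd : Odd p) : qc p ≠ 1 := by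
  have h2 : ringChar (ZMod p) ≠ 2 := by
    rw [ZMod.ringChar_zmod_n]; rintro rfl; exact absurd hodd (by decide)
  have := quadraticChar_ne_one h2
  rw [qc]
  exact (MulChar.ringHomComp_ne_one_iff (RingHom.injective_int _)).2 this

theorem gs_sq (hodd : Odd p) : ∃ d : ℤ, d.natAbs = p ∧ gs p ^ 2 = d := by
  have h := gaussSum_sq (qc_ne p hodd) (MulChar.IsQuadratic.comp (quadraticChar_isQuadratic (ZMod p)) _)
    (AddChar.zmodChar_primitive_of_primitive_root p (zt_prim (p := p)))
  refine ⟨quadraticChar (ZMod p) (-1) * p, ?_, ?_⟩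
  · have : (-1 : ZMod p) ≠ 0 := by simp
    rcases quadraticChar_dichotomy this with h | h <;> simp [h]
  · rw [gs]; refine h.trans ?_
    simp [qc, ZMod.card]

theorem gs_eq : gs p = ∑ k : ZMod p, ((quadraticChar (ZMod p) k : ℤ) : ℂ) * zt p ^ k.val := by
  simp [gs, gaussSum, ac_apply, qc, MulChar.ringHomComp_apply]

theorem gs_mem (L : IntermediateField ℚ ℂ) (h : zt p ∈ L) : gs p ∈ L := by
  rw [gs_eq]
  exact sum_mem fun i _ => mul_mem (intCast_mem _ _) (pow_mem h _)

theorem gal_gs (L : IntermediateField ℚ ℂ) (φ : L →+* ℂ) (ζ g : L) (hζ : (ζ : ℂ) = zt p) (hg : (g : ℂ) = gs p) :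
    ∃ a : (ZMod p)ˣ, φ ζ = zt p ^ (a : ZMod p).val ∧ (IsSquare (a : ZMod p) → φ g = g) ∧
      (¬ IsSquare (a : ZMod p) → φ g = -g) := by
  have hp0 : NeZero p := ⟨hp.out.ne_zero⟩
  have hprim : IsPrimitiveRoot ζ p := by
    refine IsPrimitiveRoot.of_map_of_injective (f := L.subtype) ?_ Subtype.val_injective
    change IsPrimitiveRoot (ζ : ℂ) p
    rw [hζ]; exact zt_prim (p := p)
  have h2 : IsPrimitiveRoot (φ ζ) p := hprim.map_of_injective φ.injective
  obtain ⟨i, hi, hc, hi'⟩ := (zt_prim (p := p)).isPrimitiveRoot_iff.1 h2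
  refine ⟨ZMod.unitOfCoprime i hc, ?_, ?_⟩
  · rw [ZMod.coe_unitOfCoprime, ZMod.val_natCast, Nat.mod_eq_of_lt hi, hi']
  set a := ZMod.unitOfCoprime i hc
  have ha : φ ζ = ac p a := by
    rw [ac_apply, ZMod.coe_unitOfCoprime, ZMod.val_natCast, Nat.mod_eq_of_lt hi, hi']
  have hgφ : φ g = gaussSum (qc p) ((ac p).mulShift a) := by
    have : g = ∑ k : ZMod p, ((quadraticChar (ZMod p) k : ℤ) : L) * ζ ^ k.val := by
      apply Subtype.val_injective
      change (g : ℂ) = _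
      rw [hg, gs_eq, ← hζ]; push_cast; rfl
    rw [this]
    simp only [map_sum, map_mul, map_intCast, map_pow, ha, gaussSum, qc, MulChar.ringHomComp_apply, AddChar.mulShift_apply]
    refine Finset.sum_congr rfl fun k _ => ?_
    congr 1
    rw [← AddChar.map_nsmul_eq_pow, nsmul_eq_mul, ZMod.natCast_val, ZMod.cast_id, mul_comm]
  have h3 := gaussSum_mulShift (qc p) (ac p) a
  rw [← hgφ, ← gs, ← hg] at h3
  have ha0 : (a : ZMod p) ≠ 0 := a.ne_zero
  constructor
  · intro hs
    have : quadraticChar (ZMod p) a = 1 := (quadraticChar_one_iff_isSquare ha0).2 hs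
    simpa [qc, this] using h3
  · intro hs
    have : quadraticChar (ZMod p) a = -1 := quadraticChar_neg_one_iff_not_isSquare.2 hs
    rw [qc, MulChar.ringHomComp_apply, this] at h3
    simp at h3
    rw [← h3]; ring
end Shih

set_option maxHeartbeats 400000
set_option linter.all false
namespace Shih

theorem d_nsq {p : ℕ} [hp : Fact p.Prime] {d : ℤ} (hd : d.natAbs = p) (q : ℚ) : q ^ 2 ≠ d := by
  intro h
  have h1 : IsSquare (d : ℚ) := ⟨q, by rw [← h, sq]⟩
  rw [Rat.isSquare_intCast_iff] at h1
  obtain ⟨m, hm⟩ := h1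
  have : p = m.natAbs * m.natAbs := by rw [← hd, hm, Int.natAbs_mul]
  have h2 := hp.out
  rw [this] at h2
  by_cases h1 : m.natAbs = 1
  · rw [h1] at h2; exact Nat.not_prime_one h2
  · exact Nat.not_prime_mul h1 h1 h2

theorem d_nsq' {p : ℕ} [hp : Fact p.Prime] {d : ℤ} (hd : d.natAbs = p) {a b : ℤ} (h : b ^ 2 = d * a ^ 2) : a = 0 ∧ b = 0 := by
  have ha : a = 0 := by
    by_contra ha
    refine d_nsq hd ((b : ℚ) / a) ?_
    have ha' : (a : ℚ) ≠ 0 := by exact_mod_cast ha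
    rw [div_pow, div_eq_iff (pow_ne_zero _ ha')]
    exact_mod_cast h
  subst ha
  refine ⟨rfl, by simpa using h⟩

theorem exists_l {p : ℕ} [hp : Fact p.Prime] {d : ℤ} (hd : d.natAbs = p) (B : ℕ) :
    ∃ l : ℕ, l.Prime ∧ B < l ∧ ∃ n : ℤ, (l : ℤ) ∣ n ^ 2 - d := by
  have hp2 := hp.out.two_le
  have hB : 2 ≤ (B + 2).factorial := Nat.le_trans (by omega) (Nat.self_le_factorial (B + 2))
  set f : ℤ := ((B + 2).factorial : ℤ) with hf
  have hf2 : 2 ≤ f := by rw [hf]; exact_mod_cast hB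
  have hf1 : 1 ≤ f := by linarith
  have hd2 : 2 ≤ |d| := by rw [Int.abs_eq_natAbs, hd]; exact_mod_cast hp2
  have hne : (d * f ^ 2 - 1).natAbs ≠ 1 := by
    intro h
    rw [Int.natAbs_eq_iff] at h
    have hff : 1 ≤ f ^ 2 := one_le_pow₀ hf1
    rcases h with h | h
    · have h1 : d * f ^ 2 = 2 := by push_cast at h; linarith
      have h3 : d = 2 := by
        have : 0 < d := by by_contra! hh; nlinarith
        rw [abs_of_pos this] at hd2
        nlinarith
      nlinarith
    · have h1 : d * f ^ 2 = 0 := by push_cast at h; linarith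
      have : d = 0 := by
        rcases mul_eq_zero.1 h1 with h | h
        · exact h
        · nlinarith
      rw [this] at hd2; norm_num at hd2
  obtain ⟨l, hl, hdv⟩ := Nat.exists_prime_and_dvd hne
  have hdv : (l : ℤ) ∣ d * f ^ 2 - 1 := Int.natCast_dvd.2 hdv
  refine ⟨l, hl, ?_, d * f, ?_⟩
  · by_contra! hle
    have h1 : (l : ℤ) ∣ f := by
      rw [hf]; exact_mod_cast (Nat.dvd_factorial hl.pos (hle.trans (by omega)))
    have h2 : (l : ℤ) ∣ 1 := by
      have := dvd_sub (Dvd.dvd.mul_left (dvd_pow h1 two_ne_zero) d) hdv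
      simpa using this
    have := Int.natCast_dvd_natCast.1 (by simpa using h2 : (l : ℤ) ∣ ((1 : ℕ) : ℤ))
    exact hl.one_lt.ne' (Nat.dvd_one.1 this)
  · have : (d * f) ^ 2 - d = d * (d * f ^ 2 - 1) := by ring
    rw [this]; exact hdv.mul_left d

/-- the data produced by the argument of Thue -/
structure TD (p : ℕ) (d : ℤ) (B l : ℕ) (a b k : ℤ) : Prop where
  prime : l.Prime
  lt : B < l
  eq : b ^ 2 - d * a ^ 2 = k * l
  k0 : k ≠ 0
  kle : k.natAbs ≤ p + 1
  la : ¬ (l : ℤ) ∣ a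
  lb : ¬ (l : ℤ) ∣ b
  a2 : a ^ 2 ≤ l
  b2 : b ^ 2 ≤ l

theorem thue {p : ℕ} [hp : Fact p.Prime] {d : ℤ} (hd : d.natAbs = p) (S : Set ℚ) (hS : S.Finite) (B : ℕ) :
    ∃ (l : ℕ) (a b k : ℤ), TD p d B l a b k ∧ ((a : ℚ) / b) ∉ S := by
  classical
  obtain ⟨l, hl, hBl, n, hn⟩ := exists_l hd (B + p + ∑ y ∈ hS.toFinset, (1 - (d : ℚ) * y ^ 2).num.natAbs)
  have hl0 : NeZero l := ⟨hl.ne_zero⟩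
  have hlZ : Prime (l : ℤ) := Nat.prime_iff_prime_int.1 hl
  set r := Nat.sqrt l
  have hr1 : l < (r + 1) * (r + 1) := Nat.lt_succ_sqrt l
  have hr2 : r * r ≤ l := Nat.sqrt_le l
  obtain ⟨u, v, huv, he⟩ := Fintype.exists_ne_map_eq_of_card_lt
    (fun u : Fin (r + 1) × Fin (r + 1) => ((u.1 : ℕ) : ZMod l) + (n : ZMod l) * ((u.2 : ℕ) : ZMod l))
    (by simpa [ZMod.card] using hr1)
  set b : ℤ := (u.1 : ℕ) - (v.1 : ℕ) with hb
  set a : ℤ := (u.2 : ℕ) - (v.2 : ℕ) with ha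
  have hab : ¬ (a = 0 ∧ b = 0) := by
    rintro ⟨h1, h2⟩
    apply huv
    ext <;> omega
  have hbr : |b| ≤ r := by rw [abs_le]; omega
  have har : |a| ≤ r := by rw [abs_le]; omega
  have hdiv : (l : ℤ) ∣ b + n * a := by
    rw [← ZMod.intCast_zmod_eq_zero_iff_dvd]
    simp only [hb, ha]
    push_cast
    linear_combination he
  obtain ⟨k, hk⟩ : (l : ℤ) ∣ b ^ 2 - d * a ^ 2 := by
    have : b ^ 2 - d * a ^ 2 = (b + n * a) * (b - n * a) + (n ^ 2 - d) * a ^ 2 := by ring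
    rw [this]; exact dvd_add (hdiv.mul_right _) (hn.mul_right _)
  have hk0 : k ≠ 0 := by
    rintro rfl
    exact hab (d_nsq' hd (by linarith))
  have hrl : r < l := by
    have := hl.two_le
    nlinarith
  have hdl : ¬ (l : ℤ) ∣ d := by
    intro h
    have := Int.natCast_dvd.1 h
    rw [hd] at this
    have := Nat.le_of_dvd hp.out.pos this
    omega
  have small : ∀ c : ℤ, |c| ≤ r → (l : ℤ) ∣ c → c = 0 := by
    intro c h1 h2
    exact Int.eq_zero_of_abs_lt_dvd h2 (by omega)
  have hla : ¬ (l : ℤ) ∣ a := by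
    intro h
    have h0 := small a har h
    have : (l : ℤ) ∣ b ^ 2 := by rw [h0] at hk; exact ⟨k, by linarith⟩
    exact hab ⟨h0, small b hbr (hlZ.dvd_of_dvd_pow this)⟩
  have hlb : ¬ (l : ℤ) ∣ b := by
    intro h
    have h0 := small b hbr h
    have : (l : ℤ) ∣ d * a ^ 2 := by rw [h0] at hk; exact ⟨-k, by linarith⟩
    rcases hlZ.dvd_or_dvd this with h | h
    · exact hdl h
    · exact hla (hlZ.dvd_of_dvd_pow h)
  have hb2 : b ^ 2 ≤ l := by
    rw [← sq_abs]
    calc |b| ^ 2 ≤ (r : ℤ) ^ 2 := pow_le_pow_left₀ (abs_nonneg _) hbr 2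
      _ ≤ l := by rw [sq]; exact_mod_cast hr2
  have ha2 : a ^ 2 ≤ l := by
    rw [← sq_abs]
    calc |a| ^ 2 ≤ (r : ℤ) ^ 2 := pow_le_pow_left₀ (abs_nonneg _) har 2
      _ ≤ l := by rw [sq]; exact_mod_cast hr2
  refine ⟨l, a, b, k, ⟨hl, by omega, by rw [hk]; ring, hk0, ?_, hla, hlb, ha2, hb2⟩, ?_⟩
  · have h1 : |b ^ 2 - d * a ^ 2| ≤ l * (p + 1) := by
      have e1 : |b ^ 2| ≤ l := by
        rw [abs_pow]
        calc |b| ^ 2 ≤ (r : ℤ) ^ 2 := pow_le_pow_left₀ (abs_nonneg _) hbr 2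
          _ ≤ l := by rw [sq]; exact_mod_cast hr2
      have e2 : |d * a ^ 2| ≤ p * l := by
        rw [abs_mul, abs_pow, Int.abs_eq_natAbs d, hd]
        refine mul_le_mul_of_nonneg_left ?_ (by positivity)
        calc |a| ^ 2 ≤ (r : ℤ) ^ 2 := pow_le_pow_left₀ (abs_nonneg _) har 2
          _ ≤ l := by rw [sq]; exact_mod_cast hr2
      calc |b ^ 2 - d * a ^ 2| ≤ |b ^ 2| + |d * a ^ 2| := abs_sub _ _
        _ ≤ _ := by linarith
    rw [hk, abs_mul, Nat.abs_cast] at h1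
    have h2 : |k| ≤ p + 1 := le_of_mul_le_mul_left h1 (by exact_mod_cast hl.pos)
    rw [Int.abs_eq_natAbs] at h2
    exact_mod_cast h2
  · intro hmem
    set y : ℚ := (a : ℚ) / b with hy
    have hb0 : (b : ℚ) ≠ 0 := by
      intro h; apply hlb; have : b = 0 := by exact_mod_cast h
      rw [this]; exact dvd_zero _
    set q : ℚ := 1 - d * y ^ 2 with hq
    have hqne : q ≠ 0 := by
      intro h0
      have : (1 / y) ^ 2 = d := by
        have hy0 : y ≠ 0 := by rintro h; rw [hq, h] at h0; norm_num at h0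
        field_simp; linarith
      exact d_nsq hd _ this
    have e1 : (q.num : ℚ) * b ^ 2 = k * l * q.den := by
      have h1 : q * b ^ 2 = k * l := by
        rw [hq, hy]; field_simp
        have : ((b ^ 2 - d * a ^ 2 : ℤ) : ℚ) = ((l * k : ℤ) : ℚ) := by rw [hk]
        push_cast at this; linarith
      have h2 : (q.num : ℚ) = q * q.den := (Rat.mul_den_eq_num q).symm
      rw [h2]; linear_combination (q.den : ℚ) * h1
    have e2 : q.num * b ^ 2 = k * l * q.den := by exact_mod_cast e1
    have e3 : (l : ℤ) ∣ q.num * b ^ 2 := ⟨k * q.den, by rw [e2]; ring⟩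
    have e4 : (l : ℤ) ∣ q.num := by
      rcases hlZ.dvd_or_dvd e3 with h | h
      · exact h
      · exact absurd (hlZ.dvd_of_dvd_pow h) hlb
    have e5 : l ≤ q.num.natAbs := Nat.le_of_dvd (Int.natAbs_pos.2 (Rat.num_ne_zero.2 hqne)) (Int.natCast_dvd.1 e4)
    have e6 : q.num.natAbs ≤ ∑ y ∈ hS.toFinset, (1 - (d : ℚ) * y ^ 2).num.natAbs :=
      Finset.single_le_sum (f := fun y : ℚ => (1 - (d : ℚ) * y ^ 2).num.natAbs) (fun _ _ => Nat.zero_le _) (hS.mem_toFinset.2 hmem)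
    omega
end Shih

set_option maxHeartbeats 400000
set_option linter.all false
namespace Shih
open IsDedekindDomain NumberField Polynomial

section
variable {F : Type*} [Field F] {Γ : Type*} [LinearOrderedCommGroupWithZero Γ] (v : Valuation F Γ)

theorem v_unit {l : ℕ} (hl : l.Prime) (hv : v (l : F) < 1) {n : ℤ} (hn : ¬ (l : ℤ) ∣ n) : v (n : F) = 1 := by
  have hlZ : Prime (l : ℤ) := Nat.prime_iff_prime_int.1 hl
  have hc : IsCoprime (l : ℤ) n := (Prime.coprime_iff_not_dvd hlZ).2 hn
  obtain ⟨u, w, h⟩ := hc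
  refine le_antisymm (v_int v n) ?_
  by_contra! hlt
  have h1 : v (((u * l + w * n : ℤ)) : F) < 1 := by
    push_cast
    refine v.map_add_lt ?_ ?_
    · rw [map_mul, mul_comm]; exact mul_lt_one_of_lt_of_le hv (v_int v u)
    · rw [map_mul, mul_comm]; exact mul_lt_one_of_lt_of_le hlt (v_int v w)
  rw [h] at h1; simp at h1

theorem v_g {g : F} {d : ℤ} (hg : g ^ 2 = d) : v g ≤ 1 := by
  by_contra! h
  have h1 : 1 < v g ^ 2 := one_lt_pow₀ h two_ne_zero
  rw [← map_pow, hg] at h1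
  exact absurd (v_int v d) h1.not_ge

theorem v_bag {g : F} {d : ℤ} (hg : g ^ 2 = d) (a b : ℤ) : v (b + a * g) ≤ 1 := by
  refine v.map_add_le (v_int v b) ?_
  rw [map_mul]; exact mul_le_one' (v_int v a) (v_g v hg)

theorem place {p B l : ℕ} {d a b k : ℤ} (t : TD p d B l a b k) (hB2 : 2 ≤ B) (hBp : p + 1 ≤ B) {g : F} (hg : g ^ 2 = d)
    (hv : v (l : F) < 1) :
    (v (b + a * g) = v (l : F) ∧ v (b - a * g) = 1) ∨ (v (b - a * g) = v (l : F) ∧ v (b + a * g) = 1) := by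
  have hB := t.lt
  have hk : v (k : F) = 1 := v_unit v t.prime hv (by
    intro h
    have := Nat.le_of_dvd (Int.natAbs_pos.2 t.k0) (Int.natCast_dvd.1 h)
    have := t.kle
    omega)
  have h2b : v ((2 * b : ℤ) : F) = 1 := v_unit v t.prime hv (by
    intro h
    rcases (Nat.prime_iff_prime_int.1 t.prime).dvd_or_dvd h with h | h
    · have := Int.le_of_dvd (by norm_num) h
      omega
    · exact t.lb h)
  have hm : v (b + a * g) * v (b - a * g) = v (l : F) := by
    have e : ((b : F) + a * g) * (b - a * g) = k * l := by
      have : ((b ^ 2 - d * a ^ 2 : ℤ) : F) = ((k * l : ℤ) : F) := by rw [t.eq]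
      push_cast at this
      rw [← this, ← hg]; ring
    rw [← map_mul, e, map_mul, hk, one_mul]
  have h1 := v_bag v hg a b
  have h2 : v (b - a * g) ≤ 1 := by
    have := v_bag v hg (-a) b
    push_cast at this
    rwa [neg_mul, ← sub_eq_add_neg] at this
  have hs : v (b + a * g) = 1 ∨ v (b - a * g) = 1 := by
    by_contra! hh
    have l1 := lt_of_le_of_ne h1 hh.1
    have l2 := lt_of_le_of_ne h2 hh.2
    have := v.map_add_lt l1 l2
    rw [show (b : F) + a * g + (b - a * g) = ((2 * b : ℤ) : F) by push_cast; ring, h2b] at this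
    exact lt_irrefl _ this
  rcases hs with h | h
  · right; rw [h, one_mul] at hm; exact ⟨hm, h⟩
  · left; rw [h, mul_one] at hm; exact ⟨hm, h⟩

theorem bag_ne [CharZero F] {p B l : ℕ} {d a b k : ℤ} (t : TD p d B l a b k) {g : F} (hg : g ^ 2 = d) :
    (b : F) + a * g ≠ 0 ∧ (b : F) - a * g ≠ 0 ∧ ((b : F) + a * g) * (b - a * g) = k * l := by
  have e : ((b : F) + a * g) * (b - a * g) = k * l := by
    have : ((b ^ 2 - d * a ^ 2 : ℤ) : F) = ((k * l : ℤ) : F) := by rw [t.eq]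
    push_cast at this
    rw [← this, ← hg]; ring
  have hne : (k : F) * l ≠ 0 := mul_ne_zero (by exact_mod_cast t.k0) (by exact_mod_cast t.prime.ne_zero)
  refine ⟨fun h => hne ?_, fun h => hne ?_, e⟩ <;> rw [← e, h] <;> ring
end

theorem div_of_place {p : ℕ} [hp : Fact p.Prime] (hodd : Odd p) {F : Type*} [Field F] [NumberField F] [IsGalois ℚ F] {Ψ : ℤ[X][X]} (hΨ : PsiOK p Ψ)
    {ι : Type*} [Fintype ι] (hι : Fintype.card ι = p + 1) {s : F} {ξ : ι → F}
    (h : Ψ.map (sp s) = ∏ i, (X - C (ξ i))) (hs0 : s ≠ 0) (w : HeightOneSpectrum (𝓞 F)) {l : ℕ} (hl : l.Prime)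
    (hlw : w.valuation F (l : F) < 1) (hs : w.valuation F s = w.valuation F (l : F)) : p ∣ Module.finrank ℚ F := by
  have hprod : ∏ i, ξ i = s ^ (p + 1) := by
    have := congrArg (eval 0) h
    rw [hΨ.eval, Finset.sum_range_succ', eval_prod] at this
    simp only [hΨ.zero, map_pow, sp_X, eval_sub, eval_X, eval_C, zero_sub, Finset.prod_neg, Finset.card_univ, hι,
      (hodd.add_one).neg_one_pow, one_mul] at this
    rw [← this]; simp
  have hx0 : ∀ i, ξ i ≠ 0 := by
    intro i h0
    have : ∏ i, ξ i = 0 := Finset.prod_eq_zero (Finset.mem_univ i) h0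
    rw [hprod] at this
    exact pow_ne_zero _ hs0 this
  have hlt : w.valuation F s < 1 := by rw [hs]; exact hlw
  have hr : ∀ i, (Ψ.map (sp s)).eval (ξ i) = 0 := by
    intro i
    rw [h, eval_prod]; exact Finset.prod_eq_zero (Finset.mem_univ i) (by simp)
  by_cases hex : ∃ i, w.valuation F (ξ i) ^ p = w.valuation F s
  · obtain ⟨i, hi⟩ := hex
    exact V3 w hl hlw (hi.trans hs)
  · push Not at hex
    exfalso
    have h2 : ∀ i, w.valuation F (ξ i) = w.valuation F s ^ p := fun i =>
      (V1 (w.valuation F) hΨ hlt hs0 (hx0 i) (hr i)).resolve_left (hex i)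
    have h3 := congrArg (w.valuation F) hprod
    rw [map_prod, Finset.prod_congr rfl (fun i _ => h2 i), Finset.prod_const, Finset.card_univ, hι, map_pow, ← pow_mul] at h3
    have h4 : 0 < w.valuation F s := zero_lt_iff.2 ((Valuation.ne_zero_iff _).2 hs0)
    have h5 := pow_lt_pow_right_of_lt_one₀ h4 hlt (show p + 1 < p * (p + 1) by nlinarith [hp.out.two_le])
    exact h5.ne h3
end Shih

set_option maxHeartbeats 400000
set_option linter.all false
namespace Shih
open IsDedekindDomain NumberField Polynomial

theorem map_hom {F E : Type*} [Field F] [Field E] (φ : F →+* E) (s : F) (Ψ : ℤ[X][X]) :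
    (Ψ.map (sp s)).map φ = Ψ.map (sp (φ s)) := by
  rw [Polynomial.map_map]
  congr 1
  refine RingHom.ext fun r => sp_hom φ _ _

theorem ev_hom {F E : Type*} [Field F] [Field E] (φ : F →+* E) {s x : F} {Ψ : ℤ[X][X]}
    (h : (Ψ.map (sp s)).eval x = 0) : (Ψ.map (sp (φ s))).eval (φ x) = 0 := by
  rw [← map_hom, eval_map_apply, h, map_zero]

/-- a common denominator -/
noncomputable def D2 (p K : ℕ) (Ψ : ℤ[X][X]) : ℤ := (((p + 1).factorial * K : ℕ) : ℤ) ^ bdeg Ψ * K * ((p + 1).factorial : ℤ) ^ p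

theorem fp_int {p : ℕ} [hp : Fact p.Prime] {E : Type*} [Field E] [NumberField E] [IsGalois ℚ E]
    (hfr : ¬ p ∣ Module.finrank ℚ E) {Ψ : ℤ[X][X]} (hΨ : PsiOK p Ψ) {B l K : ℕ} {d a b k : ℤ} (t : TD p d B l a b k)
    (hB2 : 2 ≤ B) (hBp : p + 1 ≤ B) (hK : ¬ (l : ℤ) ∣ (K : ℤ)) {g : E} (hg : g ^ 2 = d) {T x : E}
    (hT : T = (b + a * g) / (b - a * g)) (hx0 : x ≠ 0) (h1 : (Ψ.map (sp (T / K))).eval (x / K) = 0)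
    (h2 : (Ψ.map (sp (T⁻¹ / K))).eval (x⁻¹ / K) = 0) (w : HeightOneSpectrum (𝓞 E)) :
    w.valuation E (D2 p K Ψ * (x / T ^ p)) ≤ 1 := by
  obtain ⟨n1, n2, e⟩ := bag_ne t hg
  have hK0 : (K : E) ≠ 0 := by
    intro h; apply hK
    have : K = 0 := by exact_mod_cast h
    rw [this]; exact dvd_zero _
  have hk0 : (k : E) ≠ 0 := by exact_mod_cast t.k0
  have hl0 : (l : E) ≠ 0 := by exact_mod_cast t.prime.ne_zero
  have hT0 : T ≠ 0 := by rw [hT]; exact div_ne_zero n1 n2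
  set v := w.valuation E with hv
  by_cases hlt : v (l : E) < 1
  · have hvK : v (K : E) = 1 := by
      have := v_unit v t.prime hlt hK
      simpa using this
    have key : ∀ T' x' : E, T' ≠ 0 → x' ≠ 0 → v T' = v (l : E) → (Ψ.map (sp (T' / K))).eval (x' / K) = 0 → v x' = v T' ^ p := by
      intro T' x' hT' hx' hvT h
      have := V1 v hΨ (s := T' / K) (x := x' / K) (by rw [map_div₀, hvK, div_one, hvT]; exact hlt)
        (div_ne_zero hT' hK0) (div_ne_zero hx' hK0) h
      simp only [map_div₀, hvK, div_one] at this
      refine this.resolve_left fun h3 => hfr (V3 w t.prime hlt (h3.trans hvT))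
    have hβ : v x = v T ^ p := by
      rcases place v t hB2 hBp hg hlt with ⟨q1, q2⟩ | ⟨q1, q2⟩
      · exact key T x hT0 hx0 (by rw [hT, map_div₀, q1, q2, div_one]) h1
      · have := key T⁻¹ x⁻¹ (inv_ne_zero hT0) (inv_ne_zero hx0) (by rw [hT, inv_div, map_div₀, q1, q2, div_one]) h2
        rw [map_inv₀, map_inv₀, inv_pow, inv_inj] at this
        exact this
    rw [map_mul, map_div₀, map_pow, hβ, div_self (pow_ne_zero _ ((Valuation.ne_zero_iff v).2 hT0)), mul_one]
    exact v_int v _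
  · have hvl : v (l : E) = 1 := le_antisymm (by simpa using v_int v (l : ℤ)) (not_lt.1 hlt)
    obtain ⟨c, hc⟩ : (k : ℤ) ∣ ((p + 1).factorial : ℤ) :=
      Int.dvd_natCast.2 (Nat.dvd_factorial (Int.natAbs_pos.2 t.k0) t.kle)
    have hc' : (((p + 1).factorial : ℕ) : E) = k * c := by
      have : (((p + 1).factorial : ℤ) : E) = ((k * c : ℤ) : E) := by rw [hc]
      push_cast at this; exact this
    have b1 := v_bag v hg a b
    have b2 : v (b - a * g) ≤ 1 := by
      have := v_bag v hg (-a) b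
      push_cast at this
      rwa [neg_mul, ← sub_eq_add_neg] at this
    have aux : ∀ u u' : E, u ≠ 0 → u' ≠ 0 → u * u' = k * l → v u ≤ 1 → v (((p + 1).factorial : ℕ) * (u / u')) ≤ 1 := by
      intro u u' hu hu' huu hvu
      have : (((p + 1).factorial : ℕ) : E) * (u / u') = c * u ^ 2 / l := by
        rw [hc']; field_simp; linear_combination (-c : E) * huu
      rw [this, map_div₀, hvl, div_one, map_mul, map_pow]
      exact mul_le_one' (v_int v c) (pow_le_one' hvu 2)
    have a1 : v (((p + 1).factorial : ℕ) * T) ≤ 1 := by rw [hT]; exact aux _ _ n1 n2 e b1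
    have a2 : v (((p + 1).factorial : ℕ) * T⁻¹) ≤ 1 := by rw [hT, inv_div]; exact aux _ _ n2 n1 (by rw [mul_comm]; exact e) b2
    have hf0 : (((p + 1).factorial : ℕ) : E) ≠ 0 := by exact_mod_cast Nat.factorial_ne_zero _
    have hV := V2 v hΨ (s := T / K) (x := x / K) (((p + 1).factorial * K : ℕ) : ℤ) (by
      push_cast; exact mul_ne_zero hf0 hK0) (by
      have : ((((p + 1).factorial * K : ℕ) : ℤ) : E) * (T / K) = ((p + 1).factorial : ℕ) * T := by
        push_cast; field_simp
      rw [this]; exact a1) h1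
    have : (D2 p K Ψ : E) * (x / T ^ p) = ((((p + 1).factorial * K : ℕ) : ℤ) : E) ^ bdeg Ψ * (x / K) * (K ^ 2 : ℕ) * (((p + 1).factorial : ℕ) * T⁻¹) ^ p := by
      rw [D2, mul_pow, inv_pow]; push_cast; field_simp
    rw [this, map_mul, map_mul, map_pow v _ p]
    exact mul_le_one' (mul_le_one' hV (by have := v_int v ((K ^ 2 : ℕ) : ℤ); rwa [Int.cast_natCast] at this)) (pow_le_one' a2 p)

/-- root bound -/
noncomputable def Cb (p : ℕ) (Ψ : ℤ[X][X]) (c : ℝ) : ℝ :=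
  1 + ∑ j ∈ Finset.range (p + 1), ∑ i ∈ Finset.range ((Ψ.coeff j).natDegree + 1), |((Ψ.coeff j).coeff i : ℝ)| * c ^ i

theorem root_bound {p : ℕ} [hp : Fact p.Prime] {Ψ : ℤ[X][X]} (hΨ : PsiOK p Ψ) {c : ℝ} (hc : 0 ≤ c) {s x : ℂ} (hs : ‖s‖ ≤ c)
    (h : (Ψ.map (sp s)).eval x = 0) : ‖x‖ ≤ Cb p Ψ c := by
  have hcj : ∀ j, ‖sp s (Ψ.coeff j)‖ ≤ ∑ i ∈ Finset.range ((Ψ.coeff j).natDegree + 1), |((Ψ.coeff j).coeff i : ℝ)| * c ^ i := by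
    intro j
    simp only [sp, coe_eval₂RingHom, eval₂_eq_sum_range]
    refine (norm_sum_le _ _).trans (Finset.sum_le_sum fun i _ => ?_)
    rw [norm_mul, norm_pow]
    refine mul_le_mul (by simp) (pow_le_pow_left₀ (norm_nonneg _) hs i) (by positivity) (by positivity)
  set Q : ℝ := ∑ j ∈ Finset.range (p + 1), ∑ i ∈ Finset.range ((Ψ.coeff j).natDegree + 1), |((Ψ.coeff j).coeff i : ℝ)| * c ^ i with hQ
  have hQ0 : 0 ≤ Q := by positivity
  change _ ≤ 1 + Q
  by_cases hx : ‖x‖ ≤ 1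
  · linarith
  push Not at hx
  rw [hΨ.eval] at h
  have h1 : ‖x‖ ^ (p + 1) ≤ Q * ‖x‖ ^ p := by
    rw [← norm_pow, eq_neg_of_add_eq_zero_left h, norm_neg, hQ, Finset.sum_mul]
    refine (norm_sum_le _ _).trans (Finset.sum_le_sum fun j hj => ?_)
    rw [norm_mul, norm_pow]
    have hj : j ≤ p := by simpa [Nat.lt_succ_iff] using hj
    refine mul_le_mul (hcj j) (pow_le_pow_right₀ hx.le hj) (by positivity) (by positivity)
  rw [pow_succ'] at h1
  have := le_of_mul_le_mul_right h1 (by positivity)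
  linarith

theorem T_bound {p B l : ℕ} {d a b k : ℤ} (hd : d.natAbs = p) (t : TD p d B l a b k) {g : ℂ} (hg : g ^ 2 = d) :
    ‖(b + a * g) / (b - a * g)‖ ≤ 2 + 2 * p := by
  obtain ⟨n1, n2, e⟩ := bag_ne t hg
  have hl0 : (0 : ℝ) < l := by exact_mod_cast t.prime.pos
  have hk1 : (1 : ℝ) ≤ |(k : ℝ)| := by exact_mod_cast Int.one_le_abs t.k0
  have hg2 : ‖g‖ ^ 2 = p := by
    rw [← norm_pow, hg, Complex.norm_intCast, ← Int.cast_abs, Int.abs_eq_natAbs, hd]; simp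
  have e2 : (b + a * g) / (b - a * g) = (b + a * g) ^ 2 / (k * l) := by
    rw [← e]; field_simp
  rw [e2, norm_div, norm_mul, norm_pow, Complex.norm_natCast, Complex.norm_intCast]
  have e3 : ‖(b : ℂ) + a * g‖ ^ 2 ≤ (2 + 2 * p) * l := by
    have : ‖(b : ℂ) + a * g‖ ≤ |(b : ℝ)| + |(a : ℝ)| * ‖g‖ := by
      refine (norm_add_le _ _).trans ?_
      rw [norm_mul, Complex.norm_intCast, Complex.norm_intCast]
    have hb2 : |(b : ℝ)| ^ 2 ≤ l := by rw [sq_abs]; exact_mod_cast t.b2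
    have ha2 : |(a : ℝ)| ^ 2 ≤ l := by rw [sq_abs]; exact_mod_cast t.a2
    calc ‖(b : ℂ) + a * g‖ ^ 2 ≤ (|(b : ℝ)| + |(a : ℝ)| * ‖g‖) ^ 2 := pow_le_pow_left₀ (norm_nonneg _) this 2
      _ ≤ 2 * |(b : ℝ)| ^ 2 + 2 * (|(a : ℝ)| ^ 2 * ‖g‖ ^ 2) := by nlinarith [sq_nonneg (|(b : ℝ)| - |(a : ℝ)| * ‖g‖)]
      _ ≤ 2 * l + 2 * (l * p) := by rw [hg2]; gcongr
      _ = _ := by ring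
  rw [div_le_iff₀ (by positivity)]
  refine e3.trans ?_
  gcongr
  nlinarith

/-- the finite set of possible ratios -/
def WW (p K : ℕ) (Ψ : ℤ[X][X]) (E : Type*) [Field E] : Set E :=
  {β : E | IsIntegral ℤ ((D2 p K Ψ : E) * β) ∧ ∀ φ : E →+* ℂ, ‖φ ((D2 p K Ψ : E) * β)‖ ≤
    |(D2 p K Ψ : ℝ)| * (K * Cb p Ψ (2 + 2 * p) * (2 + 2 * p) ^ p)}

theorem WW_fin (p K : ℕ) (hK : K ≠ 0) (Ψ : ℤ[X][X]) (E : Type*) [Field E] [NumberField E] : (WW p K Ψ E).Finite := by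
  have h := Embeddings.finite_of_norm_le E ℂ (|(D2 p K Ψ : ℝ)| * (K * Cb p Ψ (2 + 2 * p) * (2 + 2 * p) ^ p))
  refine Set.Finite.preimage (f := fun β : E => (D2 p K Ψ : E) * β) ?_ h
  refine Function.Injective.injOn (mul_right_injective₀ ?_)
  have : D2 p K Ψ ≠ 0 := by
    have := Nat.factorial_ne_zero (p + 1)
    unfold D2; positivity
  exact_mod_cast this

theorem fp_mem {p : ℕ} [hp : Fact p.Prime] {E : Type*} [Field E] [NumberField E] [IsGalois ℚ E]
    (hfr : ¬ p ∣ Module.finrank ℚ E) {Ψ : ℤ[X][X]} (hΨ : PsiOK p Ψ) {B l K : ℕ} {d a b k : ℤ} (hd : d.natAbs = p)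
    (t : TD p d B l a b k)
    (hB2 : 2 ≤ B) (hBp : p + 1 ≤ B) (hK : ¬ (l : ℤ) ∣ (K : ℤ)) {g : E} (hg : g ^ 2 = d) {T x : E}
    (hT : T = (b + a * g) / (b - a * g)) (hx0 : x ≠ 0) (h1 : (Ψ.map (sp (T / K))).eval (x / K) = 0)
    (h2 : (Ψ.map (sp (T⁻¹ / K))).eval (x⁻¹ / K) = 0) : x / T ^ p ∈ WW p K Ψ E := by
  have hK0 : K ≠ 0 := by rintro rfl; exact hK (by simp)
  have hK1 : (1 : ℝ) ≤ K := by exact_mod_cast Nat.one_le_iff_ne_zero.2 hK0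
  constructor
  · obtain ⟨y, hy⟩ := HeightOneSpectrum.mem_integers_of_valuation_le_one (R := 𝓞 E) E _
      (fun w => fp_int hfr hΨ t hB2 hBp hK hg hT hx0 h1 h2 w)
    rw [← hy]
    exact y.2
  · intro φ
    have hgφ : (φ g) ^ 2 = d := by rw [← map_pow, hg]; simp
    have hTφ : φ T = (b + a * φ g) / (b - a * φ g) := by rw [hT]; simp
    have n1 : ‖φ T‖ ≤ 2 + 2 * p := by rw [hTφ]; exact T_bound hd t hgφ
    have n2 : ‖(φ T)⁻¹‖ ≤ 2 + 2 * p := by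
      have := T_bound hd t (g := -φ g) (by rw [neg_sq, hgφ])
      rw [hTφ, inv_div]
      convert this using 3 <;> ring
    have n3 : ‖φ (x / K)‖ ≤ Cb p Ψ (2 + 2 * p) := by
      refine root_bound hΨ (by positivity) (s := φ (T / K)) ?_ ?_
      · rw [map_div₀, map_natCast, norm_div, Complex.norm_natCast]
        exact (div_le_self (norm_nonneg _) hK1).trans n1
      · exact ev_hom φ h1
    have e : φ ((D2 p K Ψ : E) * (x / T ^ p)) = (D2 p K Ψ : ℂ) * (K * φ (x / K) * (φ T)⁻¹ ^ p) := by
      have : (K : ℂ) ≠ 0 := by exact_mod_cast hK0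
      simp only [map_mul, map_intCast, map_div₀, map_pow, map_natCast, inv_pow]
      rw [div_eq_mul_inv, mul_div_cancel₀ _ this]
    rw [e, norm_mul, Complex.norm_intCast, norm_mul, norm_mul, norm_pow, Complex.norm_natCast]
    have n4 := (norm_nonneg _).trans n3
    gcongr
end Shih

set_option maxHeartbeats 400000
set_option linter.all false
namespace Shih
open NumberField Polynomial

theorem g_int {g : ℂ} {d : ℤ} (hg : g ^ 2 = d) : IsIntegral ℚ g := by
  refine ⟨X ^ 2 - C (d : ℚ), monic_X_pow_sub_C _ two_ne_zero, ?_⟩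
  rw [eval₂_sub, eval₂_pow, eval₂_X, eval₂_C, hg]; simp

theorem g_fr {p : ℕ} [hp : Fact p.Prime] {d : ℤ} (hd : d.natAbs = p) {g : ℂ} (hg : g ^ 2 = d) :
    Module.finrank ℚ (IntermediateField.adjoin ℚ {g}) = 2 := by
  rw [IntermediateField.adjoin.finrank (g_int hg)]
  have hirr : Irreducible (X ^ 2 - C (d : ℚ)) := by
    rw [X_pow_sub_C_irreducible_iff_of_prime Nat.prime_two]
    exact fun q => d_nsq hd q
  rw [← minpoly.eq_of_irreducible_of_monic hirr (by simp [hg]) (monic_X_pow_sub_C _ two_ne_zero)]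
  exact natDegree_X_pow_sub_C

theorem one_sub_ne {p : ℕ} [hp : Fact p.Prime] {d : ℤ} (hd : d.natAbs = p) {F : Type*} [Field F] [CharZero F] {g : F} (hg : g ^ 2 = d) (y : ℚ) :
    1 - g * y ≠ 0 := by
  intro h
  have hy : y ≠ 0 := by rintro rfl; simp at h
  have hy' : (y : F) ≠ 0 := by exact_mod_cast hy
  have h1 : g = ((1 / y : ℚ) : F) := by
    push_cast; field_simp; linear_combination -h
  apply d_nsq hd (1 / y)
  rw [h1] at hg
  exact_mod_cast hg

theorem one_add_ne {p : ℕ} [hp : Fact p.Prime] {d : ℤ} (hd : d.natAbs = p) {F : Type*} [Field F] [CharZero F] {g : F} (hg : g ^ 2 = d) (y : ℚ) :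
    1 + g * y ≠ 0 := by
  have := one_sub_ne hd hg (-y)
  push_cast at this
  rwa [mul_neg, sub_neg_eq_add] at this

/-- the point with Cayley coordinate `y` -/
noncomputable def TT {F : Type*} [Field F] (g y : F) : F := (1 + g * y) / (1 - g * y)

theorem TT_inj {p : ℕ} [hp : Fact p.Prime] {d : ℤ} (hd : d.natAbs = p) {g : ℂ} (hg : g ^ 2 = d) :
    Function.Injective (fun y : ℚ => TT g (y : ℂ)) := by
  intro y y' h
  have n1 := one_sub_ne hd hg y
  have n2 := one_sub_ne hd hg y'
  have g0 : g ≠ 0 := by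
    rintro rfl
    apply d_nsq hd 0
    have : (d : ℂ) = 0 := by rw [← hg]; simp
    have : d = 0 := by exact_mod_cast this
    simp [this]
  simp only [TT] at h
  rw [div_eq_div_iff n1 n2] at h
  have : g * ((y : ℂ) - y') = 0 := by linear_combination h / 2
  rcases mul_eq_zero.1 this with h | h
  · exact absurd h g0
  · exact_mod_cast sub_eq_zero.1 h

variable {N m p : ℕ} [hp : Fact p.Prime]

theorem fin_D {d : ℤ} (hd : d.natAbs = p) {g : ℂ} (hg : g ^ 2 = d) {K : ℕ} (hK : K ≠ 0) {D : ℤ[X]} (hD : D ≠ 0) :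
    {y : ℚ | sp (TT g (y : ℂ) / K) D = 0}.Finite := by
  have hf : ((D.map (Int.castRingHom ℂ)).roots.toFinset : Set ℂ).Finite := Finset.finite_toSet _
  have hKc : (K : ℂ) ≠ 0 := by exact_mod_cast hK
  refine (hf.preimage (f := fun y : ℚ => TT g (y : ℂ) / K) ?_).subset ?_
  · refine Function.Injective.injOn fun y y' h => TT_inj hd hg ?_
    simpa [hKc] using h
  · intro y hy
    have hD' : D.map (Int.castRingHom ℂ) ≠ 0 := (Polynomial.map_ne_zero_iff (RingHom.injective_int _)).2 hD
    simp only [Set.mem_preimage, SetLike.mem_coe, Multiset.mem_toFinset, mem_roots hD', IsRoot.def, eval_map]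
    exact hy

theorem fin_W (h : NM N m) (hNp : (N : ZMod p) ≠ 0) {Ψ : ℤ[X][X]}
    (hΨ2 : ∀ z, 0 < z.im → Ψ.map (evz (hm N m z)) = ∏ i, (X - C (sk N m p i z)))
    {d : ℤ} (hd : d.natAbs = p) {g : ℂ} (hg : g ^ 2 = d) {K : ℕ} (hK : K ≠ 0) (β : ℂ) :
    {y : ℚ | (Ψ.map (sp (TT g (y : ℂ) / K))).eval (β * TT g (y : ℂ) ^ p / K) = 0}.Finite := by
  have hKc : (K : ℂ) ≠ 0 := by exact_mod_cast hK
  let f : ℤ[X] →+* ℂ[X] := eval₂RingHom (Int.castRingHom ℂ[X]) (C (1 / (K : ℂ)) * X)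
  let P : ℂ[X] := Ψ.eval₂ f (C (β / K) * X ^ p)
  have hP : ∀ T : ℂ, P.eval T = (Ψ.map (sp (T / K))).eval (β * T ^ p / K) := by
    intro T
    have : P.eval T = evalRingHom T (Ψ.eval₂ f (C (β / K) * X ^ p)) := rfl
    rw [this, hom_eval₂, eval_map]
    congr 1
    · refine Polynomial.ringHom_ext' (RingHom.ext_int _ _) ?_
      simp [f, sp]; field_simp
    · simp; ring
  have hP0 : P ≠ 0 := by
    obtain ⟨z, hz, hz'⟩ := A6 (p := p) h hNp (β * K ^ p / K)
    intro h0
    have := hP (K * hm N m z)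
    rw [h0, eval_zero, mul_div_cancel_left₀ _ hKc] at this
    have e : (Ψ.map (sp (hm N m z))) = ∏ i, (X - C (sk N m p i z)) := hΨ2 z hz
    rw [e, eval_prod] at this
    obtain ⟨i, -, hi⟩ := Finset.prod_eq_zero_iff.1 this.symm
    simp only [eval_sub, eval_X, eval_C] at hi
    apply hz' i
    rw [← sub_eq_zero.1 hi, mul_pow]; ring
  have hf : (P.roots.toFinset : Set ℂ).Finite := Finset.finite_toSet _
  refine (hf.preimage (f := fun y : ℚ => TT g (y : ℂ)) (TT_inj hd hg).injOn).subset ?_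
  intro y hy
  simp only [Set.mem_preimage, SetLike.mem_coe, Multiset.mem_toFinset, mem_roots hP0, IsRoot.def, hP]
  exact hy

theorem exists_TD (hodd : Odd p) (h : NM N m) (hNp : (N : ZMod p) ≠ 0) {Ψ : ℤ[X][X]} (hΨ : PsiOK p Ψ)
    (hΨ2 : ∀ z, 0 < z.im → Ψ.map (evz (hm N m z)) = ∏ i, (X - C (sk N m p i z)))
    {d : ℤ} (hd : d.natAbs = p) {g : ℂ} (hg : g ^ 2 = d) {D : ℤ[X]} (hD : D ≠ 0) :
    ∃ (l : ℕ) (a b k : ℤ), TD p d (p + 1 + N ^ m) l a b k ∧ ¬ (l : ℤ) ∣ ((N ^ m : ℕ) : ℤ) ∧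
      sp ((b + a * g) / (b - a * g) / (N ^ m : ℕ)) D ≠ 0 ∧
      ∀ y : ℚ, (Ψ.map (sp ((b + a * g) / (b - a * g) / (N ^ m : ℕ)))).eval (TT g (y : ℂ) / (N ^ m : ℕ)) ≠ 0 := by
  set K := N ^ m with hKdef
  have hK : K ≠ 0 := pow_ne_zero _ h.pos.ne'
  have hp2 := hp.out.two_le
  let E := IntermediateField.adjoin ℚ {g}
  have hfr : Module.finrank ℚ E = 2 := g_fr hd hg
  have : Algebra.IsQuadraticExtension ℚ E := ⟨hfr⟩
  have : FiniteDimensional ℚ E := inferInstance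
  have : NumberField E := ⟨⟩
  let gE : E := ⟨g, IntermediateField.mem_adjoin_simple_self ℚ g⟩
  have hgE : gE ^ 2 = d := Subtype.val_injective (by
    change g ^ 2 = _
    rw [hg]; simp)
  have hW := WW_fin p K hK Ψ E
  have hS : ({y : ℚ | sp (TT g (y : ℂ) / K) D = 0} ∪
    ⋃ β ∈ WW p K Ψ E, {y : ℚ | (Ψ.map (sp (TT g (y : ℂ) / K))).eval ((β : ℂ) * TT g (y : ℂ) ^ p / K) = 0}).Finite :=
    (fin_D hd hg hK hD).union (hW.biUnion fun β _ => fin_W h hNp hΨ2 hd hg hK _)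
  obtain ⟨l, a, b, k, t, hy⟩ := thue hd _ hS (p + 1 + K)
  have hlK : ¬ (l : ℤ) ∣ (K : ℤ) := by
    intro hdv
    have := Nat.le_of_dvd (Nat.pos_of_ne_zero hK) (Int.natCast_dvd_natCast.1 hdv)
    have := t.lt
    omega
  have hb0 : (b : ℂ) ≠ 0 := by
    intro h0
    have : b = 0 := by exact_mod_cast h0
    exact t.lb (by rw [this]; exact dvd_zero _)
  obtain ⟨n1, n2, e⟩ := bag_ne t hg
  have hTT : TT g (((a : ℚ) / b : ℚ) : ℂ) = (b + a * g) / (b - a * g) := by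
    unfold TT; push_cast
    rw [div_eq_div_iff (by
      intro h0; apply n2
      have : (b : ℂ) * (1 - g * (a / b)) = 0 := by rw [h0, mul_zero]
      rw [← this]; field_simp) n2]
    field_simp
  simp only [Set.mem_union, Set.mem_setOf_eq, Set.mem_iUnion, not_or, not_exists, hTT] at hy
  refine ⟨l, a, b, k, t, hlK, hy.1, fun y hyy => ?_⟩
  let TE : E := (b + a * gE) / (b - a * gE)
  let xE : E := TT gE (y : E)
  have vT : ((TE : E) : ℂ) = (b + a * g) / (b - a * g) := by simp [TE, gE]
  have vx : ((xE : E) : ℂ) = TT g (y : ℂ) := by simp [xE, TT, gE]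
  have m1 := one_sub_ne hd hgE y
  have m2 := one_add_ne hd hgE y
  have hx0 : xE ≠ 0 := div_ne_zero m2 m1
  have h1 : (Ψ.map (sp (TE / K))).eval (xE / K) = 0 := by
    apply E.val.toRingHom.injective
    rw [map_zero, ← eval_map_apply, map_hom]
    have e1 : E.val.toRingHom (TE / K) = (b + a * g) / (b - a * g) / K := by rw [map_div₀, map_natCast, ← vT]; rfl
    have e2 : E.val.toRingHom (xE / K) = TT g (y : ℂ) / K := by rw [map_div₀, map_natCast, ← vx]; rfl
    rw [e1, e2]; exact hyy
  obtain ⟨σ, hσ⟩ : ∃ σ : E ≃ₐ[ℚ] E, σ gE = -gE := by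
    have : ¬ ∀ σ : E ≃ₐ[ℚ] E, σ gE = gE := by
      rw [← IsGalois.mem_bot_iff_fixed, IntermediateField.mem_bot]
      rintro ⟨q, hq⟩
      apply d_nsq hd q
      rw [← hq] at hgE
      have := congrArg (Subtype.val) hgE
      have h3 : ((q : ℂ)) ^ 2 = d := by simpa using this
      exact_mod_cast h3
    push Not at this
    obtain ⟨σ, hσ⟩ := this
    refine ⟨σ, ?_⟩
    have : (σ gE) ^ 2 = gE ^ 2 := by rw [← map_pow, hgE]; simp
    exact (sq_eq_sq_iff_eq_or_eq_neg.1 this).resolve_left hσ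
  have h2 : (Ψ.map (sp (TE⁻¹ / K))).eval (xE⁻¹ / K) = 0 := by
    have := ev_hom (σ : E →+* E) h1
    have e1 : (σ : E →+* E) (TE / K) = TE⁻¹ / K := by
      change σ _ = _
      simp only [TE, map_div₀, map_add, map_sub, map_mul, map_intCast, map_natCast, hσ, inv_div]
      ring_nf
    have e2 : (σ : E →+* E) (xE / K) = xE⁻¹ / K := by
      change σ _ = _
      simp only [xE, TT, map_div₀, map_add, map_sub, map_mul, map_one, map_ratCast, map_natCast, hσ, inv_div]
      ring_nf
    rw [e1, e2] at this; exact this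
  have hmem := fp_mem (E := E) (by
    rw [hfr]; intro hdv
    have := Nat.le_of_dvd (by norm_num) hdv
    have : p = 2 := by omega
    rw [this] at hodd; exact absurd hodd (by decide)) hΨ hd t (by omega) (by omega) hlK hgE rfl hx0 h1 h2
  refine hy.2 _ hmem ?_
  rw [← hyy]
  congr 1
  have hT0 : (b + a * g) / (b - a * g) ≠ 0 := div_ne_zero n1 n2
  have : ((xE / TE ^ p : E) : ℂ) = TT g (y : ℂ) / ((b + a * g) / (b - a * g)) ^ p := by
    rw [← vx, ← vT]; simp
  rw [this, div_mul_cancel₀ _ (pow_ne_zero _ hT0)]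
end Shih

set_option maxHeartbeats 400000
set_option linter.all false
namespace Shih
open NumberField Polynomial

variable {p : ℕ} [hp : Fact p.Prime] {Ω : Type} [Field Ω] [Algebra ℚ Ω] [IsGalois ℚ Ω]

theorem exists_rho {ι : Type} (Y : ι → Ω) (hinj : Function.Injective Y) (R : Subgroup (Equiv.Perm ι))
    (hY : ∀ τ : Ω ≃ₐ[ℚ] Ω, ∃ σ ∈ R, ∀ i, τ (Y i) = Y (σ i)) :
    ∃ ρ : (Ω ≃ₐ[ℚ] Ω) →* Equiv.Perm ι, ρ.range ≤ R ∧ ∀ τ i, τ (Y i) = Y (ρ τ i) := by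
  choose f hf hf2 using hY
  refine ⟨MonoidHom.mk' f ?_, ?_, hf2⟩
  · intro a b
    ext i
    apply hinj
    rw [← hf2, AlgEquiv.mul_apply, hf2 b, hf2 a]; rfl
  · rintro _ ⟨τ, rfl⟩
    exact hf τ

theorem exists_sub {k : Type} {Ω : Type} [Field k] [CharZero k] [Field Ω] [Algebra k Ω] [IsGalois k Ω] {S : Set Ω} (hS : S.Finite)
    (hst : ∀ (τ : Ω ≃ₐ[k] Ω), ∀ x ∈ S, τ x ∈ IntermediateField.adjoin k S) :
    ∃ (F : Type) (_ : Field F) (_ : Algebra k F) (e : F →ₐ[k] Ω) (res : (Ω ≃ₐ[k] Ω) →* (F ≃ₐ[k] F)),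
      FiniteDimensional k F ∧ IsGalois k F ∧ (∀ x ∈ S, ∃ y, e y = x) ∧ Function.Surjective res ∧
      (∀ τ, res τ = 1 ↔ ∀ x ∈ S, τ x = x) ∧ ∀ τ x, e (res τ x) = τ (e x) := by
  have hn : Normal k (IntermediateField.adjoin k S) := by
    rw [IntermediateField.normal_iff_forall_map_le']
    intro σ
    rw [IntermediateField.adjoin_map, IntermediateField.adjoin_le_iff]
    rintro _ ⟨x, hx, rfl⟩
    exact hst σ x hx
  have : Finite S := hS
  refine ⟨IntermediateField.adjoin k S, inferInstance, inferInstance, IntermediateField.val _,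
    AlgEquiv.restrictNormalHom _, IntermediateField.finiteDimensional_adjoin (fun x _ => (Algebra.IsIntegral.isIntegral x)),
    {}, fun x hx => ⟨⟨x, IntermediateField.subset_adjoin _ _ hx⟩, rfl⟩, AlgEquiv.restrictNormalHom_surjective Ω, ?_,
    fun τ x => AlgEquiv.restrictNormal_commutes τ _ x⟩
  intro τ
  constructor
  · intro h x hx
    have := AlgEquiv.restrictNormal_commutes τ (IntermediateField.adjoin k S) ⟨x, IntermediateField.subset_adjoin _ _ hx⟩
    have h2 : τ.restrictNormal (IntermediateField.adjoin k S) = 1 := h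
    rw [h2] at this
    exact this.symm
  · intro h
    ext ⟨x, hx⟩
    have h1 := AlgEquiv.restrictNormal_commutes τ (IntermediateField.adjoin k S) ⟨x, hx⟩
    have h2 : τ x = x := by
      clear h1
      induction hx using IntermediateField.adjoin_induction with
      | mem x hx => exact h x hx
      | algebraMap x => simp
      | add x y _ _ hx hy => rw [map_add, hx, hy]
      | inv x _ hx => rw [map_inv₀, hx]
      | mul x y _ _ hx hy => rw [map_mul, hx, hy]
    exact h1.trans h2

theorem conclude {Y : OnePoint (ZMod p) → Ω} (hinj : Function.Injective Y) (ρ : (Ω ≃ₐ[ℚ] Ω) →* Equiv.Perm (OnePoint (ZMod p)))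
    (hρ : ∀ τ i, τ (Y i) = Y (ρ τ i)) (hr : ρ.range = (act p).range) :
    ∃ (M : Type) (_ : Field M) (_ : Algebra ℚ M),
      FiniteDimensional ℚ M ∧ IsGalois ℚ M ∧
        Nonempty ((M ≃ₐ[ℚ] M) ≃* (Matrix.SpecialLinearGroup (Fin 2) (ZMod p) ⧸
            Subgroup.center (Matrix.SpecialLinearGroup (Fin 2) (ZMod p)))) := by
  obtain ⟨M, iF, iA, e, res, hfd, hG, -, hsur, hker, -⟩ := exists_sub (k := ℚ) (Set.finite_range Y) (by
    rintro τ _ ⟨i, rfl⟩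
    rw [hρ]
    exact IntermediateField.subset_adjoin _ _ ⟨_, rfl⟩)
  refine ⟨M, iF, iA, hfd, hG, ?_⟩
  have hk : res.ker = ρ.ker := by
    ext τ
    rw [MonoidHom.mem_ker, MonoidHom.mem_ker, hker]
    constructor
    · intro h
      ext i
      apply hinj
      rw [← hρ]
      exact h _ ⟨i, rfl⟩
    · rintro h _ ⟨i, rfl⟩
      rw [hρ, h]; rfl
  have e1 := QuotientGroup.quotientKerEquivOfSurjective res hsur
  have e2 := QuotientGroup.quotientMulEquivOfEq hk
  have e3 := QuotientGroup.quotientKerEquivRange ρ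
  have e4 := MulEquiv.subgroupCongr hr
  have e5 := QuotientGroup.quotientKerEquivRange (act p)
  have e6 := QuotientGroup.quotientMulEquivOfEq (act_ker (p := p))
  exact ⟨e1.symm.trans (e2.trans (e3.trans (e4.trans (e5.symm.trans e6))))⟩

/-- fixed by everything implies rational -/
theorem rat_of_fixed (x : Ω) (h : ∀ τ : Ω ≃ₐ[ℚ] Ω, τ x = x) : ∃ y : ℚ, algebraMap ℚ Ω y = x := by
  have := (InfiniteGalois.mem_bot_iff_fixed (k := ℚ) x).2 h
  exact IntermediateField.mem_bot.1 this

theorem exists_neg {d : ℤ} (hd : d.natAbs = p) {g : Ω} (hg : g ^ 2 = d) : ∃ τ : Ω ≃ₐ[ℚ] Ω, τ g = -g := by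
  by_contra! hcon
  have : ∀ τ : Ω ≃ₐ[ℚ] Ω, τ g = g := by
    intro τ
    have : (τ g) ^ 2 = g ^ 2 := by rw [← map_pow, hg]; simp
    exact (sq_eq_sq_iff_eq_or_eq_neg.1 this).resolve_right (hcon τ)
  obtain ⟨y, hy⟩ := rat_of_fixed g this
  refine d_nsq hd y ?_
  have : algebraMap ℚ Ω (y ^ 2) = algebraMap ℚ Ω d := by rw [map_pow, hy, hg]; simp
  exact (algebraMap ℚ Ω).injective this

theorem place_exists (F : Type) [Field F] [NumberField F] {l : ℕ} (hl : l.Prime) :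
    ∃ w : IsDedekindDomain.HeightOneSpectrum (𝓞 F), w.valuation F (l : F) < 1 := by
  have hl0 : ((l : ℕ) : 𝓞 F) ≠ 0 := by exact_mod_cast hl.ne_zero
  have hu : ¬ IsUnit ((l : ℕ) : 𝓞 F) := by
    intro hu
    have := NumberField.isUnit_iff_norm.1 hu
    have h2 : RingOfIntegers.norm ℚ ((l : ℕ) : 𝓞 F) = ((l : ℕ) : 𝓞 ℚ) ^ Module.finrank ℚ F := by
      apply RingOfIntegers.ext
      simp
      have := Algebra.norm_algebraMap (R := ℚ) (S := F) (l : ℚ)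
      simpa using this
    rw [h2] at this
    simp at this
    have h3 : (1 : ℚ) < l := by exact_mod_cast hl.one_lt
    have h4 : Module.finrank ℚ F ≠ 0 := Module.finrank_pos.ne'
    have := (one_lt_pow₀ h3 h4).ne'
    contradiction
  obtain ⟨I, hI, hmem⟩ := exists_max_ideal_of_mem_nonunits hu
  refine ⟨⟨I, hI.isPrime, ?_⟩, ?_⟩
  · rintro rfl
    exact hl0 (by simpa using hmem)
  · have := (IsDedekindDomain.HeightOneSpectrum.valuation_lt_one_iff_mem (K := F) ⟨I, hI.isPrime, by rintro rfl; exact hl0 (by simpa using hmem)⟩ ((l : ℕ) : 𝓞 F)).2 hmem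
    simpa using this
end Shih

set_option maxHeartbeats 400000
set_option linter.all false
namespace Shih
open NumberField Polynomial

variable {p : ℕ} [hp : Fact p.Prime]

theorem dvd_finrank (hodd : Odd p) {F : Type} [Field F] [NumberField F] [IsGalois ℚ F] {Ψ : ℤ[X][X]} (hΨ : PsiOK p Ψ)
    {d : ℤ} (hd : d.natAbs = p) {g : F} (hg : g ^ 2 = d) {K B l : ℕ} {a b k : ℤ} (t : TD p d B l a b k)
    (hB : p + 1 ≤ B) (hK : ¬ (l : ℤ) ∣ (K : ℤ)) {ξ : OnePoint (ZMod p) → F}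
    (h : Ψ.map (sp ((b + a * g) / (b - a * g) / (K : F))) = ∏ i, (X - C (ξ i))) : p ∣ Module.finrank ℚ F := by
  have hp1 := hp.out.two_le
  obtain ⟨w, hw⟩ := place_exists F t.prime
  have hK1 : w.valuation F (K : F) = 1 := by
    have := v_unit (w.valuation F) t.prime hw hK
    simpa using this
  have hK0 : (K : F) ≠ 0 := by
    intro h0; rw [h0] at hK1; simp at hK1
  obtain ⟨hn1, hn2, -⟩ := bag_ne t hg
  rcases place (w.valuation F) t (by omega) hB hg hw with ⟨h1, h2⟩ | ⟨h1, h2⟩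
  · refine div_of_place hodd hΨ card_onePoint h ?_ w t.prime hw ?_
    · positivity
    · rw [map_div₀, map_div₀, h1, h2, hK1]; simp
  · obtain ⟨τ, hτ⟩ := exists_neg hd hg
    have h' := congrArg (Polynomial.map (τ : F →+* F)) h
    rw [map_hom, Polynomial.map_prod] at h'
    simp only [Polynomial.map_sub, map_X, map_C] at h'
    refine div_of_place hodd hΨ card_onePoint h' ?_ w t.prime hw ?_
    · rw [Ne, map_eq_zero]; positivity
    · have : (τ : F →+* F) ((b + a * g) / (b - a * g) / (K : F)) = (b - a * g) / (b + a * g) / K := by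
        change τ _ = _
        simp only [map_div₀, map_sub, map_add, map_mul, hτ, map_intCast, map_natCast]
        ring
      rw [this, map_div₀, map_div₀, h1, h2, hK1]; simp

variable {Ω : Type} [Field Ω] [Algebra ℚ Ω] [IsGalois ℚ Ω]

theorem Y_spec {ι : Type} {g : Ω} (hg0 : g ≠ 0) {K : Ω} (hK : K ≠ 0) (h2 : (2 : Ω) ≠ 0) {x : Ω} (hx : K * x + 1 ≠ 0) :
    x = TT g ((K * x - 1) / (g * (K * x + 1))) / K := by
  have e1 : 1 + g * ((K * x - 1) / (g * (K * x + 1))) = 2 * K * x / (K * x + 1) := by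
    field_simp; ring
  have e2 : 1 - g * ((K * x - 1) / (g * (K * x + 1))) = 2 / (K * x + 1) := by
    field_simp; ring
  unfold TT
  rw [e1, e2, div_div_div_cancel_right₀ hx]
  field_simp

theorem main_alg (hodd : Odd p) {Ψ : ℤ[X][X]} (hΨ : PsiOK p Ψ)
    {d : ℤ} (hd : d.natAbs = p) {g : Ω} (hg : g ^ 2 = d) {K B l : ℕ} {a b k : ℤ} (t : TD p d B l a b k)
    (hB : p + 1 ≤ B) (hK : ¬ (l : ℤ) ∣ (K : ℤ)) {ξ : OnePoint (ZMod p) → Ω}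
    (h : Ψ.map (sp ((b + a * g) / (b - a * g) / (K : Ω))) = ∏ i, (X - C (ξ i)))
    (hξ : Function.Injective ξ) (hξ0 : ∀ i, ξ i ≠ 0) (hξ1 : ∀ i, (K : Ω) * ξ i + 1 ≠ 0)
    (hgal : ∀ τ : Ω ≃ₐ[ℚ] Ω, ∃ σ ∈ (act p).range, (τ g = g ∧ ∀ i, τ (ξ i) = ξ (σ i)) ∨
      (τ g = -g ∧ ∀ i, τ (ξ i) = 1 / ((K : Ω) ^ 2 * ξ (σ i))))
    (hno : ∀ y : ℚ, (Ψ.map (sp ((b + a * g) / (b - a * g) / (K : Ω)))).eval (TT g (y : Ω) / K) ≠ 0) :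
    ∃ (M : Type) (_ : Field M) (_ : Algebra ℚ M),
      FiniteDimensional ℚ M ∧ IsGalois ℚ M ∧
        Nonempty ((M ≃ₐ[ℚ] M) ≃* (Matrix.SpecialLinearGroup (Fin 2) (ZMod p) ⧸
            Subgroup.center (Matrix.SpecialLinearGroup (Fin 2) (ZMod p)))) := by
  have hch : CharZero Ω := algebraRat.charZero Ω
  have hK0 : (K : Ω) ≠ 0 := by
    intro h0
    have : K = 0 := by exact_mod_cast h0
    rw [this] at hK; simp at hK
  have hg0 : g ≠ 0 := by
    rintro rfl
    have : d = 0 := by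
      have : (d : Ω) = 0 := by rw [← hg]; ring
      exact_mod_cast this
    rw [this] at hd; exact hp.out.ne_zero (by simpa using hd.symm)
  have hYs : ∀ i, ξ i = TT g (((K : Ω) * ξ i - 1) / (g * ((K : Ω) * ξ i + 1))) / K := fun i =>
    Y_spec (ι := ℕ) hg0 hK0 two_ne_zero (hξ1 i)
  set Y : OnePoint (ZMod p) → Ω := fun i => ((K : Ω) * ξ i - 1) / (g * ((K : Ω) * ξ i + 1)) with hYd
  have hYs : ∀ i, ξ i = TT g (Y i) / K := hYs
  have hinj : Function.Injective Y := fun i j hij => hξ (by rw [hYs i, hYs j, hij])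
  have hY : ∀ τ : Ω ≃ₐ[ℚ] Ω, ∃ σ ∈ (act p).range, ∀ i, τ (Y i) = Y (σ i) := by
    intro τ
    obtain ⟨σ, hσ, h1 | h1⟩ := hgal τ
    · refine ⟨σ, hσ, fun i => ?_⟩
      simp only [hYd, map_div₀, map_sub, map_mul, map_add, map_natCast, map_one, h1.1, h1.2]
    · refine ⟨σ, hσ, fun i => ?_⟩
      simp only [hYd, map_div₀, map_sub, map_mul, map_add, map_natCast, map_one, h1.1, h1.2]
      have := hξ1 (σ i)
      have h0 := hξ0 (σ i)
      have e1 : (K : Ω) * (1 / ((K : Ω) ^ 2 * ξ (σ i))) - 1 = -(K * ξ (σ i) - 1) / (K * ξ (σ i)) := by field_simp; ring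
      have e2 : (K : Ω) * (1 / ((K : Ω) ^ 2 * ξ (σ i))) + 1 = (K * ξ (σ i) + 1) / (K * ξ (σ i)) := by field_simp; ring
      rw [e1, e2]
      field_simp
  obtain ⟨ρ, hρ1, hρ⟩ := exists_rho Y hinj _ hY
  refine conclude hinj ρ hρ (perm_sub_top _ hρ1 ?_ ?_)
  · obtain ⟨F, iF, iA, e, res, hfd, hG, hsurj, hsur, hker, hcomm⟩ := exists_sub (k := ℚ) (S := {g} ∪ Set.range ξ)
      ((Set.finite_singleton g).union (Set.finite_range ξ)) (by
        intro τ
        obtain ⟨σ, -, h1⟩ := hgal τ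
        have m1 : g ∈ IntermediateField.adjoin ℚ ({g} ∪ Set.range ξ) := IntermediateField.subset_adjoin _ _ (by simp)
        have m2 : ∀ i, ξ i ∈ IntermediateField.adjoin ℚ ({g} ∪ Set.range ξ) := fun i => IntermediateField.subset_adjoin _ _ (by simp)
        rintro x (hx | ⟨i, rfl⟩)
        · rw [Set.mem_singleton_iff] at hx
          subst hx
          rcases h1 with h1 | h1
          · rw [h1.1]; exact m1
          · rw [h1.1]; exact neg_mem m1
        · rcases h1 with h1 | h1
          · rw [h1.2]; exact m2 _
          · rw [h1.2]; exact div_mem (one_mem _) (mul_mem (pow_mem (natCast_mem _ _) _) (m2 _)))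
    have hfr : p ∣ Nat.card (F ≃ₐ[ℚ] F) := by
      obtain ⟨g', hg'⟩ := hsurj g (by simp)
      choose ξ' hξ' using fun i => hsurj (ξ i) (by simp)
      have hcF : CharZero F := algebraRat.charZero F
      have hes : e ((b + a * g') / (b - a * g') / (K : F)) = (b + a * g) / (b - a * g) / (K : Ω) := by
        simp only [map_div₀, map_sub, map_add, map_mul, hg', map_intCast, map_natCast]
      have h' : Ψ.map (sp ((b + a * g') / (b - a * g') / (K : F))) = ∏ i, (X - C (ξ' i)) := by
        apply Polynomial.map_injective (e : F →+* Ω) (e : F →+* Ω).injective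
        rw [map_hom, Polynomial.map_prod]
        simp only [Polynomial.map_sub, map_X, map_C]
        rw [show (e : F →+* Ω) ((b + a * g') / (b - a * g') / (K : F)) = _ from hes, h]
        refine Finset.prod_congr rfl fun i _ => ?_
        rw [show (e : F →+* Ω) (ξ' i) = _ from hξ' i]
      have hg2 : g' ^ 2 = d := by
        apply (e : F →+* Ω).injective
        rw [map_pow, show (e : F →+* Ω) g' = _ from hg', hg, map_intCast]
      rw [IsGalois.card_aut_eq_finrank]
      clear hcomm hker hsur hsurj hξ' hg' hes
      clear res e
      obtain rfl : iA = DivisionRing.toRatAlgebra := Subsingleton.elim _ _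
      have : NumberField F := { to_charZero := hcF, to_finiteDimensional := hfd }
      exact dvd_finrank hodd hΨ hd hg2 t hB hK h'
    obtain ⟨τ', hτ'⟩ := exists_prime_orderOf_dvd_card' p hfr
    obtain ⟨τ, rfl⟩ := hsur τ'
    have hp1 : res (τ ^ p) = 1 := by rw [map_pow, ← hτ', pow_orderOf_eq_one]
    have hfixp := (hker _).1 hp1
    have hgp : (τ ^ p) g = g := hfixp g (by simp)
    have hne : res τ ≠ 1 := by
      intro h1; rw [h1, orderOf_one] at hτ'; exact hp.out.one_lt.ne hτ'
    have hτg : τ g = g := by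
      obtain ⟨σ, -, h1 | h1⟩ := hgal τ
      · exact h1.1
      · exfalso
        have : ∀ n : ℕ, (τ ^ n) g = (-1) ^ n * g := by
          intro n
          induction n with
          | zero => simp
          | succ n ih => rw [pow_succ', AlgEquiv.mul_apply, ih, map_mul, h1.1]; simp; ring
        rw [this, hodd.neg_one_pow] at hgp
        have : (2 : Ω) * g = 0 := by linear_combination -hgp
        simp [hg0] at this
    have hYfix : ∀ τ : Ω ≃ₐ[ℚ] Ω, τ g = g → ((∀ i, τ (ξ i) = ξ i) ↔ ρ τ = 1) := by
      intro τ hτ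
      constructor
      · intro hx
        ext i
        apply hinj
        rw [← hρ]
        simp only [hYd, map_div₀, map_sub, map_mul, map_add, map_natCast, map_one, hτ, hx]
        rfl
      · intro h1 i
        have : τ (Y i) = Y i := by rw [hρ, h1]; rfl
        rw [hYs i]
        simp only [TT, map_div₀, map_sub, map_mul, map_add, map_natCast, map_one, hτ, this]
    have hr1 : ρ τ ^ p = 1 := by
      rw [← map_pow]
      exact (hYfix _ hgp).1 (fun i => hfixp _ (by simp))
    have hr2 : ρ τ ≠ 1 := by
      intro h1
      apply hne
      rw [hker]
      rintro x (hx | ⟨i, rfl⟩)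
      · rw [Set.mem_singleton_iff] at hx
        rw [hx, hτg]
      · exact (hYfix τ hτg).2 h1 i
    have h8 := orderOf_eq_prime hr1 hr2
    have h9 : orderOf (ρ τ) ∣ Nat.card ρ.range := Subgroup.orderOf_dvd_natCard _ ⟨τ, rfl⟩
    exact (dvd_of_eq h8.symm).trans h9
  · intro i
    by_contra! hcon
    obtain ⟨y, hy⟩ := rat_of_fixed (Y i) (fun τ => by rw [hρ, hcon _ ⟨τ, rfl⟩])
    apply hno y
    have : (y : Ω) = Y i := by rw [← hy]; simp
    rw [this, ← hYs i, h, Polynomial.eval_prod]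
    exact Finset.prod_eq_zero (Finset.mem_univ i) (by simp)
end Shih

set_option maxHeartbeats 400000
set_option linter.all false
namespace Shih
open NumberField Polynomial

theorem acl_gal {k E : Type} [Field k] [CharZero k] [Field E] [Algebra k E] [IsAlgClosed E] : IsGalois k (algebraicClosure k E) := by
  have : IsAlgClosure k (algebraicClosure k E) := inferInstance
  have : Normal k (algebraicClosure k E) := IsAlgClosure.normal _ _
  exact {}

variable {p : ℕ} [hp : Fact p.Prime] {N m : ℕ}

theorem shih_main (hodd : Odd p) (h : NM N m) (hN : ¬ IsSquare (N : ZMod p)) :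
    ∃ (M : Type) (_ : Field M) (_ : Algebra ℚ M),
      FiniteDimensional ℚ M ∧ IsGalois ℚ M ∧
        Nonempty ((M ≃ₐ[ℚ] M) ≃* (Matrix.SpecialLinearGroup (Fin 2) (ZMod p) ⧸
            Subgroup.center (Matrix.SpecialLinearGroup (Fin 2) (ZMod p)))) := by
  have hNp : (N : ZMod p) ≠ 0 := by
    intro h0; exact hN (by rw [h0]; exact IsSquare.zero)
  obtain ⟨Ψ, h1, h2, h3, h4, h5, h6⟩ := exists_Psi' h hodd hNp
  have hΨ : PsiOK p Ψ := ⟨h1, h2, h4, h5, h6⟩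
  obtain ⟨D, hD, hD2⟩ := A5 h hNp
  obtain ⟨d, hd, hg⟩ := gs_sq p hodd
  obtain ⟨l, a, b, k, t, hlK, hsD, hno⟩ := exists_TD hodd h hNp hΨ h3 hd hg hD
  obtain ⟨hn1, hn2, -⟩ := bag_ne t hg
  have hNpos := h.pos
  have hK0 : ((N ^ m : ℕ) : ℂ) ≠ 0 := by exact_mod_cast (pow_pos hNpos m).ne'
  obtain ⟨z, hz, hzs⟩ := hm_surj h ((b + a * gs p) / (b - a * gs p) / ((N ^ m : ℕ) : ℂ)) (div_ne_zero (div_ne_zero hn1 hn2) hK0)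
  obtain ⟨hinj, hξ1⟩ := hD2 z hz (by rw [hzs]; exact hsD)
  have hprod := h3 z hz
  -- membership in the algebraic closure
  set Ω := algebraicClosure ℚ ℂ with hΩ
  have hζm : zt p ∈ Ω := by
    rw [hΩ, mem_algebraicClosure_iff]
    exact ((zt_prim (p := p)).isIntegral hp.out.pos).tower_top.isAlgebraic
  have hgm : gs p ∈ Ω := gs_mem p Ω hζm
  have hsm : hm N m z ∈ Ω := by
    rw [hzs]
    exact div_mem (div_mem (add_mem (intCast_mem _ _) (mul_mem (intCast_mem _ _) hgm))
      (sub_mem (intCast_mem _ _) (mul_mem (intCast_mem _ _) hgm))) (natCast_mem _ _)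
  have hprod' : Ψ.map (sp (hm N m z)) = ∏ i, (X - C (sk N m p i z)) := hprod
  have hξm : ∀ i, sk N m p i z ∈ Ω := by
    intro i
    have e1 := map_hom (algebraMap Ω ℂ) ⟨_, hsm⟩ Ψ
    have hr : (Ψ.map (sp (hm N m z))).eval (sk N m p i z) = 0 := by
      rw [hprod', eval_prod]
      exact Finset.prod_eq_zero (Finset.mem_univ i) (by simp)
    have e1' : (Ψ.map (sp (⟨_, hsm⟩ : Ω))).map (algebraMap Ω ℂ) = Ψ.map (sp (hm N m z)) := e1
    rw [← e1', eval_map] at hr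
    have hinte : IsIntegral Ω (sk N m p i z) := ⟨Ψ.map (sp (⟨_, hsm⟩ : Ω)), h1.map _, hr⟩
    rw [hΩ, mem_algebraicClosure_iff]
    have : Algebra.IsAlgebraic ℚ Ω := algebraicClosure.isAlgebraic ℚ ℂ
    exact IsAlgebraic.restrictScalars ℚ hinte.isAlgebraic
  obtain ⟨ξ, hξ⟩ : ∃ ξ : OnePoint (ZMod p) → Ω, ∀ i, (ξ i : ℂ) = sk N m p i z := ⟨fun i => ⟨_, hξm i⟩, fun i => rfl⟩
  obtain ⟨ζ, hζ⟩ : ∃ ζ : Ω, (ζ : ℂ) = zt p := ⟨⟨_, hζm⟩, rfl⟩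
  obtain ⟨g, hg'⟩ : ∃ g : Ω, (g : ℂ) = gs p := ⟨⟨_, hgm⟩, rfl⟩
  have hgal : IsGalois ℚ Ω := by
    convert acl_gal (k := ℚ) (E := ℂ)
    exact Subsingleton.elim _ _
  have hval : ∀ x : Ω, algebraMap Ω ℂ x = (x : ℂ) := fun x => rfl
  have hsval : algebraMap Ω ℂ ((b + a * g) / (b - a * g) / ((N ^ m : ℕ) : Ω)) = hm N m z := by
    rw [hzs]
    simp only [map_div₀, map_sub, map_add, map_mul, map_intCast, map_natCast]
    simp only [hval, hg']
  obtain ⟨s0, hs0⟩ : ∃ s0 : Ω, s0 = (b + a * g) / (b - a * g) / ((N ^ m : ℕ) : Ω) := ⟨_, rfl⟩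
  have hs : (s0 : ℂ) = hm N m z := by rw [hs0]; exact hsval
  refine main_alg (Ω := Ω) hodd hΨ hd (g := g) ?_ t (by omega) hlK (ξ := ξ) ?_ ?_ ?_ ?_ ?_ ?_
  · apply (algebraMap Ω ℂ).injective
    rw [map_pow, hval, hg', hg, map_intCast]
  · apply Polynomial.map_injective (algebraMap Ω ℂ) (algebraMap Ω ℂ).injective
    rw [map_hom, Polynomial.map_prod, hsval, hprod']
    simp only [Polynomial.map_sub, map_X, map_C, hval, hξ]
  · intro i j hij
    apply hinj
    simp only [← hξ, hij]
  · intro i h0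
    apply sk_ne h i hz
    rw [← hξ, h0]; rfl
  · intro i h0
    apply hξ1 i
    rw [← hξ]
    have := congrArg (algebraMap Ω ℂ) h0
    simpa [hval] using this
  · intro τ
    let φ : Ω →+* ℂ := (algebraMap Ω ℂ).comp (τ : Ω →+* Ω)
    have hφ : ∀ x, φ x = (τ x : ℂ) := fun x => rfl
    obtain ⟨c, hc, hc1, hc2⟩ := gal_gs p Ω φ ζ g hζ hg'
    by_cases hsq : IsSquare (c : ZMod p)
    · have hgg := hc1 hsq
      have hgg' : τ g = g := Subtype.ext hgg
      have hs' : φ s0 = s0 := by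
        rw [hφ, hs0]
        simp only [map_div₀, map_sub, map_add, map_mul, map_intCast, map_natCast, hgg']
      obtain ⟨σ, hσ, h8⟩ := gal_sq h hNp Ω φ ζ s0 ξ z hz hζ hs hξ c hc hsq hs'
      exact ⟨σ, hσ, Or.inl ⟨hgg', fun i => Subtype.ext (h8 i)⟩⟩
    · have hgg := hc2 hsq
      have hgg' : τ g = -g := Subtype.ext hgg
      have hs' : φ s0 = 1 / (((N : ℂ) ^ m) ^ 2 * s0) := by
        rw [hφ]
        have : τ s0 = (b - a * g) / (b + a * g) / ((N ^ m : ℕ) : Ω) := by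
          rw [hs0]
          simp only [map_div₀, map_sub, map_add, map_mul, map_intCast, map_natCast, hgg']
          ring
        rw [this, hs, hzs, ← hval]
        simp only [map_div₀, map_sub, map_add, map_mul, map_intCast, map_natCast]
        simp only [hval, hg']
        push_cast at hK0 ⊢
        field_simp
      obtain ⟨σ, hσ, h8⟩ := gal_nsq h hN Ω φ ζ s0 ξ z hz hζ hs hξ c hc hsq hs'
      refine ⟨σ, hσ, Or.inr ⟨hgg', fun i => ?_⟩⟩
      apply (algebraMap Ω ℂ).injective
      have := h8 i
      rw [hφ] at this
      rw [hval, this]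
      simp [hval]
  · intro y h0
    apply hno y
    have e := ev_hom (algebraMap Ω ℂ) h0
    rw [hsval] at e
    rw [← hzs, ← e]
    congr 1
    simp [TT, hval, hg']

end Shih


/-- **Shih.** Let `p` be an odd prime such that `2`, `3` or `7` is a quadratic
non-residue modulo `p`. Then `PSL(2, p)`, the quotient of `SL(2, 𝔽_p)` by its center,
occurs as a Galois group over `ℚ`. -/
theorem psl_two_occurs_as_galoisGroup_over_rat (p : ℕ) [Fact p.Prime] (hodd : Odd p)
    (hqnr : ¬ IsSquare (2 : ZMod p) ∨ ¬ IsSquare (3 : ZMod p) ∨ ¬ IsSquare (7 : ZMod p)) :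
    ∃ (M : Type) (_ : Field M) (_ : Algebra ℚ M),
      FiniteDimensional ℚ M ∧ IsGalois ℚ M ∧
        Nonempty ((M ≃ₐ[ℚ] M) ≃*
          (Matrix.SpecialLinearGroup (Fin 2) (ZMod p) ⧸
            Subgroup.center (Matrix.SpecialLinearGroup (Fin 2) (ZMod p)))) := by
  rcases hqnr with h | h | h
  · exact Shih.shih_main (N := 2) (m := 6) hodd (Or.inl ⟨rfl, rfl⟩) (by exact_mod_cast h)
  · exact Shih.shih_main (N := 3) (m := 3) hodd (Or.inr (Or.inl ⟨rfl, rfl⟩)) (by exact_mod_cast h)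
  · exact Shih.shih_main (N := 7) (m := 1) hodd (Or.inr (Or.inr ⟨rfl, rfl⟩)) (by exact_mod_cast h)
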